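/- There exists a constant c₃ > 0 with the following property. Let q ≥ 2 be an integer, let θ₃(q) := Σ_{n=0}^∞ q^{-n³}, let A > 1.1 be a real number, and let α₀, α₁, α₂, α₃ be integers with |α_j| ≤ q^A for all j and α₃ ≠ 0. Then |α₀ + α₁·θ₃(q) + α₂·θ₃(q)² + α₃·θ₃(q)³| > exp( − (log q) · exp( c₃ · A² · (log A)² ) ). -/

import Mathlib

/-- The cubic theta value `θ₃(q) = ∑_{n=0}^∞ q^{-n³}`. -/
noncomputable def theta3 (q : ℕ) : ℝ := ∑' n : ℕ, (1 : ℝ) / (q : ℝ) ^ (n ^ 3)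

/-- The ring of Eisenstein integers `ℤ[ω]`, `ω² = -1 - ω`. -/
abbrev Eis := QuadraticAlgebra ℤ (-1) (-1)

namespace Eis

/-- The primitive cube root of unity in `ℂ` used for the embedding. -/
noncomputable def rootC : ℂ := ⟨-1 / 2, √3 / 2⟩

lemma rootC_sq : rootC * rootC = -1 - rootC := by
  have h : √3 * √3 = (3 : ℝ) := Real.mul_self_sqrt (by norm_num)
  apply Complex.ext
  · simp [rootC]; nlinarith
  · simp [rootC]; ring

lemma norm_eq (z : Eis) : z.norm = z.re ^ 2 - z.re * z.im + z.im ^ 2 := by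
  rw [QuadraticAlgebra.norm_def]; ring

lemma four_norm (z : Eis) : 4 * z.norm = (2 * z.re - z.im) ^ 2 + 3 * z.im ^ 2 := by
  rw [norm_eq]; ring

lemma norm_nonneg (z : Eis) : 0 ≤ z.norm := by
  have := four_norm z
  nlinarith [sq_nonneg (2 * z.re - z.im), sq_nonneg z.im]

lemma norm_eq_zero {z : Eis} : z.norm = 0 ↔ z = 0 := by
  constructor
  · intro h
    have h4 := four_norm z
    have h1 : z.im = 0 := by
      have : z.im ^ 2 = 0 := by nlinarith [sq_nonneg (2 * z.re - z.im), sq_nonneg z.im]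
      simpa using this
    have h2 : z.re = 0 := by
      have : z.re ^ 2 = 0 := by rw [norm_eq, h1] at h; linarith
      simpa using this
    ext <;> simp [h1, h2]
  · rintro rfl; simp

lemma norm_pos {z : Eis} (h : z ≠ 0) : 0 < z.norm :=
  lt_of_le_of_ne (norm_nonneg z) (fun hz => h (norm_eq_zero.1 hz.symm))

/-- The embedding of the Eisenstein integers into `ℂ`. -/
noncomputable def toC : Eis →+* ℂ :=
  (QuadraticAlgebra.lift (R := ℤ) (a := -1) (b := -1) (A := ℂ)
    ⟨rootC, by rw [rootC_sq]; simp; ring⟩).toRingHom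

lemma toC_apply (z : Eis) : toC z = z.re + z.im * rootC := by
  simp [toC, QuadraticAlgebra.lift]

lemma toC_re (z : Eis) : (toC z).re = z.re - z.im / 2 := by
  simp [toC_apply, rootC]; ring

lemma toC_im (z : Eis) : (toC z).im = z.im * (√3 / 2) := by
  simp [toC_apply, rootC]

lemma normSq_toC (z : Eis) : Complex.normSq (toC z) = (z.norm : ℝ) := by
  have h : √3 ^ 2 = (3 : ℝ) := Real.sq_sqrt (by norm_num)
  rw [Complex.normSq_apply, toC_re, toC_im, norm_eq]
  push_cast
  linear_combination (z.im ^ 2 / 4 : ℝ) * h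

lemma norm_toC_sq (z : Eis) : ‖toC z‖ ^ 2 = (z.norm : ℝ) := by
  rw [← normSq_toC, Complex.normSq_eq_norm_sq]

lemma toC_star (z : Eis) : toC (star z) = (starRingEnd ℂ) (toC z) := by
  apply Complex.ext
  · rw [Complex.conj_re, toC_re, toC_re, QuadraticAlgebra.re_star, QuadraticAlgebra.im_star]
    push_cast; ring
  · rw [Complex.conj_im, toC_im, toC_im, QuadraticAlgebra.im_star]
    push_cast; ring

lemma toC_injective : Function.Injective toC := by
  rw [injective_iff_map_eq_zero]
  intro z hz
  have := normSq_toC z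
  rw [hz, map_zero] at this
  exact norm_eq_zero.1 (by exact_mod_cast this.symm)

instance : IsDomain Eis := toC_injective.isDomain toC

/-- Rounded quotient. -/
def quo (x y : Eis) : Eis :=
  ⟨round (((x * star y).re : ℚ) / y.norm), round (((x * star y).im : ℚ) / y.norm)⟩

lemma norm_rem_lt (x : Eis) {y : Eis} (hy : y ≠ 0) : (x - y * quo x y).norm < y.norm := by
  have hn := norm_pos hy
  have hnq : (0 : ℚ) < y.norm := by exact_mod_cast hn
  have key : (x - y * quo x y).norm * y.norm =
      ((x * star y).re - y.norm * (quo x y).re) ^ 2 -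
      ((x * star y).re - y.norm * (quo x y).re) * ((x * star y).im - y.norm * (quo x y).im) +
      ((x * star y).im - y.norm * (quo x y).im) ^ 2 := by
    simp only [norm_eq, QuadraticAlgebra.re_sub, QuadraticAlgebra.im_sub,
      QuadraticAlgebra.re_mul, QuadraticAlgebra.im_mul, QuadraticAlgebra.re_star,
      QuadraticAlgebra.im_star]
    ring
  have e1 := abs_sub_round (((x * star y).re : ℚ) / y.norm)
  have e2 := abs_sub_round (((x * star y).im : ℚ) / y.norm)
  set u : ℚ := ((x * star y).re : ℚ) / y.norm - round (((x * star y).re : ℚ) / y.norm) with hu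
  set v : ℚ := ((x * star y).im : ℚ) / y.norm - round (((x * star y).im : ℚ) / y.norm) with hv
  have h1 : ((x * star y).re : ℚ) - y.norm * (quo x y).re = y.norm * u := by
    rw [hu, mul_sub, mul_div_cancel₀ _ hnq.ne']; rfl
  have h2 : ((x * star y).im : ℚ) - y.norm * (quo x y).im = y.norm * v := by
    rw [hv, mul_sub, mul_div_cancel₀ _ hnq.ne']; rfl
  have key2 : ((x - y * quo x y).norm : ℚ) * y.norm =
      y.norm ^ 2 * (u ^ 2 - u * v + v ^ 2) := by
    have := congrArg (fun t : ℤ => (t : ℚ)) key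
    push_cast at this
    rw [this, h1, h2]; ring
  have h3 : u ^ 2 - u * v + v ^ 2 < 1 := by
    rw [abs_le] at e1 e2
    nlinarith [mul_nonneg (by linarith [e1.1] : 0 ≤ u + 1 / 2) (by linarith [e1.2] : 0 ≤ 1 / 2 - u),
      mul_nonneg (by linarith [e2.1] : 0 ≤ v + 1 / 2) (by linarith [e2.2] : 0 ≤ 1 / 2 - v),
      sq_nonneg (u + v), sq_nonneg (u - v)]
  have : ((x - y * quo x y).norm : ℚ) < y.norm := by
    by_contra hcon
    push Not at hcon
    nlinarith [mul_le_mul_of_nonneg_right hcon hnq.le, pow_pos hnq 2]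
  exact_mod_cast this

noncomputable instance : EuclideanDomain Eis where
  quotient := fun x y => if y = 0 then 0 else quo x y
  quotient_zero := by intro a; simp
  remainder := fun x y => if y = 0 then x else x - y * quo x y
  quotient_mul_add_remainder_eq := by
    intro a b
    by_cases h : b = 0 <;> simp [h]
  r := fun x y => x.norm < y.norm
  r_wellFounded := by
    have : WellFounded (fun x y : Eis => x.norm.toNat < y.norm.toNat) :=
      (measure (fun z : Eis => z.norm.toNat)).wf
    refine Subrelation.wf ?_ this
    intro x y h
    have := norm_nonneg x
    show x.norm.toNat < y.norm.toNat
    omega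
  remainder_lt := by
    intro a b h
    simp only [h, if_false]
    exact norm_rem_lt a h
  mul_left_not_lt := by
    intro a b h
    rw [map_mul]
    have := norm_nonneg a
    have := norm_pos h
    nlinarith

/-- Primary elements: those congruent to `1` modulo `3`. -/
def IsPrimary (z : Eis) : Prop := 3 ∣ z.re - 1 ∧ 3 ∣ z.im

lemma isPrimary_one : IsPrimary 1 :=
  ⟨⟨0, rfl⟩, ⟨0, rfl⟩⟩

lemma IsPrimary.mul {x y : Eis} (hx : IsPrimary x) (hy : IsPrimary y) : IsPrimary (x * y) := by
  obtain ⟨⟨a, ha⟩, b, hb⟩ := hx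
  obtain ⟨⟨c, hc⟩, d, hd⟩ := hy
  have ha' : x.re = 1 + 3 * a := by omega
  have hc' : y.re = 1 + 3 * c := by omega
  constructor
  · rw [QuadraticAlgebra.re_mul, ha', hc', hb, hd]
    exact ⟨a + c + 3 * a * c - 3 * b * d, by ring⟩
  · rw [QuadraticAlgebra.im_mul, ha', hc', hb, hd]
    exact ⟨(1 + 3 * a) * d + b * (1 + 3 * c) - 3 * b * d, by ring⟩

lemma IsPrimary.pow {x : Eis} (hx : IsPrimary x) (n : ℕ) : IsPrimary (x ^ n) := by
  induction n with
  | zero => simpa using isPrimary_one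
  | succ n ih => rw [pow_succ]; exact ih.mul hx

lemma IsPrimary.of_mul {x y : Eis} (hx : IsPrimary x) (h : IsPrimary (x * y)) : IsPrimary y := by
  obtain ⟨⟨a, ha⟩, b, hb⟩ := hx
  obtain ⟨⟨c, hc⟩, d, hd⟩ := h
  have ha' : x.re = 1 + 3 * a := by omega
  rw [QuadraticAlgebra.re_mul, ha', hb] at hc
  rw [QuadraticAlgebra.im_mul, ha', hb] at hd
  constructor
  · exact ⟨c - a * y.re + b * y.im, by linear_combination hc⟩
  · exact ⟨d - a * y.im - b * y.re + b * y.im, by linear_combination hd⟩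

lemma IsPrimary.ne_zero {x : Eis} (hx : IsPrimary x) : x ≠ 0 := by
  rintro rfl
  have := hx.1
  simp at this

lemma IsPrimary.star {x : Eis} (hx : IsPrimary x) : IsPrimary (star x) := by
  obtain ⟨h1, h2⟩ := hx
  constructor
  · rw [QuadraticAlgebra.re_star]; omega
  · rw [QuadraticAlgebra.im_star]; omega

lemma units_cases {u : Eis} (h : u.norm = 1) :
    u = ⟨1, 0⟩ ∨ u = ⟨-1, 0⟩ ∨ u = ⟨0, 1⟩ ∨ u = ⟨0, -1⟩ ∨ u = ⟨1, 1⟩ ∨ u = ⟨-1, -1⟩ := by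
  have h4 := four_norm u
  have h5 : 4 * u.norm = (2 * u.im - u.re) ^ 2 + 3 * u.re ^ 2 := by rw [norm_eq]; ring
  rw [h] at h4 h5
  have b1 : u.im ≤ 1 := by nlinarith [sq_nonneg (2 * u.re - u.im)]
  have b2 : -1 ≤ u.im := by nlinarith [sq_nonneg (2 * u.re - u.im)]
  have b3 : u.re ≤ 1 := by nlinarith [sq_nonneg (2 * u.im - u.re)]
  have b4 : -1 ≤ u.re := by nlinarith [sq_nonneg (2 * u.im - u.re)]
  obtain ⟨x, y⟩ := u
  simp only at *
  rw [norm_eq] at h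
  interval_cases x <;> interval_cases y <;> simp_all

lemma isUnit_iff {u : Eis} : IsUnit u ↔ u.norm = 1 := by
  rw [QuadraticAlgebra.isUnit_iff_norm_isUnit, Int.isUnit_iff]
  have := norm_nonneg u
  constructor
  · rintro (h | h)
    · exact h
    · omega
  · exact Or.inl

lemma IsPrimary.eq_one_of_norm {x : Eis} (hx : IsPrimary x) (h : x.norm = 1) : x = 1 := by
  rcases units_cases h with h | h | h | h | h | h <;> subst h <;>
    first | rfl | (exfalso; revert hx; simp [IsPrimary]; try omega)

lemma IsPrimary.eq_of_associated {x y : Eis} (hx : IsPrimary x) (hy : IsPrimary y)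
    (h : Associated x y) : x = y := by
  obtain ⟨u, rfl⟩ := h
  have h1 : IsPrimary (u : Eis) := hx.of_mul hy
  rw [h1.eq_one_of_norm (isUnit_iff.1 u.isUnit), mul_one]

lemma IsPrimary.norm_not_dvd {x : Eis} (hx : IsPrimary x) : ¬ 3 ∣ x.norm := by
  obtain ⟨⟨a, ha⟩, b, hb⟩ := hx
  have ha' : x.re = 1 + 3 * a := by omega
  rw [norm_eq, ha', hb]
  intro h
  have : (3:ℤ) ∣ 1 := by
    have h2 : (3:ℤ) ∣ (1 + 3 * a) ^ 2 - (1 + 3 * a) * (3 * b) + (3 * b) ^ 2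
       - 3 * (2 * a + 3 * a ^ 2 - (1 + 3 * a) * b + 3 * b ^ 2) := dvd_sub h (dvd_mul_right _ _)
    ring_nf at h2
    exact h2
  omega

lemma exists_primary {x : Eis} (h : ¬ 3 ∣ x.norm) : ∃ y, IsPrimary y ∧ Associated x y := by
  have hu : ∀ u : Eis, u.norm = 1 → IsPrimary (x * u) → ∃ y, IsPrimary y ∧ Associated x y := by
    intro u h1 h2
    obtain ⟨v, rfl⟩ := isUnit_iff.2 h1
    exact ⟨_, h2, v, rfl⟩
  obtain ⟨a, b⟩ := x
  rw [norm_eq] at h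
  simp only at h
  have ha : a % 3 = 0 ∨ a % 3 = 1 ∨ a % 3 = 2 := by omega
  have hb : b % 3 = 0 ∨ b % 3 = 1 ∨ b % 3 = 2 := by omega
  have hmod : ¬ ((a % 3) ^ 2 - (a % 3) * (b % 3) + (b % 3) ^ 2) % 3 = 0 := by
    intro hc
    apply h
    apply Int.dvd_of_emod_eq_zero
    rw [← hc]
    simp [Int.add_emod, Int.sub_emod, Int.mul_emod, pow_two]
  have w : ∀ c d : ℤ, (⟨c, d⟩ : Eis).norm = 1 → 3 ∣ a * c - b * d - 1 →
      3 ∣ a * d + b * c - b * d → ∃ y, IsPrimary y ∧ Associated (⟨a, b⟩ : Eis) y := by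
    intro c d h1 h2 h3
    refine hu ⟨c, d⟩ h1 ⟨?_, ?_⟩
    · rw [QuadraticAlgebra.re_mul]
      simp only
      convert h2 using 1
      ring
    · rw [QuadraticAlgebra.im_mul]
      simp only
      convert h3 using 1
      ring
  have n1 : (⟨1, 0⟩ : Eis).norm = 1 := by simp [norm_eq]
  have n2 : (⟨-1, 0⟩ : Eis).norm = 1 := by simp [norm_eq]
  have n3 : (⟨0, 1⟩ : Eis).norm = 1 := by simp [norm_eq]
  have n4 : (⟨0, -1⟩ : Eis).norm = 1 := by simp [norm_eq]
  have n5 : (⟨1, 1⟩ : Eis).norm = 1 := by simp [norm_eq]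
  have n6 : (⟨-1, -1⟩ : Eis).norm = 1 := by simp [norm_eq]
  rcases ha with ha | ha | ha <;> rcases hb with hb | hb | hb <;> rw [ha, hb] at hmod <;>
    first
    | (exfalso; revert hmod; norm_num; done)
    | exact w _ _ n1 (by omega) (by omega)
    | exact w _ _ n2 (by omega) (by omega)
    | exact w _ _ n3 (by omega) (by omega)
    | exact w _ _ n4 (by omega) (by omega)
    | exact w _ _ n5 (by omega) (by omega)
    | exact w _ _ n6 (by omega) (by omega)

end Eis

namespace Eis

lemma dvd_norm (z : Eis) : z ∣ ((z.norm : ℤ) : Eis) := by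
  refine ⟨star z, ?_⟩
  have := QuadraticAlgebra.algebraMap_norm_eq_mul_star z
  rw [← this]; rfl

lemma norm_dvd_norm {x y : Eis} (h : x ∣ y) : x.norm ∣ y.norm := map_dvd QuadraticAlgebra.norm h

lemma prime_of_norm_prime {z : Eis} {p : ℕ} (hp : p.Prime) (h : z.norm = p) : Prime z := by
  rw [← irreducible_iff_prime]
  constructor
  · rw [isUnit_iff, h]
    have := hp.one_lt
    omega
  · intro a b hab
    have h1 : a.norm * b.norm = p := by rw [← map_mul, ← hab, h]
    have ha := norm_nonneg a
    have hb := norm_nonneg b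
    obtain ⟨m, hm⟩ := Int.eq_ofNat_of_zero_le ha
    obtain ⟨n, hn⟩ := Int.eq_ofNat_of_zero_le hb
    rw [hm, hn] at h1
    have h2 : m * n = p := by exact_mod_cast h1
    rw [isUnit_iff, isUnit_iff, hm, hn]
    rcases Nat.prime_mul_iff.1 (h2 ▸ hp) with h | h
    · right; exact_mod_cast h.2
    · left; exact_mod_cast h.2

lemma eq_or_eq_star {x y : Eis} {p : ℕ} (hp : p.Prime) (hx : IsPrimary x) (hy : IsPrimary y)
    (hxn : x.norm = p) (hyn : y.norm = p) : y = x ∨ y = star x := by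
  have px := prime_of_norm_prime hp hxn
  have py := prime_of_norm_prime hp hyn
  have pxs : Prime (star x) := prime_of_norm_prime hp (by rw [QuadraticAlgebra.norm_star, hxn])
  have h : y ∣ x * star x := by
    have h1 := dvd_norm y
    have := QuadraticAlgebra.algebraMap_norm_eq_mul_star x
    rw [← this, hxn]
    rw [hyn] at h1
    exact h1
  rcases py.dvd_or_dvd h with h | h
  · left
    exact hy.eq_of_associated hx (py.irreducible.associated_of_dvd px.irreducible h)
  · right
    exact hy.eq_of_associated hx.star (py.irreducible.associated_of_dvd pxs.irreducible h)

lemma norm_natCast' (n : ℕ) : ((n : Eis)).norm = (n : ℤ) ^ 2 := QuadraticAlgebra.norm_natCast n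

/-- A prime of `ℤ[ω]` either has prime norm, or is associated to a rational prime. -/
lemma prime_cases {z : Eis} (hz : Prime z) :
    (∃ p : ℕ, p.Prime ∧ z.norm = p) ∨ ∃ p : ℕ, p.Prime ∧ Associated z (p : Eis) := by
  have h0 : z.norm ≠ 1 := fun h => hz.not_isUnit (isUnit_iff.2 h)
  have hpos := norm_pos hz.ne_zero
  obtain ⟨n, hn⟩ := Int.eq_ofNat_of_zero_le hpos.le
  have hdiv : z ∣ ((n : ℕ) : Eis) := by
    have := dvd_norm z
    rw [hn] at this
    exact_mod_cast this
  have key : ∀ m : ℕ, m ≠ 0 → z ∣ (m : Eis) → ∃ p : ℕ, p.Prime ∧ z ∣ (p : Eis) := by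
    intro m
    induction m using Nat.recOnMul with
    | zero => intro h; exact absurd rfl h
    | one => intro _ h; exact absurd (isUnit_of_dvd_one (by simpa using h)) hz.not_isUnit
    | prime p hp => intro _ h; exact ⟨p, hp, h⟩
    | mul a b iha ihb =>
      intro hab h
      rw [Nat.cast_mul] at h
      rcases hz.dvd_or_dvd h with h | h
      · exact iha (by rintro rfl; simp at hab) h
      · exact ihb (by rintro rfl; simp at hab) h
  obtain ⟨p, hp, hzp⟩ := key n (by rintro rfl; omega) hdiv
  have h1 := norm_dvd_norm hzp
  rw [norm_natCast', hn] at h1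
  have h2 : n ∣ p ^ 2 := by exact_mod_cast h1
  obtain ⟨k, hk, hk2⟩ := (Nat.dvd_prime_pow hp).1 h2
  interval_cases k
  · exfalso; apply h0; rw [hn, hk2]; simp
  · left; exact ⟨p, hp, by rw [hn, hk2]; simp⟩
  · right
    refine ⟨p, hp, ?_⟩
    obtain ⟨c, hc⟩ := hzp
    have h3 : z.norm * c.norm = (p : ℤ) ^ 2 := by rw [← map_mul, ← hc, norm_natCast']
    have hp2 : (p : ℤ) ^ 2 ≠ 0 := by
      have := hp.pos
      positivity
    rw [hn, hk2] at h3
    push_cast at h3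
    have h4 : c.norm = 1 := by
      have : (p : ℤ) ^ 2 * c.norm = (p : ℤ) ^ 2 * 1 := by rw [h3, mul_one]
      exact mul_left_cancel₀ hp2 this
    obtain ⟨u, hu⟩ := isUnit_iff.2 h4
    exact ⟨u, by rw [hu, hc]⟩

lemma IsPrimary.norm_mod {x : Eis} (hx : IsPrimary x) : x.norm % 3 = 1 := by
  obtain ⟨⟨a, ha⟩, b, hb⟩ := hx
  have ha' : x.re = 1 + 3 * a := by omega
  have : x.norm = 1 + 3 * (2 * a + 3 * a ^ 2 - (1 + 3 * a) * b + 3 * b ^ 2) := by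
    rw [norm_eq, ha', hb]; ring
  omega

/-- Primary primes. -/
abbrev PrimE : Type := {z : Eis // Prime z ∧ IsPrimary z}

lemma exists_primary_prime_dvd {x : Eis} (hx : IsPrimary x) (h1 : x ≠ 1) :
    ∃ z : PrimE, (z : Eis) ∣ x := by
  have hu : ¬ IsUnit x := fun h => h1 (hx.eq_one_of_norm (isUnit_iff.1 h))
  obtain ⟨i, hi, hix⟩ := WfDvdMonoid.exists_irreducible_factor hu hx.ne_zero
  have h3 : ¬ 3 ∣ i.norm := fun h => hx.norm_not_dvd (h.trans (norm_dvd_norm hix))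
  obtain ⟨y, hy, hiy⟩ := exists_primary h3
  exact ⟨⟨y, hiy.prime hi.prime, hy⟩, (hiy.dvd_iff_dvd_left).1 hix⟩

lemma PrimE.eq_of_dvd {a b : PrimE} (h : (a : Eis) ∣ b) : a = b :=
  Subtype.ext (a.2.2.eq_of_associated b.2.2
    (a.2.1.irreducible.associated_of_dvd b.2.1.irreducible h))

lemma PrimE.dvd_mul_pow {a b : PrimE} (h : a ≠ b) (n : ℕ) (x : Eis) :
    (a : Eis) ^ n ∣ b * x ↔ (a : Eis) ^ n ∣ x := by
  have hab : ¬ (a : Eis) ∣ b := fun hd => h (PrimE.eq_of_dvd hd)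
  constructor
  · intro hd
    exact a.2.1.pow_dvd_of_dvd_mul_left n hab hd
  · exact fun hd => hd.mul_left _

lemma hasSum_log_norm : ∀ (n : ℕ) (x : Eis), IsPrimary x → x.norm = n →
    HasSum (fun t : PrimE × ℕ => open Classical in
      if (t.1 : Eis) ^ (t.2 + 1) ∣ x then Real.log ((t.1 : Eis).norm : ℝ) else 0)
      (Real.log (x.norm : ℝ)) := by
  classical
  intro n
  induction n using Nat.strong_induction_on with
  | _ n ih =>
  intro x hx hxn
  by_cases h1 : x = 1
  · subst h1
    have : (fun t : PrimE × ℕ => if (t.1 : Eis) ^ (t.2 + 1) ∣ 1 then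
        Real.log ((t.1 : Eis).norm : ℝ) else 0) = fun _ => 0 := by
      funext t
      rw [if_neg]
      intro h
      exact t.1.2.1.not_isUnit (isUnit_of_dvd_one ((dvd_pow_self _ (by simp)).trans h))
    simp only [map_one, Int.cast_one, Real.log_one]
    convert hasSum_zero using 1
  · obtain ⟨b, y, rfl⟩ := exists_primary_prime_dvd hx h1
    have hy : IsPrimary y := b.2.2.of_mul hx
    have hbn : 2 ≤ (b : Eis).norm := by
      have h2 : (b : Eis).norm ≠ 1 := fun h => b.2.1.not_isUnit (isUnit_iff.2 h)
      have := norm_pos b.2.1.ne_zero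
      omega
    have hyp := norm_pos hy.ne_zero
    have hmul : ((b : Eis) * y).norm = (b : Eis).norm * y.norm := map_mul _ _ _
    obtain ⟨m, hm⟩ := Int.eq_ofNat_of_zero_le hyp.le
    have hmn : m < n := by
      have : (m : ℤ) < n := by rw [← hm, ← hxn, hmul]; nlinarith
      exact_mod_cast this
    have IH := ih m hmn y hy hm
    set f : PrimE × ℕ → ℝ := fun t => if (t.1 : Eis) ^ (t.2 + 1) ∣ y then
        Real.log ((t.1 : Eis).norm : ℝ) else 0 with hf
    let i : PrimE × ℕ → PrimE × ℕ := fun t => if t.1 = b then (b, t.2 + 1) else t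
    have hi : Function.Injective i := by
      rintro ⟨a, j⟩ ⟨a', j'⟩ h
      simp only [i] at h
      split_ifs at h with h1 h2 h2 <;> simp_all
    let g : PrimE × ℕ → ℝ := fun t => if t = (b, 0) then 0 else
      if (t.1 : Eis) ^ (t.2 + 1) ∣ b * y then Real.log ((t.1 : Eis).norm : ℝ) else 0
    have hg : HasSum g (Real.log (y.norm : ℝ)) := by
      rw [← hi.hasSum_iff]
      · convert IH using 1
        funext ⟨a, j⟩
        simp only [Function.comp, i, g, hf]
        by_cases hab : a = b
        · subst hab
          simp only [if_true]
          rw [if_neg (by simp)]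
          have : (a : Eis) ^ (j + 1 + 1) ∣ a * y ↔ (a : Eis) ^ (j + 1) ∣ y := by
            rw [pow_succ' _ (j + 1)]
            exact mul_dvd_mul_iff_left a.2.1.ne_zero
          simp only [this]
        · rw [if_neg hab, if_neg (by simp [hab])]
          simp only [PrimE.dvd_mul_pow hab]
      · rintro ⟨a, j⟩ hnot
        simp only [g]
        by_cases hab : a = b
        · rcases j with _ | j
          · simp [hab]
          · exact absurd ⟨(b, j), by simp [i, hab]⟩ hnot
        · exact absurd ⟨(a, j), by simp [i, hab]⟩ hnot
    have he : HasSum (fun t : PrimE × ℕ => if t = (b, 0) then Real.log ((b : Eis).norm : ℝ) else 0)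
        (Real.log ((b : Eis).norm : ℝ)) := hasSum_ite_eq (b, 0) _
    have hsum := he.add hg
    have hlog : Real.log (((b : Eis) * y).norm : ℝ) =
        Real.log ((b : Eis).norm : ℝ) + Real.log (y.norm : ℝ) := by
      rw [hmul]; push_cast
      rw [Real.log_mul]
      · have : (0:ℝ) < ((b : Eis).norm : ℝ) := by exact_mod_cast (by omega : 0 < (b : Eis).norm)
        exact this.ne'
      · have : (0:ℝ) < (y.norm : ℝ) := by exact_mod_cast hyp
        exact this.ne'
    rw [hlog]
    convert hsum using 1
    funext ⟨a, j⟩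
    simp only [g]
    by_cases hab : ((a, j) : PrimE × ℕ) = (b, 0)
    · obtain ⟨rfl, rfl⟩ := Prod.mk.inj hab
      simp
    · simp only [if_neg hab, zero_add]

end Eis

section

open Finset

/-- Number of solutions of `x³ + y³ + z³ = b` modulo `m`. -/
def cubeCount (m : ℕ) [NeZero m] (b : ZMod m) : ℕ :=
  #{t : ZMod m × ZMod m × ZMod m | t.1 ^ 3 + t.2.1 ^ 3 + t.2.2 ^ 3 = b}

namespace CubicChar

variable {p : ℕ} [hp : Fact p.Prime]

lemma exists_root (h3 : p % 3 = 1) :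
    ∃ z : ZMod p, z ^ 2 + z + 1 = 0 ∧ z ≠ 1 ∧ z ^ 2 ≠ 1 ∧ z ≠ z ^ 2 := by
  have hdvd : 3 ∣ Fintype.card (ZMod p)ˣ := by
    rw [ZMod.card_units]; omega
  have : Fact (Nat.Prime 3) := ⟨Nat.prime_three⟩
  obtain ⟨u, hu⟩ := exists_prime_orderOf_dvd_card 3 hdvd
  have h1 : (u : ZMod p) ^ 3 = 1 := by
    have := pow_orderOf_eq_one u
    rw [hu] at this
    have := congrArg (fun v : (ZMod p)ˣ => (v : ZMod p)) this
    simpa using this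
  have h2 : (u : ZMod p) ≠ 1 := by
    intro h
    have : u = 1 := Units.ext h
    rw [this, orderOf_one] at hu
    omega
  have h4 : (u : ZMod p) ^ 2 + u + 1 = 0 := by
    have : ((u : ZMod p) - 1) * ((u : ZMod p) ^ 2 + u + 1) = 0 := by ring_nf; rw [h1]; ring
    rcases mul_eq_zero.1 this with h | h
    · exact absurd (sub_eq_zero.1 h) h2
    · exact h
  refine ⟨u, h4, h2, ?_, ?_⟩
  · intro h
    apply h2
    calc (u : ZMod p) = u * u ^ 2 := by rw [h, mul_one]
      _ = u ^ 3 := by ring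
      _ = 1 := h1
  · intro h
    apply h2
    have := mul_left_cancel₀ (Units.ne_zero u)
      (show (u : ZMod p) * u = u * 1 by rw [mul_one, ← pow_two, ← h])
    exact this

lemma card_roots (h3 : p % 3 = 1) {t : ZMod p} (ht : t ≠ 0) :
    #{s : ZMod p | s ^ 3 = t ^ 3} = 3 := by
  obtain ⟨z, hz, z1, z2, z3⟩ := exists_root h3
  have : ({s : ZMod p | s ^ 3 = t ^ 3} : Finset (ZMod p)) = {t, t * z, t * z ^ 2} := by
    ext s
    simp only [mem_filter, mem_univ, true_and, mem_insert, mem_singleton]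
    have hz3 : z ^ 3 = 1 := by linear_combination (z - 1) * hz
    constructor
    · intro h
      have : (s - t) * ((s - t * z) * (s - t * z ^ 2)) = 0 := by
        have e : (s - t) * ((s - t * z) * (s - t * z ^ 2)) = s ^ 3 - t ^ 3 * z ^ 3
          + (z ^ 2 + z + 1) * (s * t ^ 2 * z - s ^ 2 * t) := by ring
        rw [e, hz, hz3, h]; ring
      rcases mul_eq_zero.1 this with h | h
      · left; exact sub_eq_zero.1 h
      · right
        rcases mul_eq_zero.1 h with h | h
        · left; exact sub_eq_zero.1 h
        · right; exact sub_eq_zero.1 h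
    · rintro (rfl | rfl | rfl)
      · rfl
      · rw [mul_pow, hz3, mul_one]
      · rw [mul_pow, ← pow_mul, show 2 * 3 = 3 * 2 from rfl, pow_mul, hz3]; ring
  rw [this, card_eq_three]
  refine ⟨t, t * z, t * z ^ 2, ?_, ?_, ?_, rfl⟩
  · intro h
    exact z1 (mul_left_cancel₀ ht (by rw [← h, mul_one]))
  · intro h
    exact z2 (mul_left_cancel₀ ht (by rw [← h, mul_one]))
  · intro h
    exact z3 (mul_left_cancel₀ ht h)

/-- Number of cube roots of `x`, in terms of a cubic character. -/
noncomputable def nroots (χ : MulChar (ZMod p) ℂ) (x : ZMod p) : ℂ := 1 + χ x + χ⁻¹ x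

lemma ne_one_of_order {m : ℕ} {χ : MulChar (ZMod m) ℂ} (hχ : orderOf χ = 3) : χ ≠ 1 := by
  rintro rfl
  simp at hχ

lemma pow_three {m : ℕ} {χ : MulChar (ZMod m) ℂ} (hχ : orderOf χ = 3) : χ ^ 3 = 1 := by
  rw [← hχ]; exact pow_orderOf_eq_one χ

lemma sq_eq_inv {m : ℕ} {χ : MulChar (ZMod m) ℂ} (hχ : orderOf χ = 3) : χ * χ = χ⁻¹ := by
  rw [eq_inv_iff_mul_eq_one, ← pow_three hχ, pow_succ, pow_two]

lemma apply_pow_three {χ : MulChar (ZMod p) ℂ} (hχ : orderOf χ = 3) {x : ZMod p} (hx : x ≠ 0) :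
    χ x ^ 3 = 1 := by
  have h := congrArg (fun ψ : MulChar (ZMod p) ℂ => ψ x) (pow_three hχ)
  rw [MulChar.pow_apply' _ (by norm_num), MulChar.one_apply (isUnit_iff_ne_zero.2 hx)] at h
  exact h

lemma apply_inv {m : ℕ} {χ : MulChar (ZMod m) ℂ} (hχ : orderOf χ = 3) (x : ZMod m) :
    χ⁻¹ x = χ x ^ 2 := by
  rw [← sq_eq_inv hχ, MulChar.mul_apply]; ring

lemma card_eq_nroots (h3 : p % 3 = 1) {χ : MulChar (ZMod p) ℂ} (hχ : orderOf χ = 3)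
    (x : ZMod p) : ((#{s : ZMod p | s ^ 3 = x} : ℕ) : ℂ) = nroots χ x := by
  by_cases hx : x = 0
  · subst hx
    have : ({s : ZMod p | s ^ 3 = 0} : Finset (ZMod p)) = {0} := by
      ext s; simp
    rw [this, nroots, χ.map_zero, MulChar.map_zero]; simp
  · rw [nroots, apply_inv hχ]
    by_cases hc : ∃ t, t ^ 3 = x
    · obtain ⟨t, rfl⟩ := hc
      have ht : t ≠ 0 := by rintro rfl; simp at hx
      rw [card_roots h3 ht, map_pow, apply_pow_three hχ ht]
      norm_num
    · have h0 : ({s : ZMod p | s ^ 3 = x} : Finset (ZMod p)) = ∅ := by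
        ext s
        simp only [mem_filter, mem_univ, true_and, notMem_empty, iff_false]
        exact fun h => hc ⟨s, h⟩
      rw [h0]
      have h1 : χ x ≠ 1 := by
        obtain ⟨g, hg⟩ := IsCyclic.exists_generator (α := (ZMod p)ˣ)
        have hg1 : χ (g : ZMod p) ≠ 1 := by
          intro h
          apply ne_one_of_order hχ
          rw [MulChar.eq_one_iff]
          intro a
          obtain ⟨k, hk⟩ := (mem_powers_iff_mem_zpowers (x := g) (y := a)).2 (hg a)
          rw [← hk]
          simp only [Units.val_pow_eq_pow_val, map_pow, h, one_pow]
        obtain ⟨k, hk⟩ := (mem_powers_iff_mem_zpowers (x := g) (y := Units.mk0 x hx)).2 (hg _)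
        have hxk : x = (g : ZMod p) ^ k := by
          have := congrArg (fun v : (ZMod p)ˣ => (v : ZMod p)) hk
          simpa using this.symm
        have hg3 := apply_pow_three hχ g.ne_zero
        intro h
        rw [hxk, map_pow] at h
        have hd : k = 3 * (k / 3) + k % 3 := (Nat.div_add_mod k 3).symm
        rw [hd, pow_add, pow_mul, hg3, one_pow, one_mul] at h
        have hk3 : k % 3 < 3 := Nat.mod_lt _ (by norm_num)
        interval_cases hkm : k % 3
        · apply hc
          refine ⟨(g : ZMod p) ^ (k / 3), ?_⟩
          rw [hxk, ← pow_mul]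
          congr 1
          omega
        · exact hg1 (by simpa using h)
        · apply hg1
          calc χ (g : ZMod p) = χ g * χ g ^ 2 := by rw [h, mul_one]
            _ = χ g ^ 3 := by ring
            _ = 1 := hg3
      have : (χ x - 1) * (1 + χ x + χ x ^ 2) = 0 := by
        linear_combination apply_pow_three hχ hx
      rcases mul_eq_zero.1 this with h | h
      · exact absurd (sub_eq_zero.1 h) h1
      · rw [h]; simp

lemma sum_cube (h3 : p % 3 = 1) {χ : MulChar (ZMod p) ℂ} (hχ : orderOf χ = 3)
    (f : ZMod p → ℂ) : ∑ s, f (s ^ 3) = ∑ x, nroots χ x * f x := by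
  calc ∑ s, f (s ^ 3) = ∑ s : ZMod p, ∑ x, if s ^ 3 = x then f x else 0 := by simp
    _ = ∑ x, ∑ s : ZMod p, if s ^ 3 = x then f x else 0 := sum_comm
    _ = _ := by
      refine sum_congr rfl fun x _ => ?_
      rw [← card_eq_nroots h3 hχ, ← sum_filter, sum_const, nsmul_eq_mul]

lemma conv_ne {ψ φ : MulChar (ZMod p) ℂ} {c : ZMod p} (hc : c ≠ 0) :
    ∑ x, ψ x * φ (c - x) = (ψ * φ) c * jacobiSum ψ φ := by
  rw [jacobiSum, mul_sum, ← Equiv.sum_comp (Equiv.mulLeft₀ c hc)]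
  refine sum_congr rfl fun x _ => ?_
  simp only [Equiv.mulLeft₀_apply, MulChar.mul_apply]
  rw [show c - c * x = c * (1 - x) by ring, map_mul, map_mul]
  ring

lemma apply_neg {χ : MulChar (ZMod p) ℂ} (hχ : orderOf χ = 3) (x : ZMod p) :
    χ (-x) = χ x := by
  have h1 : χ (-1) ^ 3 = 1 := apply_pow_three hχ (by simp)
  have h2 : χ (-1) ^ 2 = 1 := by rw [← map_pow]; simp
  have h3 : χ (-1) = 1 := by
    calc χ (-1) = χ (-1) * χ (-1) ^ 2 := by rw [h2, mul_one]
      _ = χ (-1) ^ 3 := by ring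
      _ = 1 := h1
  rw [neg_eq_neg_one_mul, map_mul, h3, one_mul]

lemma order_inv {m : ℕ} {χ : MulChar (ZMod m) ℂ} (hχ : orderOf χ = 3) : orderOf χ⁻¹ = 3 := by
  rw [orderOf_inv, hχ]

lemma conv_self {χ : MulChar (ZMod p) ℂ} (hχ : orderOf χ = 3) (c : ZMod p) :
    ∑ x, χ x * χ (c - x) = χ⁻¹ c * jacobiSum χ χ := by
  by_cases hc : c = 0
  · subst hc
    rw [MulChar.map_zero, zero_mul,
      ← MulChar.sum_eq_zero_of_ne_one (ne_one_of_order (order_inv hχ))]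
    refine sum_congr rfl fun x _ => ?_
    rw [zero_sub, apply_neg hχ, ← sq_eq_inv hχ, MulChar.mul_apply]
  · rw [conv_ne hc, sq_eq_inv hχ]

lemma conv_inv {χ : MulChar (ZMod p) ℂ} (hχ : orderOf χ = 3) (c : ZMod p) :
    ∑ x, χ x * χ⁻¹ (c - x) = (if c = 0 then (p : ℂ) else 0) - 1 := by
  by_cases hc : c = 0
  · subst hc
    have : ∀ x : ZMod p, χ x * χ⁻¹ (0 - x) = 1 - if x = 0 then 1 else 0 := by
      intro x
      rw [zero_sub, apply_neg (order_inv hχ), apply_inv hχ]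
      by_cases hx : x = 0
      · subst hx; simp [MulChar.map_zero]
      · rw [if_neg hx]
        have := apply_pow_three hχ hx
        linear_combination this
    simp only [this, sum_sub_distrib]
    simp [ZMod.card]
  · rw [conv_ne hc, mul_inv_cancel, MulChar.one_apply (isUnit_iff_ne_zero.2 hc),
      jacobiSum_nontrivial_inv (ne_one_of_order hχ), if_neg hc]
    have := apply_neg hχ 1
    rw [this, map_one]; ring

lemma sum_shift (χ : MulChar (ZMod p) ℂ) (hχ : χ ≠ 1) (c : ZMod p) :
    ∑ x, χ (c - x) = 0 := by
  rw [← MulChar.sum_eq_zero_of_ne_one hχ]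
  exact (Equiv.subLeft c).sum_comp χ

lemma conv_inv' {χ : MulChar (ZMod p) ℂ} (hχ : orderOf χ = 3) (c : ZMod p) :
    ∑ x, χ⁻¹ x * χ (c - x) = (if c = 0 then (p : ℂ) else 0) - 1 := by
  have := conv_inv (order_inv hχ) c
  rwa [inv_inv] at this

lemma conv_self' {χ : MulChar (ZMod p) ℂ} (hχ : orderOf χ = 3) (c : ZMod p) :
    ∑ x, χ⁻¹ x * χ⁻¹ (c - x) = χ c * jacobiSum χ⁻¹ χ⁻¹ := by
  have := conv_self (order_inv hχ) c
  rwa [inv_inv] at this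

lemma sum_nroots_delta (χ : MulChar (ZMod p) ℂ) (b : ZMod p) (a : ℂ) :
    ∑ x, nroots χ x * (if b - x = 0 then a else 0) = nroots χ b * a := by
  simp [sub_eq_zero]

lemma sum_nroots {χ : MulChar (ZMod p) ℂ} (hχ : orderOf χ = 3) : ∑ x, nroots χ x = p := by
  simp only [nroots, sum_add_distrib, MulChar.sum_eq_zero_of_ne_one (ne_one_of_order hχ),
    MulChar.sum_eq_zero_of_ne_one (ne_one_of_order (order_inv hχ))]
  simp [ZMod.card]

lemma nroots_conv {χ : MulChar (ZMod p) ℂ} (hχ : orderOf χ = 3) (c : ZMod p) :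
    ∑ x, nroots χ x * nroots χ (c - x) = p + χ⁻¹ c * jacobiSum χ χ + χ c * jacobiSum χ⁻¹ χ⁻¹
      + 2 * ((if c = 0 then (p : ℂ) else 0) - 1) := by
  have e : ∀ x, nroots χ x * nroots χ (c - x) = 1 + χ x + χ⁻¹ x + χ (c - x) + χ⁻¹ (c - x) +
      χ x * χ (c - x) + χ⁻¹ x * χ⁻¹ (c - x) + χ x * χ⁻¹ (c - x) + χ⁻¹ x * χ (c - x) := by
    intro x; simp only [nroots]; ring
  simp only [e, sum_add_distrib, conv_self hχ, conv_self' hχ, conv_inv hχ, conv_inv' hχ,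
    sum_shift χ (ne_one_of_order hχ), sum_shift χ⁻¹ (ne_one_of_order (order_inv hχ)),
    MulChar.sum_eq_zero_of_ne_one (ne_one_of_order hχ),
    MulChar.sum_eq_zero_of_ne_one (ne_one_of_order (order_inv hχ))]
  simp [ZMod.card]
  ring

lemma nroots_conv_chi {χ : MulChar (ZMod p) ℂ} (hχ : orderOf χ = 3) (c : ZMod p) :
    ∑ x, nroots χ x * χ (c - x) = (if c = 0 then (p : ℂ) else 0) - 1 + χ⁻¹ c * jacobiSum χ χ := by
  have e : ∀ x, nroots χ x * χ (c - x) = χ (c - x) + χ x * χ (c - x) + χ⁻¹ x * χ (c - x) := by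
    intro x; simp only [nroots]; ring
  simp only [e, sum_add_distrib, conv_self hχ, conv_inv' hχ,
    sum_shift χ (ne_one_of_order hχ)]
  ring

lemma nroots_conv_chi' {χ : MulChar (ZMod p) ℂ} (hχ : orderOf χ = 3) (c : ZMod p) :
    ∑ x, nroots χ x * χ⁻¹ (c - x) =
      (if c = 0 then (p : ℂ) else 0) - 1 + χ c * jacobiSum χ⁻¹ χ⁻¹ := by
  have e : ∀ x, nroots χ x * χ⁻¹ (c - x) =
      χ⁻¹ (c - x) + χ x * χ⁻¹ (c - x) + χ⁻¹ x * χ⁻¹ (c - x) := by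
    intro x; simp only [nroots]; ring
  simp only [e, sum_add_distrib, conv_self' hχ, conv_inv hχ,
    sum_shift χ⁻¹ (ne_one_of_order (order_inv hχ))]
  ring

lemma cubeCount_eq_sum (h3 : p % 3 = 1) {χ : MulChar (ZMod p) ℂ} (hχ : orderOf χ = 3)
    (b : ZMod p) : (cubeCount p b : ℂ) =
      ∑ x, nroots χ x * ∑ y, nroots χ y * nroots χ (b - x - y) := by
  have h1 : (cubeCount p b : ℂ) = ∑ s : ZMod p, ∑ t : ZMod p, nroots χ (b - s ^ 3 - t ^ 3) := by
    rw [cubeCount, card_filter]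
    push_cast
    rw [Fintype.sum_prod_type]
    refine sum_congr rfl fun s _ => ?_
    rw [Fintype.sum_prod_type]
    refine sum_congr rfl fun t _ => ?_
    rw [← card_eq_nroots h3 hχ, card_filter]
    push_cast
    refine sum_congr rfl fun u _ => ?_
    congr 1
    apply propext
    constructor
    · intro h; linear_combination h
    · intro h; linear_combination h
  rw [h1, ← sum_cube h3 hχ (fun x => ∑ y, nroots χ y * nroots χ (b - x - y))]
  refine sum_congr rfl fun s _ => ?_
  rw [← sum_cube h3 hχ (fun y => nroots χ (b - s ^ 3 - y))]

lemma cubeCount_formula (h3 : p % 3 = 1) {χ : MulChar (ZMod p) ℂ} (hχ : orderOf χ = 3)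
    (hJ : jacobiSum χ χ * jacobiSum χ⁻¹ χ⁻¹ = p) (b : ZMod p) :
    (cubeCount p b : ℂ) = p ^ 2 - 2 * p + 2 * p * nroots χ b +
      (jacobiSum χ χ + jacobiSum χ⁻¹ χ⁻¹) * ((if b = 0 then (p : ℂ) else 0) - 1) +
      p * (χ b + χ⁻¹ b) := by
  rw [cubeCount_eq_sum h3 hχ]
  have e : ∀ x, nroots χ x * ∑ y, nroots χ y * nroots χ (b - x - y) =
      nroots χ x * (p - 2) + (nroots χ x * χ⁻¹ (b - x)) * jacobiSum χ χ
      + (nroots χ x * χ (b - x)) * jacobiSum χ⁻¹ χ⁻¹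
      + 2 * (nroots χ x * (if b - x = 0 then (p : ℂ) else 0)) := by
    intro x
    rw [nroots_conv hχ]; ring
  simp only [e, sum_add_distrib, ← sum_mul, ← mul_sum, nroots_conv_chi hχ, nroots_conv_chi' hχ,
    sum_nroots_delta, sum_nroots hχ]
  linear_combination (χ b + χ⁻¹ b) * hJ

end CubicChar

lemma Eis.rootC_eqn : Eis.rootC ^ 2 + Eis.rootC + 1 = 0 := by
  rw [pow_two, Eis.rootC_sq]; ring

lemma Eis.isPrimitiveRoot_rootC : IsPrimitiveRoot Eis.rootC 3 := by
  have h1 : Eis.rootC ^ 3 = 1 := by linear_combination (Eis.rootC - 1) * Eis.rootC_eqn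
  have : Fact (Nat.Prime 3) := ⟨Nat.prime_three⟩
  have h2 : Eis.rootC ≠ 1 := by
    intro h
    have hroot := Eis.rootC_eqn
    rw [h] at hroot
    norm_num at hroot
  rw [← orderOf_eq_prime h1 h2]
  exact IsPrimitiveRoot.orderOf _

lemma Eis.exists_of_mem_adjoin {w : ℂ} (hw : w ∈ Algebra.adjoin ℤ {Eis.rootC}) :
    ∃ y : Eis, Eis.toC y = w := by
  have hle : Algebra.adjoin ℤ {Eis.rootC} ≤ (Eis.toC.toIntAlgHom).range := by
    rw [Algebra.adjoin_le_iff]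
    intro x hx
    rw [Set.mem_singleton_iff] at hx
    subst hx
    refine ⟨⟨0, 1⟩, ?_⟩
    simp [Eis.toC_apply]
  obtain ⟨y, hy⟩ := hle hw
  exact ⟨y, hy⟩

lemma Eis.exists_primary_of_adjoin {w : ℂ} (hw : w ∈ Algebra.adjoin ℤ {Eis.rootC}) :
    ∃ z : Eis, Eis.IsPrimary z ∧ Eis.toC z = -(-1 + w * (Eis.rootC - 1) ^ 2) := by
  obtain ⟨y, rfl⟩ := Eis.exists_of_mem_adjoin hw
  refine ⟨⟨1 - 3 * y.im, 3 * y.re - 3 * y.im⟩, ⟨⟨-y.im, by simp only; ring⟩,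
    ⟨y.re - y.im, by simp only; ring⟩⟩, ?_⟩
  rw [Eis.toC_apply, Eis.toC_apply]
  push_cast
  linear_combination (((y.im : ℂ) * Eis.rootC) + y.re - 3 * y.im) * Eis.rootC_eqn

namespace CubicChar

variable {p : ℕ} [hp : Fact p.Prime]

lemma jacobiSum_mul_inv {χ : MulChar (ZMod p) ℂ} (hχ : orderOf χ = 3) :
    jacobiSum χ χ * jacobiSum χ⁻¹ χ⁻¹ = p := by
  rw [jacobiSum_mul_jacobiSum_inv _ (ne_one_of_order hχ) (ne_one_of_order hχ), ZMod.card]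
  · rw [sq_eq_inv hχ]; exact ne_one_of_order (order_inv hχ)
  · rw [ZMod.ringChar_zmod_n, ringChar.eq_zero]
    exact hp.out.ne_zero.symm

lemma conj_apply {m : ℕ} (χ : MulChar (ZMod m) ℂ) (b : ZMod m) :
    χ⁻¹ b = (starRingEnd ℂ) (χ b) := by
  rw [← MulChar.star_apply']; rfl

lemma jacobiSum_inv_eq_conj (χ : MulChar (ZMod p) ℂ) :
    jacobiSum χ⁻¹ χ⁻¹ = (starRingEnd ℂ) (jacobiSum χ χ) := by
  simp only [jacobiSum, map_sum, map_mul, conj_apply]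

lemma exists_primary (h3 : p % 3 = 1) : ∃ (χ : MulChar (ZMod p) ℂ) (z : Eis),
    orderOf χ = 3 ∧ z.norm = p ∧ Eis.IsPrimary z ∧ Eis.toC z = -jacobiSum χ χ := by
  have hdvd : 3 ∣ Fintype.card (ZMod p) - 1 := by rw [ZMod.card]; omega
  obtain ⟨χ, hχ⟩ := MulChar.exists_mulChar_orderOf (ZMod p) hdvd Eis.isPrimitiveRoot_rootC
  have hex : ∃ w ∈ Algebra.adjoin ℤ {Eis.rootC},
      jacobiSum χ χ = -1 + w * (Eis.rootC - 1) ^ 2 :=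
    exists_jacobiSum_eq_neg_one_add (by norm_num : 2 < 3)
      (pow_three hχ) (pow_three hχ) hdvd Eis.isPrimitiveRoot_rootC
  obtain ⟨w, hw, hJw⟩ := hex
  obtain ⟨z, hz, hzw⟩ := Eis.exists_primary_of_adjoin hw
  rw [← hJw] at hzw
  refine ⟨χ, z, hχ, ?_, hz, hzw⟩
  have hnorm : Complex.normSq (jacobiSum χ χ) = p := by
    have := Complex.mul_conj (jacobiSum χ χ)
    rw [← jacobiSum_inv_eq_conj, jacobiSum_mul_inv hχ] at this
    exact_mod_cast this.symm
  have := Eis.normSq_toC z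
  rw [hzw, Complex.normSq_neg, hnorm] at this
  exact_mod_cast this.symm

end CubicChar

open CubicChar in
/-- Local densities at a prime `p ≡ 1 mod 3`, in terms of a primary Eisenstein prime above `p`. -/
theorem exists_primary_cubeCount {p : ℕ} [hp : Fact p.Prime] (h3 : p % 3 = 1) :
    ∃ z : Eis, z.norm = p ∧ Eis.IsPrimary z ∧
      (cubeCount p 0 : ℝ) = p ^ 2 - 2 * (p - 1) * (Eis.toC z).re ∧
      ∀ b : ZMod p, b ≠ 0 → (cubeCount p b : ℝ) ≤ p ^ 2 + 8 * p := by
  obtain ⟨χ, z, hχ, hzn, hzp, hz⟩ := CubicChar.exists_primary h3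
  have hJ := jacobiSum_mul_inv hχ
  have hre : jacobiSum χ χ + jacobiSum χ⁻¹ χ⁻¹ = ((-2 * (Eis.toC z).re : ℝ) : ℂ) := by
    rw [jacobiSum_inv_eq_conj, Complex.add_conj, hz]
    simp
  refine ⟨z, hzn, hzp, ?_, ?_⟩
  · have := cubeCount_formula h3 hχ hJ 0
    rw [hre, if_pos rfl, nroots, MulChar.map_zero, MulChar.map_zero] at this
    have h : (cubeCount p 0 : ℂ) = ((p ^ 2 - 2 * (p - 1) * (Eis.toC z).re : ℝ) : ℂ) := by
      rw [this]; push_cast; ring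
    exact_mod_cast h
  · intro b hb
    have := cubeCount_formula h3 hχ hJ b
    rw [hre, if_neg hb, nroots, conj_apply] at this
    have hadd := Complex.add_conj (χ b)
    have h : (cubeCount p b : ℂ) = ((p ^ 2 + 6 * p * (χ b).re + 2 * (Eis.toC z).re : ℝ) : ℂ) := by
      rw [this]; push_cast at hadd ⊢
      linear_combination (3 * p : ℂ) * hadd
    have h' : (cubeCount p b : ℝ) = p ^ 2 + 6 * p * (χ b).re + 2 * (Eis.toC z).re := by
      exact_mod_cast h
    have hb1 : (χ b).re ≤ 1 := by
      have h1 : ‖χ b‖ ^ 3 = 1 := by rw [← norm_pow, apply_pow_three hχ hb, norm_one]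
      have h2 : ‖χ b‖ = 1 := (pow_eq_one_iff_of_nonneg (norm_nonneg _) (by norm_num)).1 h1
      exact (Complex.re_le_norm _).trans h2.le
    have hz1 : (Eis.toC z).re ≤ p := by
      have h1 := Complex.re_le_norm (Eis.toC z)
      have h2 := Eis.norm_toC_sq z
      rw [hzn] at h2
      have h4 : (1:ℝ) ≤ p := by exact_mod_cast hp.out.one_lt.le
      have h5 : ‖Eis.toC z‖ ≤ p := by
        have : ((p : ℤ) : ℝ) = (p:ℝ) := by norm_cast
        rw [this] at h2
        nlinarith [norm_nonneg (Eis.toC z)]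
      linarith
    have h4 : (0:ℝ) ≤ p := by positivity
    nlinarith

end

/-- The Hecke-type function `w ↦ (w/|w|)^k |w|^(-2 * s)`. -/
noncomputable def heckeF (k : ℕ) (s w : ℂ) : ℂ := (w / ‖w‖) ^ k * (‖w‖ : ℂ) ^ (-2 * s)

namespace Hecke

lemma heckeF_mul (k : ℕ) (s w z : ℂ) : heckeF k s (w * z) = heckeF k s w * heckeF k s z := by
  unfold heckeF
  rw [norm_mul, Complex.ofReal_mul, Complex.mul_cpow_ofReal_nonneg (norm_nonneg _) (norm_nonneg _),
    mul_div_mul_comm, mul_pow]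
  ring

lemma norm_unit_part {w : ℂ} (hw : w ≠ 0) : ‖w / (‖w‖ : ℂ)‖ = 1 := by
  rw [norm_div, Complex.norm_real, norm_norm, div_self (norm_ne_zero_iff.2 hw)]

lemma norm_heckeF (k : ℕ) (s : ℂ) {w : ℂ} (hw : w ≠ 0) :
    ‖heckeF k s w‖ = ‖w‖ ^ (-2 * s.re) := by
  unfold heckeF
  rw [norm_mul, norm_pow, norm_unit_part hw, one_pow, one_mul,
    Complex.norm_cpow_eq_rpow_re_of_pos (norm_pos_iff.2 hw)]
  simp

lemma heckeF_one (k : ℕ) (s : ℂ) : heckeF k s 1 = 1 := by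
  simp [heckeF]

lemma differentiable_heckeF (k : ℕ) {w : ℂ} (hw : w ≠ 0) :
    Differentiable ℂ (fun s => heckeF k s w) := by
  unfold heckeF
  intro s
  have h : ((‖w‖ : ℝ) : ℂ) ≠ 0 := by exact_mod_cast (norm_ne_zero_iff.2 hw)
  exact (DifferentiableAt.const_cpow (by fun_prop) (Or.inl h)).const_mul _

lemma deriv_heckeF (k : ℕ) (s : ℂ) {w : ℂ} (hw : w ≠ 0) :
    deriv (fun s => heckeF k s w) s = -(2 * Real.log ‖w‖ : ℝ) * heckeF k s w := by
  unfold heckeF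
  have h : ((‖w‖ : ℝ) : ℂ) ≠ 0 := by exact_mod_cast (norm_ne_zero_iff.2 hw)
  have h1 : HasDerivAt (fun s : ℂ => -2 * s) (-2) s := by
    simpa using (hasDerivAt_id s).const_mul (-2 : ℂ)
  have h2 := (h1.const_cpow (Or.inl h)).const_mul ((w / (‖w‖ : ℂ)) ^ k)
  rw [h2.deriv, ← Complex.ofReal_log (norm_nonneg _)]
  push_cast
  ring

lemma norm_pow_sub_pow {u v : ℂ} (hu : ‖u‖ = 1) (hv : ‖v‖ = 1) (k : ℕ) :
    ‖u ^ k - v ^ k‖ ≤ k * ‖u - v‖ := by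
  induction k with
  | zero => simp
  | succ k ih =>
    have : u ^ (k + 1) - v ^ (k + 1) = (u ^ k - v ^ k) * u + v ^ k * (u - v) := by ring
    rw [this]
    refine (norm_add_le _ _).trans ?_
    rw [norm_mul, norm_mul, norm_pow, hu, hv]
    push_cast
    simp only [mul_one, one_pow, one_mul]
    linarith

lemma norm_unit_sub {z w : ℂ} (hz : z ≠ 0) (hw : w ≠ 0) :
    ‖w / (‖w‖ : ℂ) - z / (‖z‖ : ℂ)‖ ≤ 2 * ‖w - z‖ / ‖z‖ := by
  have hz' := norm_pos_iff.2 hz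
  have hw' := norm_pos_iff.2 hw
  have hzc : ((‖z‖ : ℝ) : ℂ) ≠ 0 := by exact_mod_cast hz'.ne'
  have hwc : ((‖w‖ : ℝ) : ℂ) ≠ 0 := by exact_mod_cast hw'.ne'
  have e : w / (‖w‖ : ℂ) - z / (‖z‖ : ℂ) =
      ((w - z) + (w / (‖w‖ : ℂ)) * ((‖z‖ - ‖w‖ : ℝ) : ℂ)) / (‖z‖ : ℂ) := by
    push_cast
    field_simp
    ring
  rw [e, norm_div, Complex.norm_real, norm_norm]
  gcongr
  refine (norm_add_le _ _).trans ?_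
  rw [norm_mul, norm_unit_part hw, Complex.norm_real, Real.norm_eq_abs]
  have := abs_norm_sub_norm_le w z
  rw [abs_sub_comm] at this
  linarith

/-- A crude domain on which the continuation is carried out. -/
lemma ball_bounds {s : ℂ} (hs : s ∈ Metric.ball (1 : ℂ) (1 / 4)) :
    3 / 4 ≤ s.re ∧ ‖s‖ ≤ 5 / 4 := by
  rw [Metric.mem_ball, dist_eq_norm] at hs
  constructor
  · have h := Complex.abs_re_le_norm (s - 1)
    rw [abs_le] at h
    simp at h
    linarith [h.1]
  · have : ‖s‖ ≤ ‖s - 1‖ + ‖(1 : ℂ)‖ := by simpa using norm_add_le (s - 1) 1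
    rw [norm_one] at this
    linarith

lemma cpow_sub_bound {s : ℂ} (hs : s ∈ Metric.ball (1 : ℂ) (1 / 4)) {m a b : ℝ} (hm : 0 < m)
    (ha : 1 ≤ a) (hb : 1 ≤ b) (hma : m ≤ a) (hmb : m ≤ b) :
    ‖(b : ℂ) ^ (-2 * s) - (a : ℂ) ^ (-2 * s)‖ ≤ 5 / 2 * m ^ (-(5 / 2) : ℝ) * ‖b - a‖ := by
  obtain ⟨h1, h2⟩ := ball_bounds hs
  have hs0 : -2 * s ≠ 0 := by
    intro h
    have : s = 0 := by simpa using h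
    rw [this] at h1
    norm_num at h1
  refine Convex.norm_image_sub_le_of_norm_hasDerivWithin_le (s := Set.Ici (max 1 m))
    (f := fun y : ℝ => (y : ℂ) ^ (-2 * s))
    (f' := fun y : ℝ => (-2 * s) * (y : ℂ) ^ (-2 * s - 1)) ?_ ?_ (convex_Ici _)
    (by simp [ha, hma]) (by simp [hb, hmb])
  · intro y hy
    have hy1 : 1 ≤ y := (le_max_left _ _).trans hy
    exact (hasDerivAt_ofReal_cpow_const (by linarith) hs0).hasDerivWithinAt
  · intro y hy
    have hy1 : 1 ≤ y := (le_max_left _ _).trans hy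
    have hym : m ≤ y := (le_max_right _ _).trans hy
    rw [norm_mul, norm_mul, Complex.norm_cpow_eq_rpow_re_of_pos (by linarith)]
    have e1 : y ^ ((-2 * s - 1).re) ≤ m ^ (-(5 / 2) : ℝ) := by
      calc y ^ ((-2 * s - 1).re) ≤ y ^ (-(5 / 2) : ℝ) := by
            apply Real.rpow_le_rpow_of_exponent_le hy1
            simp; linarith
        _ ≤ m ^ (-(5 / 2) : ℝ) := Real.rpow_le_rpow_of_nonpos hm hym (by norm_num)
    have e2 : ‖(-2 : ℂ)‖ * ‖s‖ ≤ 5 / 2 := by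
      have : ‖(-2 : ℂ)‖ = 2 := by simp
      rw [this]; linarith
    exact mul_le_mul e2 e1 (by positivity) (by norm_num)

lemma heckeF_sub_bound (k : ℕ) : ∃ C : ℝ, ∀ s ∈ Metric.ball (1 : ℂ) (1 / 4), ∀ z w : ℂ,
    1 ≤ ‖z‖ → 1 ≤ ‖w‖ → ‖w - z‖ ≤ 2 →
    ‖heckeF k s w - heckeF k s z‖ ≤ C * ‖z‖ ^ (-(5 / 2) : ℝ) := by
  refine ⟨4 * k * 3 ^ (3 / 2 : ℝ) + 5 * 3 ^ (5 / 2 : ℝ), fun s hs z w hz hw hzw => ?_⟩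
  obtain ⟨h1, h2⟩ := ball_bounds hs
  have hz0 : z ≠ 0 := by rintro rfl; norm_num at hz
  have hw0 : w ≠ 0 := by rintro rfl; norm_num at hw
  set r := ‖z‖ with hr
  set t := ‖w‖ with ht
  have hrt : |t - r| ≤ 2 := (abs_norm_sub_norm_le w z).trans hzw
  rw [abs_le] at hrt
  have hr3 : 0 < r / 3 := by linarith
  have hrt3 : r / 3 ≤ t := by linarith [hrt.1]
  have hpow : ∀ a : ℝ, 0 ≤ a → (r / 3) ^ (-a) = r ^ (-a) * 3 ^ a := by
    intro a ha
    rw [Real.div_rpow (by linarith) (by norm_num), Real.rpow_neg (by norm_num : (0:ℝ) ≤ 3),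
      div_inv_eq_mul]
  have e : heckeF k s w - heckeF k s z =
      ((w / (‖w‖ : ℂ)) ^ k - (z / (‖z‖ : ℂ)) ^ k) * (‖w‖ : ℂ) ^ (-2 * s) +
      (z / (‖z‖ : ℂ)) ^ k * ((‖w‖ : ℂ) ^ (-2 * s) - (‖z‖ : ℂ) ^ (-2 * s)) := by
    unfold heckeF; ring
  rw [e]
  refine (norm_add_le _ _).trans ?_
  rw [norm_mul, norm_mul, norm_pow, norm_unit_part hz0, one_pow, one_mul, add_mul]
  have hA : ‖(w / (‖w‖ : ℂ)) ^ k - (z / (‖z‖ : ℂ)) ^ k‖ ≤ 4 * k / r := by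
    refine (norm_pow_sub_pow (norm_unit_part hw0) (norm_unit_part hz0) k).trans ?_
    have := norm_unit_sub hz0 hw0
    calc (k : ℝ) * ‖w / (‖w‖ : ℂ) - z / (‖z‖ : ℂ)‖ ≤ k * (2 * ‖w - z‖ / ‖z‖) := by gcongr
      _ ≤ k * (2 * 2 / ‖z‖) := by gcongr
      _ = 4 * k / r := by rw [← hr]; ring
  have hB : ‖(‖w‖ : ℂ) ^ (-2 * s)‖ ≤ r ^ (-(3 / 2) : ℝ) * 3 ^ (3 / 2 : ℝ) := by
    rw [Complex.norm_cpow_eq_rpow_re_of_pos (norm_pos_iff.2 hw0), ← hpow _ (by norm_num)]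
    calc t ^ ((-2 * s).re) ≤ t ^ (-(3 / 2) : ℝ) := by
          apply Real.rpow_le_rpow_of_exponent_le hw
          simp; linarith
      _ ≤ (r / 3) ^ (-(3 / 2) : ℝ) := Real.rpow_le_rpow_of_nonpos hr3 hrt3 (by norm_num)
  have hC := cpow_sub_bound hs hr3 hz hw (by linarith : r / 3 ≤ r) hrt3
  rw [hpow _ (by norm_num)] at hC
  have hr0 : 0 < r := by linarith
  have hD : ‖t - r‖ ≤ 2 := by rw [Real.norm_eq_abs, abs_le]; exact hrt
  have e1 : r ^ (-(5 / 2) : ℝ) = r ^ (-(3 / 2) : ℝ) / r := by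
    rw [show (-(5 / 2) : ℝ) = -(3 / 2) - 1 by norm_num, Real.rpow_sub_one hr0.ne']
  apply add_le_add
  · calc ‖(w / (‖w‖ : ℂ)) ^ k - (z / (‖z‖ : ℂ)) ^ k‖ * ‖(‖w‖ : ℂ) ^ (-2 * s)‖
        ≤ (4 * k / r) * (r ^ (-(3 / 2) : ℝ) * 3 ^ (3 / 2 : ℝ)) := by gcongr
      _ = 4 * k * 3 ^ (3 / 2 : ℝ) * r ^ (-(5 / 2) : ℝ) := by rw [e1]; ring
  · calc _ ≤ _ := hC
      _ ≤ 5 / 2 * (r ^ (-(5 / 2) : ℝ) * 3 ^ (5 / 2 : ℝ)) * 2 := by gcongr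
      _ = _ := by ring

end Hecke

namespace Eis

lemma half_norm_le (z : Eis) : ‖(![z.re, z.im] : Fin 2 → ℤ)‖ / 2 ≤ ‖toC z‖ := by
  have h2 := norm_toC_sq z
  have h4 : (4 * z.norm : ℝ) = (2 * z.re - z.im) ^ 2 + 3 * z.im ^ 2 := by
    exact_mod_cast four_norm z
  have h5 : (4 * z.norm : ℝ) = (2 * z.im - z.re) ^ 2 + 3 * z.re ^ 2 := by
    rw [h4]; ring
  have hn := _root_.norm_nonneg (toC z)
  rw [div_le_iff₀ (by norm_num), pi_norm_le_iff_of_nonneg (by positivity)]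
  intro i
  fin_cases i
  · simp only [Fin.zero_eta, Matrix.cons_val_zero, Int.norm_eq_abs]
    apply abs_le_of_sq_le_sq _ (by positivity)
    nlinarith [sq_nonneg (2 * (z.im : ℝ) - z.re)]
  · simp only [Fin.mk_one, Matrix.cons_val_one, Matrix.cons_val_fin_one, Int.norm_eq_abs]
    apply abs_le_of_sq_le_sq _ (by positivity)
    nlinarith [sq_nonneg (2 * (z.re : ℝ) - z.im)]

/-- Eisenstein integers as integer pairs. -/
def pairEquiv : Eis ≃ (Fin 2 → ℤ) where
  toFun z := ![z.re, z.im]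
  invFun v := ⟨v 0, v 1⟩
  left_inv z := by simp
  right_inv v := by ext i; fin_cases i <;> simp

lemma summable_rpow {a : ℝ} (ha : 2 < a) : Summable (fun z : Eis => ‖toC z‖ ^ (-a)) := by
  have h := (pairEquiv.summable_iff (f := fun v : Fin 2 → ℤ => ‖v‖ ^ (-a))).2
    (EisensteinSeries.summable_one_div_norm_rpow ha)
  refine Summable.of_nonneg_of_le (fun z => by positivity) (fun z => ?_) (h.mul_left (2 ^ a))
  by_cases hz : z = 0
  · subst hz
    rw [map_zero, norm_zero, Real.zero_rpow (by linarith)]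
    exact mul_nonneg (by positivity) (Real.rpow_nonneg (_root_.norm_nonneg (pairEquiv 0)) _)
  · have hpos : 0 < ‖(![z.re, z.im] : Fin 2 → ℤ)‖ := by
      rw [norm_pos_iff]
      intro h
      apply hz
      have h0 := congrFun h 0
      have h1 := congrFun h 1
      simp at h0 h1
      ext <;> simp [h0, h1]
    calc ‖toC z‖ ^ (-a) ≤ (‖(![z.re, z.im] : Fin 2 → ℤ)‖ / 2) ^ (-a) :=
          Real.rpow_le_rpow_of_nonpos (by positivity) (half_norm_le z) (by linarith)
      _ = 2 ^ a * ‖(![z.re, z.im] : Fin 2 → ℤ)‖ ^ (-a) := by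
          rw [Real.div_rpow (by positivity) (by norm_num), Real.rpow_neg (by norm_num : (0:ℝ) ≤ 2),
            div_inv_eq_mul, mul_comm]

lemma one_le_norm_toC {z : Eis} (hz : z ≠ 0) : 1 ≤ ‖toC z‖ := by
  have h := norm_toC_sq z
  have h1 : (1 : ℝ) ≤ z.norm := by exact_mod_cast norm_pos hz
  nlinarith [_root_.norm_nonneg (toC z)]

end Eis

section

open Eis

/-- Primary Eisenstein integers. -/
abbrev PrimaryE : Type := {z : Eis // IsPrimary z}

namespace Hecke

/-- The Hecke `L`-series as a sum over primary elements. -/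
noncomputable def heckeL (k : ℕ) (s : ℂ) : ℂ := ∑' z : PrimaryE, heckeF k s (toC z)

lemma toC_ne_zero {z : Eis} (hz : z ≠ 0) : toC z ≠ 0 := fun h =>
  hz (toC_injective (by rw [h, map_zero]))

lemma PrimaryE.toC_ne_zero (z : PrimaryE) : toC (z : Eis) ≠ 0 := Hecke.toC_ne_zero z.2.ne_zero

lemma summable_primary {a : ℝ} (ha : 2 < a) :
    Summable (fun z : PrimaryE => ‖toC (z : Eis)‖ ^ (-a)) :=
  (summable_rpow ha).comp_injective Subtype.val_injective

lemma norm_heckeF_le (k : ℕ) {s : ℂ} {σ : ℝ} (hs : σ ≤ s.re) (z : PrimaryE) :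
    ‖heckeF k s (toC z)‖ ≤ ‖toC (z : Eis)‖ ^ (-(2 * σ)) := by
  rw [norm_heckeF k s (PrimaryE.toC_ne_zero z)]
  exact Real.rpow_le_rpow_of_exponent_le (one_le_norm_toC z.2.ne_zero) (by linarith)

lemma summable_heckeF (k : ℕ) {s : ℂ} (hs : 1 < s.re) :
    Summable (fun z : PrimaryE => heckeF k s (toC z)) :=
  .of_norm_bounded (summable_primary (a := 2 * s.re) (by linarith)) fun z =>
    norm_heckeF_le k le_rfl z

lemma isOpen_re (σ : ℝ) : IsOpen {s : ℂ | σ < s.re} :=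
  isOpen_lt continuous_const Complex.continuous_re

lemma differentiableOn_heckeL (k : ℕ) : DifferentiableOn ℂ (heckeL k) {s | 1 < s.re} := by
  intro s hs
  simp only [Set.mem_ofPred_eq] at hs
  obtain ⟨σ, h1, h2⟩ := exists_between hs
  have := Complex.differentiableOn_tsum_of_summable_norm (U := {s : ℂ | σ < s.re})
    (F := fun (z : PrimaryE) s => heckeF k s (toC z))
    (summable_primary (a := 2 * σ) (by linarith))
    (fun z => (differentiable_heckeF k (PrimaryE.toC_ne_zero z)).differentiableOn) (isOpen_re σ)
    (fun z w hw => norm_heckeF_le k (le_of_lt hw) z)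
  exact (this.differentiableAt ((isOpen_re σ).mem_nhds h2)).differentiableWithinAt

lemma hasSum_deriv (k : ℕ) {s : ℂ} (hs : 1 < s.re) :
    HasSum (fun z : PrimaryE => (Real.log (z : Eis).norm : ℂ) * heckeF k s (toC z))
      (-deriv (heckeL k) s) := by
  obtain ⟨σ, h1, h2⟩ := exists_between hs
  have := Complex.hasSum_deriv_of_summable_norm (U := {s : ℂ | σ < s.re})
    (F := fun (z : PrimaryE) s => heckeF k s (toC z))
    (summable_primary (a := 2 * σ) (by linarith))
    (fun z => (differentiable_heckeF k (PrimaryE.toC_ne_zero z)).differentiableOn) (isOpen_re σ)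
    (fun z w hw => norm_heckeF_le k (le_of_lt hw) z) h2
  have e : (fun z : PrimaryE => (Real.log (z : Eis).norm : ℂ) * heckeF k s (toC z)) =
      fun z : PrimaryE => -deriv (fun s => heckeF k s (toC z)) s := by
    funext z
    rw [deriv_heckeF k s (PrimaryE.toC_ne_zero z), ← norm_toC_sq, Real.log_pow]
    push_cast
    ring
  rw [e]
  exact this.neg

/-! ### Continuation -/

/-- A cyclic shift of the primary elements; multiplied by `ω` it becomes translation by `ω - 1`. -/
def shiftEquiv : PrimaryE ≃ PrimaryE where
  toFun z := ⟨⟨z.1.im + 2 - z.1.re, 1 - z.1.re⟩, by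
    have h := z.2
    simp only [IsPrimary] at h ⊢
    constructor <;> omega⟩
  invFun z := ⟨⟨1 - z.1.im, z.1.re - 1 - z.1.im⟩, by
    have h := z.2
    simp only [IsPrimary] at h ⊢
    constructor <;> omega⟩
  left_inv z := by
    apply Subtype.ext
    ext <;> simp
    ring
  right_inv z := by
    apply Subtype.ext
    ext <;> simp
    ring

lemma rootC_mul_shift (z : PrimaryE) :
    rootC * toC (shiftEquiv z : Eis) = toC (z : Eis) + (rootC - 1) := by
  rw [toC_apply, toC_apply]
  simp only [shiftEquiv, Equiv.coe_fn_mk]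
  push_cast
  linear_combination (1 - (z : Eis).re : ℂ) * rootC_sq

lemma norm_rootC : ‖rootC‖ = 1 := by
  have h : Complex.normSq rootC = 1 := by
    rw [rootC, Complex.normSq_mk]
    have := Real.mul_self_sqrt (show (0 : ℝ) ≤ 3 by norm_num)
    linear_combination this / 4
  rw [← Complex.sq_norm] at h
  nlinarith [norm_nonneg rootC]

lemma norm_rootC_sub : ‖rootC - 1‖ ≤ 2 := by
  refine (norm_sub_le _ _).trans ?_
  rw [norm_rootC, norm_one]; norm_num

/-- The difference series that continues `heckeL`. -/
noncomputable def heckeH (k : ℕ) (s : ℂ) : ℂ :=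
  ∑' z : PrimaryE, (heckeF k s (toC z + (rootC - 1)) - heckeF k s (toC z))

lemma one_le_norm_shift (z : PrimaryE) : 1 ≤ ‖toC (z : Eis) + (rootC - 1)‖ := by
  rw [← rootC_mul_shift, norm_mul, norm_rootC, one_mul]
  exact one_le_norm_toC (shiftEquiv z).2.ne_zero

lemma differentiableOn_heckeH (k : ℕ) :
    DifferentiableOn ℂ (heckeH k) (Metric.ball (1 : ℂ) (1 / 4)) := by
  obtain ⟨C, hC⟩ := heckeF_sub_bound k
  refine Complex.differentiableOn_tsum_of_summable_norm
    ((summable_primary (a := 5 / 2) (by norm_num)).mul_left C)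
    (fun z => Differentiable.differentiableOn ?_) Metric.isOpen_ball (fun z w hw => ?_)
  · have h := one_le_norm_shift z
    exact (differentiable_heckeF k (norm_pos_iff.1 (by linarith))).sub
      (differentiable_heckeF k (PrimaryE.toC_ne_zero z))
  · exact hC w hw _ _ (one_le_norm_toC z.2.ne_zero) (one_le_norm_shift z)
      (by rw [add_sub_cancel_left]; exact norm_rootC_sub)

lemma heckeH_eq (k : ℕ) {s : ℂ} (hs : 1 < s.re) :
    heckeH k s = (rootC ^ k - 1) * heckeL k s := by
  have hF : heckeF k s rootC = rootC ^ k := by simp [heckeF, norm_rootC]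
  have e1 : ∀ z : PrimaryE, heckeF k s (toC z + (rootC - 1)) =
      rootC ^ k * heckeF k s (toC (shiftEquiv z : Eis)) := by
    intro z
    rw [← rootC_mul_shift, heckeF_mul, hF]
  have hsum := summable_heckeF k hs
  have hsum' : Summable (fun z : PrimaryE => heckeF k s (toC (shiftEquiv z : Eis))) :=
    (shiftEquiv.summable_iff (f := fun z : PrimaryE => heckeF k s (toC z))).2 hsum
  unfold heckeH
  simp only [e1]
  rw [Summable.tsum_sub (hsum'.mul_left _) hsum, tsum_mul_left]
  have := shiftEquiv.tsum_eq (fun z : PrimaryE => heckeF k s (toC z))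
  rw [this, heckeL]
  ring

lemma rootC_pow_ne_one {k : ℕ} (hk : ¬ 3 ∣ k) : rootC ^ k - 1 ≠ 0 := by
  rw [sub_ne_zero]
  intro h
  exact hk ((isPrimitiveRoot_rootC.pow_eq_one_iff_dvd k).1 h)

lemma tendsto_heckeL (k : ℕ) :
    Filter.Tendsto (fun n : ℕ => heckeL k (n : ℂ)) Filter.atTop (nhds 1) := by
  have h := tendsto_tsum_of_dominated_convergence (𝓕 := Filter.atTop)
    (f := fun (n : ℕ) (z : PrimaryE) => heckeF k (n : ℂ) (toC z))
    (g := fun z : PrimaryE => if z = ⟨1, isPrimary_one⟩ then 1 else 0)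
    (summable_primary (a := 4) (by norm_num)) ?_ ?_
  · rwa [tsum_ite_eq] at h
  · intro z
    split_ifs with hz
    · subst hz
      simp [heckeF_one]
    · rw [tendsto_zero_iff_norm_tendsto_zero]
      have h1 : 1 < ‖toC (z : Eis)‖ := by
        rcases (one_le_norm_toC z.2.ne_zero).lt_or_eq with h | h
        · exact h
        · exfalso
          apply hz
          apply Subtype.ext
          apply z.2.eq_one_of_norm
          have := norm_toC_sq (z : Eis)
          rw [← h] at this
          exact_mod_cast this.symm.trans (one_pow 2)
      have e : ∀ n : ℕ, ‖heckeF k (n : ℂ) (toC z)‖ = ((‖toC (z : Eis)‖ ^ 2)⁻¹) ^ n := by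
        intro n
        rw [norm_heckeF k _ (PrimaryE.toC_ne_zero z)]
        simp only [Complex.natCast_re]
        rw [neg_mul, Real.rpow_neg (norm_nonneg _), inv_pow, ← pow_mul, ← Real.rpow_natCast]
        push_cast
        rfl
      simp only [e]
      apply tendsto_pow_atTop_nhds_zero_of_lt_one (by positivity)
      apply inv_lt_one_of_one_lt₀
      nlinarith
  · filter_upwards [Filter.eventually_ge_atTop 2] with n hn z
    have := norm_heckeF_le k (s := (n : ℂ)) (σ := 2) (by simpa using (by exact_mod_cast hn)) z
    norm_num at this ⊢
    exact this

lemma heckeH_not_eventually_zero {k : ℕ} (hk : ¬ 3 ∣ k) :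
    ¬ ∀ᶠ s in nhds (1 : ℂ), heckeH k s = 0 := by
  intro h
  have hconv : Convex ℝ {s : ℂ | 1 < s.re} := convex_halfSpace_re_gt 1
  rw [Metric.eventually_nhds_iff] at h
  obtain ⟨ε, hε, h⟩ := h
  have hz : (1 + ((ε / 2 : ℝ) : ℂ)) ∈ {s : ℂ | 1 < s.re} := by
    simp [hε]
  have hev : heckeL k =ᶠ[nhds (1 + ((ε / 2 : ℝ) : ℂ))] 0 := by
    have h1 : Metric.ball (1 : ℂ) ε ∈ nhds (1 + ((ε / 2 : ℝ) : ℂ)) := by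
      apply Metric.isOpen_ball.mem_nhds
      rw [Metric.mem_ball, dist_eq_norm, add_sub_cancel_left, Complex.norm_real, Real.norm_eq_abs,
        abs_of_pos (by linarith)]
      linarith
    filter_upwards [h1, (isOpen_re 1).mem_nhds hz] with s hs1 hs2
    have := h hs1
    rw [heckeH_eq k hs2] at this
    simpa [rootC_pow_ne_one hk] using this
  have := ((differentiableOn_heckeL k).analyticOnNhd
    (isOpen_re 1)).eqOn_zero_of_preconnected_of_eventuallyEq_zero hconv.isPreconnected hz hev
  have hlim := tendsto_heckeL k
  have h0 : Filter.Tendsto (fun n : ℕ => heckeL k (n : ℂ)) Filter.atTop (nhds 0) := by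
    refine tendsto_const_nhds.congr' ?_
    filter_upwards [Filter.eventually_ge_atTop 2] with n hn
    refine (this (x := (n : ℂ)) ?_).symm
    simp only [Set.mem_ofPred_eq, Complex.natCast_re]
    exact_mod_cast hn
  exact one_ne_zero (tendsto_nhds_unique hlim h0)

end Hecke

end

section

open Eis

namespace Hecke

/-- The logarithm of the norm of a primary prime. -/
noncomputable def logN (π : PrimE) : ℝ := Real.log ((π : Eis).norm : ℝ)

lemma four_le_norm (π : PrimE) : (4 : ℝ) ≤ ((π : Eis).norm : ℝ) := by
  have h1 := π.2.2.norm_mod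
  have h2 := Eis.norm_pos π.2.2.ne_zero
  have h3 : (π : Eis).norm ≠ 1 := fun h => π.2.1.not_isUnit (isUnit_iff.2 h)
  have : (4 : ℤ) ≤ (π : Eis).norm := by omega
  exact_mod_cast this

lemma logN_pos (π : PrimE) : 0 < logN π := Real.log_pos (by linarith [four_le_norm π])

lemma logN_nonneg (π : PrimE) : 0 ≤ logN π := (logN_pos π).le

/-- A primary prime as a primary element. -/
def PrimE.toPrimary (π : PrimE) : PrimaryE := ⟨π, π.2.2⟩

lemma norm_heckeF_eq (k : ℕ) (s : ℂ) {z : Eis} (hz : z ≠ 0) :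
    ‖heckeF k s (toC z)‖ = (z.norm : ℝ) ^ (-s.re) := by
  rw [norm_heckeF k s (toC_ne_zero hz), ← norm_toC_sq, ← Real.rpow_natCast,
    ← Real.rpow_mul (norm_nonneg _)]
  congr 1
  push_cast
  ring

lemma summable_norm_prime (k : ℕ) {s : ℂ} (hs : 1 < s.re) :
    Summable (fun π : PrimE => logN π * ‖heckeF k s (toC (π : Eis))‖) := by
  have h := (hasSum_deriv k hs).summable.norm
  have hi : Function.Injective PrimE.toPrimary := fun a b hab =>
    Subtype.ext (congrArg (fun x : PrimaryE => (x : Eis)) hab)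
  refine (h.comp_injective hi).congr fun π => ?_
  simp only [Function.comp, PrimE.toPrimary, norm_mul, Complex.norm_real, Real.norm_eq_abs]
  rw [← logN, abs_of_nonneg (logN_nonneg π)]

/-- The prime power sum occurring in the logarithmic derivative. -/
noncomputable def primePowSum (k : ℕ) (s : ℂ) : ℂ :=
  ∑' t : PrimE × ℕ, (logN t.1 : ℂ) * heckeF k s (toC (t.1 : Eis)) ^ (t.2 + 1)

/-- The sum over primes weighted by `heckeF`. -/
noncomputable def primeSum (k : ℕ) (s : ℂ) : ℂ :=
  ∑' π : PrimE, (logN π : ℂ) * heckeF k s (toC (π : Eis))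

lemma heckeF_pow (k : ℕ) (s w : ℂ) (n : ℕ) : heckeF k s (w ^ n) = heckeF k s w ^ n := by
  induction n with
  | zero => simp [heckeF_one]
  | succ n ih => rw [pow_succ, heckeF_mul, ih, pow_succ]

open Classical in
/-- The double family relating the Dirichlet series to its prime powers. -/
noncomputable def logFamily (k : ℕ) (s : ℂ) (z : PrimaryE) (t : PrimE × ℕ) : ℂ :=
  if (t.1 : Eis) ^ (t.2 + 1) ∣ (z : Eis) then (logN t.1 : ℂ) * heckeF k s (toC z) else 0

lemma logFamily_eq (k : ℕ) (s : ℂ) (z : PrimaryE) (t : PrimE × ℕ) : logFamily k s z t =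
    (((open Classical in if (t.1 : Eis) ^ (t.2 + 1) ∣ (z : Eis) then
      Real.log ((t.1 : Eis).norm : ℝ) else 0 : ℝ)) : ℂ) * heckeF k s (toC z) := by
  unfold logFamily logN
  split_ifs <;> simp

lemma summable_logFamily (k : ℕ) {s : ℂ} (hs : 1 < s.re) :
    Summable (Function.uncurry (logFamily k s)) := by
  apply Summable.of_norm
  have hval : ∀ z : PrimaryE, HasSum (fun t => ‖logFamily k s z t‖)
      (Real.log (z : Eis).norm * ‖heckeF k s (toC z)‖) := by
    intro z
    have h0 := (hasSum_log_norm _ (z : Eis) z.2 (Int.toNat_of_nonneg (Eis.norm_nonneg _)).symm)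
    refine (h0.mul_right ‖heckeF k s (toC z)‖).congr_fun ?_
    intro t
    rw [logFamily_eq, norm_mul, Complex.norm_real, Real.norm_eq_abs, abs_of_nonneg]
    split_ifs
    · exact logN_nonneg t.1
    · exact le_rfl
  rw [summable_prod_of_nonneg (fun _ => norm_nonneg _)]
  refine ⟨fun z => (hval z).summable, ?_⟩
  have h := (hasSum_deriv k hs).summable.norm
  refine h.congr fun z => ?_
  have := (hval z).tsum_eq
  simp only [Function.uncurry_apply_pair] at this ⊢
  rw [this, norm_mul, Complex.norm_real, Real.norm_eq_abs, abs_of_nonneg]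
  apply Real.log_nonneg
  exact_mod_cast Eis.norm_pos z.2.ne_zero

lemma tsum_logFamily (k : ℕ) (s : ℂ) (t : PrimE × ℕ) : ∑' z, logFamily k s z t =
    (logN t.1 : ℂ) * heckeF k s (toC (t.1 : Eis)) ^ (t.2 + 1) * heckeL k s := by
  let g : PrimaryE → PrimaryE := fun z =>
    ⟨(t.1 : Eis) ^ (t.2 + 1) * z, (t.1.2.2.pow _).mul z.2⟩
  have hg : Function.Injective g := by
    intro a b hab
    have := congrArg (fun x : PrimaryE => (x : Eis)) hab
    exact Subtype.ext (mul_left_cancel₀ (pow_ne_zero _ t.1.2.2.ne_zero) this)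
  have hsupp : Function.support (fun z => logFamily k s z t) ⊆ Set.range g := by
    intro z hz
    simp only [Function.mem_support, logFamily] at hz
    split_ifs at hz with hd
    · obtain ⟨y, hy⟩ := hd
      have hz2 := z.2
      rw [hy] at hz2
      exact ⟨⟨y, (t.1.2.2.pow _).of_mul hz2⟩, Subtype.ext hy.symm⟩
    · exact absurd rfl hz
  rw [← hg.tsum_eq hsupp, heckeL, ← tsum_mul_left]
  congr 1
  funext z
  simp only [logFamily, g, dvd_mul_right, if_true, map_mul, map_pow, heckeF_mul, heckeF_pow]
  ring

lemma neg_deriv_heckeL (k : ℕ) {s : ℂ} (hs : 1 < s.re) :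
    -deriv (heckeL k) s = heckeL k s * primePowSum k s := by
  have h1 := (summable_logFamily k hs).tsum_comm
  simp only [tsum_logFamily] at h1
  rw [tsum_mul_right] at h1
  rw [mul_comm, primePowSum, h1, ← (hasSum_deriv k hs).tsum_eq]
  congr 1
  funext z
  have h0 := (hasSum_log_norm _ (z : Eis) z.2 (Int.toNat_of_nonneg (Eis.norm_nonneg _)).symm)
  simp only [logFamily_eq]
  rw [tsum_mul_right, ← Complex.ofReal_tsum, h0.tsum_eq]

lemma norm_pow_le (k : ℕ) {s : ℂ} (hs : 1 < s.re) (π : PrimE) (j : ℕ) :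
    ‖heckeF k s (toC (π : Eis)) ^ j‖ ≤ (1 / 4) ^ j := by
  rw [norm_pow]
  apply pow_le_pow_left₀ (_root_.norm_nonneg _)
  rw [norm_heckeF_eq k s π.2.2.ne_zero]
  have h4 := four_le_norm π
  calc ((π : Eis).norm : ℝ) ^ (-s.re) ≤ ((π : Eis).norm : ℝ) ^ (-1 : ℝ) :=
        Real.rpow_le_rpow_of_exponent_le (by linarith) (by linarith)
    _ ≤ 1 / 4 := by
        rw [Real.rpow_neg_one, one_div]
        exact inv_anti₀ (by norm_num) h4

lemma primePowSum_sub (k : ℕ) : ∃ K : ℝ, ∀ s : ℂ, 1 < s.re →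
    ‖primePowSum k s - primeSum k s‖ ≤ K := by
  have hgeo : Summable (fun j : ℕ => (1 / 4 : ℝ) ^ j) :=
    summable_geometric_of_lt_one (by norm_num) (by norm_num)
  have h2 := summable_norm_prime 0 (s := 2) (by simp)
  refine ⟨∑' π : PrimE, logN π * ‖heckeF 0 2 (toC (π : Eis))‖ * (∑' j : ℕ, (1 / 4 : ℝ) ^ j),
    fun s hs => ?_⟩
  have hfull : Summable (fun t : PrimE × ℕ =>
      (logN t.1 : ℂ) * heckeF k s (toC (t.1 : Eis)) ^ (t.2 + 1)) := by
    refine .of_norm_bounded ((summable_norm_prime k hs).mul_of_nonneg hgeo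
      (fun π => mul_nonneg (logN_nonneg π) (norm_nonneg _)) (fun j => by positivity)) fun t => ?_
    rw [norm_mul, Complex.norm_real, Real.norm_eq_abs, abs_of_nonneg (logN_nonneg _), pow_succ',
      norm_mul, ← mul_assoc]
    exact mul_le_mul_of_nonneg_left (norm_pow_le k hs _ _)
      (mul_nonneg (logN_nonneg _) (norm_nonneg _))
  have hrow : ∀ π : PrimE, Summable (fun j : ℕ =>
      (logN π : ℂ) * heckeF k s (toC (π : Eis)) ^ (j + 1)) := fun π => hfull.prod_factor π
  have hb : ∀ π : PrimE, ‖∑' j : ℕ, (logN π : ℂ) * heckeF k s (toC (π : Eis)) ^ (j + 1 + 1)‖ ≤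
      logN π * ‖heckeF 0 2 (toC (π : Eis))‖ * (∑' j : ℕ, (1 / 4 : ℝ) ^ j) := by
    intro π
    rw [← tsum_mul_left]
    refine tsum_of_norm_bounded (hgeo.mul_left _).hasSum fun j => ?_
    rw [norm_mul, Complex.norm_real, Real.norm_eq_abs, abs_of_nonneg (logN_nonneg _), mul_assoc,
      add_assoc, add_comm j, pow_add, norm_mul]
    refine mul_le_mul_of_nonneg_left ?_ (logN_nonneg _)
    refine mul_le_mul ?_ (norm_pow_le k hs _ _) (norm_nonneg _) (norm_nonneg _)
    rw [norm_pow, norm_heckeF_eq k s π.2.2.ne_zero, norm_heckeF_eq 0 2 π.2.2.ne_zero]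
    have h4 := four_le_norm π
    rw [← Real.rpow_natCast, ← Real.rpow_mul (by linarith)]
    apply Real.rpow_le_rpow_of_exponent_le (by linarith)
    norm_num
    linarith
  have hsecond := Summable.of_norm_bounded (h2.mul_right _) hb
  have hfirst : Summable (fun π : PrimE => (logN π : ℂ) * heckeF k s (toC (π : Eis))) := by
    refine Summable.of_norm ((summable_norm_prime k hs).congr fun π => ?_)
    rw [norm_mul, Complex.norm_real, Real.norm_eq_abs, abs_of_nonneg (logN_nonneg _)]
  have e : primePowSum k s - primeSum k s =
      ∑' π : PrimE, ∑' j : ℕ, (logN π : ℂ) * heckeF k s (toC (π : Eis)) ^ (j + 1 + 1) := by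
    rw [primePowSum, primeSum, hfull.tsum_prod' hrow, sub_eq_iff_eq_add, ← hsecond.tsum_add hfirst]
    congr 1
    funext π
    rw [(hrow π).tsum_eq_zero_add]
    simp only [zero_add, pow_one]
    ring
  rw [e]
  exact tsum_of_norm_bounded (h2.mul_right _).hasSum hb

open Filter Topology

lemma tendsto_one_add : Tendsto (fun t : ℝ => (1 + t : ℂ)) (𝓝[>] 0) (𝓝 1) := by
  have : Continuous (fun t : ℝ => (1 + t : ℂ)) := by fun_prop
  have h := this.tendsto 0
  simp only [Complex.ofReal_zero, add_zero] at h
  exact h.mono_left nhdsWithin_le_nhds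

lemma tendsto_ofReal_zero : Tendsto (fun t : ℝ => (t : ℂ)) (𝓝[>] 0) (𝓝 0) := by
  have h := Complex.continuous_ofReal.tendsto 0
  rw [Complex.ofReal_zero] at h
  exact h.mono_left nhdsWithin_le_nhds

lemma exists_order {k : ℕ} (hk : ¬ 3 ∣ k) : ∃ m : ℕ,
    Tendsto (fun t : ℝ => (t : ℂ) * primePowSum k (1 + t)) (𝓝[>] 0) (𝓝 (-(m : ℂ))) := by
  have hA : AnalyticAt ℂ (heckeH k) 1 := (differentiableOn_heckeH k).analyticAt
    (Metric.ball_mem_nhds _ (by norm_num))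
  obtain ⟨m, h, hh, h0, hev⟩ := hA.exists_eventuallyEq_pow_smul_nonzero_iff.2
    (heckeH_not_eventually_zero hk)
  refine ⟨m, ?_⟩
  have hlim : Tendsto (fun t : ℝ => -(m : ℂ) - t * (deriv h (1 + t) / h (1 + t))) (𝓝[>] 0)
      (𝓝 (-(m : ℂ) - 0 * (deriv h 1 / h 1))) := by
    refine tendsto_const_nhds.sub (tendsto_ofReal_zero.mul ?_)
    exact (hh.deriv.continuousAt.tendsto.comp tendsto_one_add).div
      (hh.continuousAt.tendsto.comp tendsto_one_add) h0
  rw [zero_mul, sub_zero] at hlim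
  refine hlim.congr' ?_
  have e1 := tendsto_one_add.eventually hev.eventually_nhds
  have e2 := tendsto_one_add.eventually hh.eventually_analyticAt
  have e3 := tendsto_one_add.eventually (hh.continuousAt.eventually_ne h0)
  filter_upwards [e1, e2, e3, self_mem_nhdsWithin] with t h1 h2 h3 ht
  have ht : 0 < t := ht
  have htc : (t : ℂ) ≠ 0 := by exact_mod_cast ht.ne'
  have hs : 1 < (1 + t : ℂ).re := by simp [ht]
  have hL : heckeH k =ᶠ[𝓝 (1 + t : ℂ)] fun s => (rootC ^ k - 1) * heckeL k s := by
    filter_upwards [(isOpen_re 1).mem_nhds hs] with s hs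
    exact heckeH_eq k hs
  have hd1 : deriv (heckeH k) (1 + t) = (rootC ^ k - 1) * deriv (heckeL k) (1 + t) := by
    rw [hL.deriv_eq, deriv_const_mul _ ((differentiableOn_heckeL k).differentiableAt
      ((isOpen_re 1).mem_nhds hs))]
  have hd2 : deriv (heckeH k) (1 + t) =
      m * (t : ℂ) ^ (m - 1) * h (1 + t) + (t : ℂ) ^ m * deriv h (1 + t) := by
    have h1' : heckeH k =ᶠ[𝓝 (1 + t : ℂ)] fun z => (z - 1) ^ m * h z := h1
    rw [h1'.deriv_eq]
    have ha : HasDerivAt (fun z : ℂ => (z - 1) ^ m)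
        (m * ((1 + t : ℂ) - 1) ^ (m - 1) * 1) (1 + t) :=
      ((hasDerivAt_id (1 + t : ℂ)).sub_const 1).pow m
    refine (ha.mul h2.differentiableAt.hasDerivAt).deriv.trans ?_
    simp
  have hv : heckeH k (1 + t) = (t : ℂ) ^ m * h (1 + t) := by
    have := h1.self_of_nhds
    simpa using this
  have key : deriv (heckeH k) (1 + t) = -(heckeH k (1 + t) * primePowSum k (1 + t)) := by
    rw [hd1, heckeH_eq k hs]
    linear_combination -(rootC ^ k - 1) * neg_deriv_heckeL k hs
  rw [hd2, hv] at key
  have hm : (m : ℂ) * (t : ℂ) ^ (m - 1) * t = m * (t : ℂ) ^ m := by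
    rcases m with _ | m
    · simp
    · simp [pow_succ, mul_assoc]
  have htm : (t : ℂ) ^ m ≠ 0 := pow_ne_zero _ htc
  field_simp
  apply mul_left_cancel₀ htm
  linear_combination (-t : ℂ) * key + h (1 + t) * hm

lemma tendsto_primeSum_of_primePowSum {k : ℕ} {c : ℂ}
    (h : Tendsto (fun t : ℝ => (t : ℂ) * primePowSum k (1 + t)) (𝓝[>] 0) (𝓝 c)) :
    Tendsto (fun t : ℝ => (t : ℂ) * primeSum k (1 + t)) (𝓝[>] 0) (𝓝 c) := by
  obtain ⟨K, hK⟩ := primePowSum_sub k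
  have h2 : Tendsto (fun t : ℝ => (t : ℂ) * (primePowSum k (1 + t) - primeSum k (1 + t)))
      (𝓝[>] 0) (𝓝 0) := by
    apply squeeze_zero_norm' (a := fun t : ℝ => t * K)
    · filter_upwards [self_mem_nhdsWithin] with t ht
      have ht : 0 < t := ht
      rw [norm_mul, Complex.norm_real, Real.norm_eq_abs, abs_of_pos ht]
      exact mul_le_mul_of_nonneg_left (hK _ (by simp [ht])) ht.le
    · have : Tendsto (fun t : ℝ => t * K) (𝓝 0) (𝓝 (0 * K)) :=
        tendsto_id.mul tendsto_const_nhds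
      rw [zero_mul] at this
      exact this.mono_left nhdsWithin_le_nhds
  have := h.sub h2
  rw [sub_zero] at this
  refine this.congr fun t => ?_
  ring

end Hecke

end

section

open Eis

namespace Hecke

open Filter Topology ArithmeticFunction.vonMangoldt

lemma tendsto_residue : Tendsto (fun t : ℝ =>
    t * ∑' n : ℕ, residueClass (1 : ZMod 3) n / (n : ℝ) ^ (1 + t)) (𝓝[>] 0) (𝓝 (1 / 2)) := by
  have ha : IsUnit (1 : ZMod 3) := isUnit_one
  have H {x : ℝ} (hx : 1 < x) :
      ∑' n, residueClass (1 : ZMod 3) n / (n : ℝ) ^ x =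
        (LFunctionResidueClassAux (1 : ZMod 3) x).re + (Nat.totient 3 : ℝ)⁻¹ / (x - 1) := by
    refine Complex.ofReal_injective ?_
    simp only [Complex.ofReal_tsum, Complex.ofReal_div, Complex.ofReal_cpow (Nat.cast_nonneg _),
      Complex.ofReal_natCast, Complex.ofReal_add, Complex.ofReal_inv, Complex.ofReal_sub,
      Complex.ofReal_one]
    simp_rw [← LFunctionResidueClassAux_real ha hx,
      eqOn_LFunctionResidueClassAux ha <| Set.mem_ofPred.mpr (Complex.ofReal_re x ▸ hx),
      sub_add_cancel, LSeries, LSeries.term]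
    refine tsum_congr fun n ↦ ?_
    split_ifs with hn
    · simp only [hn, residueClass_apply_zero, Complex.ofReal_zero, zero_div]
    · rfl
  have hcont : Tendsto (fun t : ℝ => (LFunctionResidueClassAux (1 : ZMod 3) (1 + t : ℂ)).re)
      (𝓝[>] 0) (𝓝 (LFunctionResidueClassAux (1 : ZMod 3) (1 : ℂ)).re) := by
    have hc := continuousOn_LFunctionResidueClassAux (1 : ZMod 3)
    have h1 := (hc 1 (by simp)).tendsto
    refine (Complex.continuous_re.tendsto _).comp (h1.comp ?_)
    refine tendsto_nhdsWithin_iff.2 ⟨tendsto_one_add, ?_⟩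
    filter_upwards [self_mem_nhdsWithin] with t ht
    have ht : 0 < t := ht
    simp [ht.le]
  have h0 : Tendsto (fun t : ℝ => t) (𝓝[>] 0) (𝓝 0) := nhdsWithin_le_nhds
  have h := (h0.mul hcont).add_const (1 / 2 : ℝ)
  rw [zero_mul, zero_add] at h
  refine h.congr' ?_
  filter_upwards [self_mem_nhdsWithin] with t ht
  have ht : 0 < t := ht
  have htot : (Nat.totient 3 : ℝ) = 2 := by rw [show Nat.totient 3 = 2 from by decide]; norm_num
  rw [H (by linarith), htot]
  push_cast
  generalize (LFunctionResidueClassAux (1 : ZMod 3) (1 + t : ℂ)).re = y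
  rw [add_sub_cancel_left]
  field_simp

/-- Rational primes that split in the Eisenstein integers. -/
abbrev SplitPrime : Type := {p : ℕ // p.Prime ∧ p % 3 = 1}

lemma exists_primary_norm (p : SplitPrime) : ∃ z : Eis, z.norm = (p : ℕ) ∧ IsPrimary z := by
  have := Fact.mk p.2.1
  obtain ⟨z, h1, h2, -⟩ := exists_primary_cubeCount p.2.2
  exact ⟨z, h1, h2⟩

lemma summable_residue {t : ℝ} (ht : 0 < t) :
    Summable (fun n : ℕ => residueClass (1 : ZMod 3) n / (n : ℝ) ^ (1 + t)) := by
  have h : LSeriesSummable (fun n => ((ArithmeticFunction.vonMangoldt n : ℝ) : ℂ)) (1 + t : ℂ) :=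
    ArithmeticFunction.LSeriesSummable_vonMangoldt (by simp [ht])
  refine .of_nonneg_of_le (fun n => div_nonneg (residueClass_nonneg _ _) (by positivity))
    (fun n => ?_) h.norm
  rw [LSeries.term]
  split_ifs with hn
  · simp [hn]
  · rw [norm_div, Complex.norm_real, Real.norm_eq_abs,
      abs_of_nonneg ArithmeticFunction.vonMangoldt_nonneg,
      Complex.norm_natCast_cpow_of_pos (Nat.pos_of_ne_zero hn)]
    simp only [Complex.add_re, Complex.one_re, Complex.ofReal_re]
    gcongr
    exact residueClass_le _ _

lemma tendsto_of_bounded_diff {f g : ℝ → ℝ} {c K : ℝ}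
    (hf : Tendsto (fun t => t * f t) (𝓝[>] 0) (𝓝 c)) (h : ∀ t, 0 < t → |g t - f t| ≤ K) :
    Tendsto (fun t => t * g t) (𝓝[>] 0) (𝓝 c) := by
  have h0 : Tendsto (fun t : ℝ => t) (𝓝[>] 0) (𝓝 0) := nhdsWithin_le_nhds
  have h2 : Tendsto (fun t => t * (g t - f t)) (𝓝[>] 0) (𝓝 0) := by
    apply squeeze_zero_norm' (a := fun t : ℝ => t * K)
    · filter_upwards [self_mem_nhdsWithin] with t ht
      have ht : 0 < t := ht
      rw [norm_mul, Real.norm_eq_abs, Real.norm_eq_abs, abs_of_pos ht]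
      exact mul_le_mul_of_nonneg_left (h t ht) ht.le
    · simpa using h0.mul_const K
  have := hf.add h2
  rw [add_zero] at this
  exact this.congr fun t => by ring

lemma tendsto_splitPrime : Tendsto (fun t : ℝ =>
    t * ∑' p : SplitPrime, Real.log (p : ℕ) / ((p : ℕ) : ℝ) ^ (1 + t)) (𝓝[>] 0) (𝓝 (1 / 2)) := by
  have hs := summable_residueClass_non_primes_div (1 : ZMod 3)
  refine tendsto_of_bounded_diff (K := ∑' n : ℕ,
    (if n.Prime then 0 else residueClass (1 : ZMod 3) n) / (n : ℝ)) tendsto_residue fun t ht => ?_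
  have h1 : Summable (fun n : ℕ =>
      (if n.Prime then 0 else residueClass (1 : ZMod 3) n / (n : ℝ) ^ (1 + t))) := by
    refine .of_nonneg_of_le (fun n => ?_) (fun n => ?_) (summable_residue ht)
    · split_ifs
      · exact le_rfl
      · exact div_nonneg (residueClass_nonneg _ _) (by positivity)
    · split_ifs
      · exact div_nonneg (residueClass_nonneg _ _) (by positivity)
      · exact le_rfl
  have h2 : Summable (fun n : ℕ =>
      (if n.Prime then residueClass (1 : ZMod 3) n / (n : ℝ) ^ (1 + t) else 0)) := by
    refine ((summable_residue ht).sub h1).congr fun n => ?_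
    split_ifs <;> simp
  have e1 : ∑' n : ℕ, residueClass (1 : ZMod 3) n / (n : ℝ) ^ (1 + t) =
      (∑' n : ℕ, (if n.Prime then residueClass (1 : ZMod 3) n / (n : ℝ) ^ (1 + t) else 0)) +
      ∑' n : ℕ, (if n.Prime then 0 else residueClass (1 : ZMod 3) n / (n : ℝ) ^ (1 + t)) := by
    rw [← h2.tsum_add h1]
    congr 1
    funext n
    split_ifs <;> simp
  have hmod : ∀ n : ℕ, ((n : ZMod 3) = 1) ↔ n % 3 = 1 := by
    intro n
    have := ZMod.natCast_eq_natCast_iff' n 1 3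
    simpa using this
  have e2 : ∑' p : SplitPrime, Real.log (p : ℕ) / ((p : ℕ) : ℝ) ^ (1 + t) =
      ∑' n : ℕ, (if n.Prime then residueClass (1 : ZMod 3) n / (n : ℝ) ^ (1 + t) else 0) := by
    have hi : Function.Injective (fun p : SplitPrime => (p : ℕ)) := Subtype.val_injective
    rw [← hi.tsum_eq]
    · congr 1
      funext p
      have hr : residueClass (1 : ZMod 3) (p : ℕ) = Real.log (p : ℕ) := by
        unfold residueClass
        rw [Set.indicator_of_mem (by exact (hmod p).2 p.2.2),
          ArithmeticFunction.vonMangoldt_apply_prime p.2.1]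
      rw [if_pos p.2.1, hr]
    · intro n hn
      rw [Function.mem_support] at hn
      split_ifs at hn with hp
      · have h1 : (n : ZMod 3) = 1 := by
          by_contra hne
          apply hn
          unfold residueClass
          rw [Set.indicator_of_notMem (by exact hne), zero_div]
        exact ⟨⟨n, hp, (hmod n).1 h1⟩, rfl⟩
      · exact absurd rfl hn
  rw [e2, e1, sub_add_cancel_left, abs_neg, ← Real.norm_eq_abs]
  refine tsum_of_norm_bounded hs.hasSum fun n => ?_
  rw [Real.norm_eq_abs]
  split_ifs
  · simp
  · rw [abs_of_nonneg (div_nonneg (residueClass_nonneg _ _) (by positivity))]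
    rcases Nat.eq_zero_or_pos n with rfl | hn
    · simp
    · have : (1 : ℝ) ≤ n := by exact_mod_cast hn
      apply div_le_div_of_nonneg_left (residueClass_nonneg _ _) (by positivity)
      calc (n : ℝ) = (n : ℝ) ^ (1 : ℝ) := (Real.rpow_one _).symm
        _ ≤ (n : ℝ) ^ (1 + t) := Real.rpow_le_rpow_of_exponent_le this (by linarith)

/-- The weight of a primary prime. -/
noncomputable def wt (t : ℝ) (π : PrimE) : ℝ := logN π * ((π : Eis).norm : ℝ) ^ (-(1 + t))

lemma wt_nonneg (t : ℝ) (π : PrimE) : 0 ≤ wt t π :=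
  mul_nonneg (logN_nonneg π) (Real.rpow_nonneg (by linarith [four_le_norm π]) _)

lemma summable_wt {t : ℝ} (ht : 0 < t) : Summable (wt t) := by
  refine (summable_norm_prime 0 (s := (1 + t : ℂ)) (by simp [ht])).congr fun π => ?_
  rw [norm_heckeF_eq 0 _ π.2.2.ne_zero, wt]
  simp

/-- Primary primes of prime norm. -/
def splitSet : Set PrimE := {π | ∃ p : ℕ, p.Prime ∧ (π : Eis).norm = p}

lemma inert_norm {π : PrimE} (h : π ∉ splitSet) :
    ∃ p : ℕ, p.Prime ∧ Associated (π : Eis) (p : Eis) ∧ (π : Eis).norm = (p : ℤ) ^ 2 := by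
  rcases prime_cases π.2.1 with h1 | ⟨p, hp, ha⟩
  · exact absurd h1 h
  · refine ⟨p, hp, ha, ?_⟩
    obtain ⟨u, hu⟩ := ha
    have := congrArg QuadraticAlgebra.norm hu
    rw [map_mul, isUnit_iff.1 u.isUnit, mul_one, norm_natCast'] at this
    exact this

/-- The rational prime below an inert primary prime. -/
noncomputable def inertPrime (π : ↥splitSetᶜ) : ℕ := (inert_norm π.2).choose

lemma inertPrime_injective : Function.Injective inertPrime := by
  intro a b hab
  have ha := (inert_norm a.2).choose_spec.2.1
  have hb := (inert_norm b.2).choose_spec.2.1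
  change Associated _ ((inertPrime a : ℕ) : Eis) at ha
  change Associated _ ((inertPrime b : ℕ) : Eis) at hb
  rw [hab] at ha
  exact Subtype.ext (Subtype.ext (a.1.2.2.eq_of_associated b.1.2.2 (ha.trans hb.symm)))

lemma summable_inert : Summable (fun π : ↥splitSetᶜ => wt 0 π) := by
  have h := ((Real.summable_nat_rpow (p := -(3 / 2))).2 (by norm_num)).comp_injective
    inertPrime_injective
  refine .of_nonneg_of_le (fun π => wt_nonneg 0 _) (fun π => ?_) (h.mul_left 4)
  obtain ⟨hp, -, hn⟩ := (inert_norm π.2).choose_spec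
  change (inertPrime π).Prime at hp
  change _ = ((inertPrime π : ℕ) : ℤ) ^ 2 at hn
  simp only [Function.comp, wt, logN, hn]
  set p := inertPrime π
  have hp0 : (0 : ℝ) < p := by exact_mod_cast hp.pos
  have hl := Real.log_le_rpow_div hp0.le (show (0 : ℝ) < 1 / 2 by norm_num)
  push_cast
  rw [Real.log_pow, ← Real.rpow_natCast, ← Real.rpow_mul hp0.le]
  norm_num
  have e : (p : ℝ) ^ (-(3 / 2) : ℝ) = (p : ℝ) ^ (1 / 2 : ℝ) * (p : ℝ) ^ (-2 : ℝ) := by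
    rw [← Real.rpow_add hp0]; norm_num
  have e2 : ((p : ℝ) ^ 2)⁻¹ = (p : ℝ) ^ (-2 : ℝ) := by
    rw [Real.rpow_neg hp0.le]; norm_num
  rw [e, e2, ← mul_assoc]
  refine mul_le_mul_of_nonneg_right ?_ (by positivity)
  linarith

lemma tsum_splitSet {t : ℝ} (ht : 0 < t) : ∑' π : ↥splitSet, wt t π =
    2 * ∑' p : SplitPrime, Real.log (p : ℕ) / ((p : ℕ) : ℝ) ^ (1 + t) := by
  choose z hz1 hz2 using exists_primary_norm
  let y : SplitPrime × Bool → Eis := fun x => if x.2 then z x.1 else star (z x.1)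
  have hy1 : ∀ x, (y x).norm = (x.1 : ℕ) := by
    rintro ⟨p, b⟩
    cases b <;> simp [y, hz1, QuadraticAlgebra.norm_star]
  have hy2 : ∀ x, IsPrimary (y x) := by
    rintro ⟨p, b⟩
    cases b <;> simp [y, hz2, IsPrimary.star]
  let e : SplitPrime × Bool → ↥splitSet := fun x =>
    ⟨⟨y x, prime_of_norm_prime x.1.2.1 (hy1 x), hy2 x⟩, x.1, x.1.2.1, hy1 x⟩
  have hstar : ∀ p : SplitPrime, z p ≠ star (z p) := by
    intro p h
    have him : (z p).im = 0 := by
      have := congrArg QuadraticAlgebra.im h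
      simp at this
      omega
    have hn := hz1 p
    rw [norm_eq, him] at hn
    have hsq : ((p : ℕ) : ℤ) = (z p).re ^ 2 := by rw [← hn]; ring
    have hpp : Prime ((p : ℕ) : ℤ) := Nat.prime_iff_prime_int.1 p.2.1
    rw [hsq] at hpp
    exact hpp.irreducible.not_isSquare ⟨_, sq _⟩
  have he : Function.Bijective e := by
    constructor
    · rintro ⟨p, b⟩ ⟨p', b'⟩ h
      have h1 : y (p, b) = y (p', b') := congrArg (fun x : ↥splitSet => ((x : PrimE) : Eis)) h
      have h2 := congrArg QuadraticAlgebra.norm h1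
      rw [hy1, hy1] at h2
      have hp : p = p' := Subtype.ext (by exact_mod_cast h2)
      subst hp
      congr 1
      cases b <;> cases b' <;> simp [y] at h1 ⊢
      · exact hstar p h1.symm
      · exact hstar p h1
    · rintro ⟨⟨x, hx1, hx2⟩, p, hp, hn⟩
      change x.norm = p at hn
      have hm : p % 3 = 1 := by
        have := hx2.norm_mod
        rw [hn] at this
        omega
      rcases eq_or_eq_star hp (hz2 ⟨p, hp, hm⟩) hx2 (hz1 ⟨p, hp, hm⟩) hn with h | h
      · exact ⟨(⟨p, hp, hm⟩, true), Subtype.ext (Subtype.ext (by simp [e, y, h]))⟩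
      · exact ⟨(⟨p, hp, hm⟩, false), Subtype.ext (Subtype.ext (by simp [e, y, h]))⟩
  let E := Equiv.ofBijective e he
  have hval : ∀ x, wt t (E x : PrimE) = Real.log (x.1 : ℕ) / ((x.1 : ℕ) : ℝ) ^ (1 + t) := by
    intro x
    have : (((E x : PrimE) : Eis).norm) = (x.1 : ℕ) := hy1 x
    simp only [wt, logN, this, Int.cast_natCast]
    rw [Real.rpow_neg (by positivity), div_eq_mul_inv]
  have hsum : Summable (fun x : SplitPrime × Bool =>
      Real.log (x.1 : ℕ) / ((x.1 : ℕ) : ℝ) ^ (1 + t)) := by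
    have h := (summable_wt ht).subtype splitSet
    exact ((E.summable_iff (f := fun π : ↥splitSet => wt t π)).2 h).congr hval
  rw [← E.tsum_eq]
  simp only [hval]
  rw [hsum.tsum_prod, ← tsum_mul_left]
  congr 1
  funext p
  rw [tsum_fintype]
  simp only [Fintype.sum_bool]
  ring

lemma tendsto_wt : Tendsto (fun t : ℝ => t * ∑' π, wt t π) (𝓝[>] 0) (𝓝 1) := by
  have h := tendsto_splitPrime.const_mul 2
  norm_num at h
  have h' : Tendsto (fun t : ℝ => t * (2 * ∑' p : SplitPrime,
      Real.log (p : ℕ) / ((p : ℕ) : ℝ) ^ (1 + t))) (𝓝[>] 0) (𝓝 1) := by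
    refine h.congr fun t => ?_
    ring
  refine tendsto_of_bounded_diff (K := ∑' π : ↥splitSetᶜ, wt 0 π) h' fun t ht => ?_
  have hw := summable_wt ht
  have hsplit := (hw.subtype splitSet).tsum_add_tsum_compl (hw.subtype splitSetᶜ)
  rw [← tsum_splitSet ht, ← hsplit]
  change |∑' π : ↥splitSet, wt t π + ∑' π : ↥splitSetᶜ, wt t π - ∑' π : ↥splitSet, wt t π| ≤ _
  rw [add_sub_cancel_left, abs_of_nonneg (tsum_nonneg fun π => wt_nonneg t _)]
  refine (hw.subtype _).tsum_le_tsum (fun π => ?_) summable_inert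
  refine mul_le_mul_of_nonneg_left ?_ (logN_nonneg _)
  exact Real.rpow_le_rpow_of_exponent_le (by linarith [four_le_norm π]) (by linarith)

/-- Cosine of `k` times the argument of a primary prime. -/
noncomputable def cosK (k : ℕ) (π : PrimE) : ℝ := ((toC (π : Eis) / ‖toC (π : Eis)‖) ^ k).re

lemma norm_unit (π : PrimE) : ‖toC (π : Eis) / (‖toC (π : Eis)‖ : ℂ)‖ = 1 :=
  norm_unit_part (toC_ne_zero π.2.2.ne_zero)

lemma abs_cosK (k : ℕ) (π : PrimE) : |cosK k π| ≤ 1 := by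
  refine (Complex.abs_re_le_norm _).trans ?_
  rw [norm_pow, norm_unit, one_pow]

lemma cosK_two_mul (k : ℕ) (π : PrimE) : cosK (2 * k) π = 2 * cosK k π ^ 2 - 1 := by
  unfold cosK
  have h : ‖(toC (π : Eis) / (‖toC (π : Eis)‖ : ℂ)) ^ k‖ = 1 := by
    rw [norm_pow, norm_unit, one_pow]
  rw [mul_comm, pow_mul]
  set u := (toC (π : Eis) / (‖toC (π : Eis)‖ : ℂ)) ^ k
  have h2 : u.re ^ 2 + u.im ^ 2 = 1 := by
    have := Complex.sq_norm u
    rw [h, Complex.normSq_apply] at this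
    linarith
  rw [sq, Complex.mul_re]
  linarith

lemma summable_wt_mul {t : ℝ} (ht : 0 < t) {f : PrimE → ℝ} {K : ℝ} (hf : ∀ π, |f π| ≤ K) :
    Summable (fun π => wt t π * f π) := by
  refine .of_norm_bounded ((summable_wt ht).mul_right K) fun π => ?_
  rw [norm_mul, Real.norm_eq_abs, Real.norm_eq_abs, abs_of_nonneg (wt_nonneg t π)]
  exact mul_le_mul_of_nonneg_left (hf π) (wt_nonneg t π)

lemma re_heckeF (k : ℕ) (t : ℝ) (π : PrimE) :
    (((logN π : ℂ) * heckeF k (1 + t) (toC (π : Eis))).re) = wt t π * cosK k π := by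
  have h : (‖toC (π : Eis)‖ : ℂ) ^ (-2 * (1 + t : ℂ)) =
      ((((π : Eis).norm : ℝ) ^ (-(1 + t)) : ℝ) : ℂ) := by
    rw [← norm_toC_sq, ← Real.rpow_natCast, ← Real.rpow_mul (norm_nonneg _),
      Complex.ofReal_cpow (norm_nonneg _)]
    congr 1
    push_cast
    ring
  unfold heckeF wt cosK
  rw [h, Complex.re_ofReal_mul, mul_comm _ ((_ : ℝ) : ℂ), Complex.re_ofReal_mul]
  ring

lemma re_primeSum (k : ℕ) {t : ℝ} (ht : 0 < t) :
    (primeSum k (1 + t)).re = ∑' π, wt t π * cosK k π := by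
  have hfirst : Summable (fun π : PrimE => (logN π : ℂ) * heckeF k (1 + t) (toC (π : Eis))) := by
    refine Summable.of_norm ((summable_norm_prime k (s := (1 + t : ℂ)) (by simp [ht])).congr
      fun π => ?_)
    rw [norm_mul, Complex.norm_real, Real.norm_eq_abs, abs_of_nonneg (logN_nonneg _)]
  rw [primeSum, Complex.re_tsum hfirst]
  simp only [re_heckeF]

lemma exists_order_cosK {k : ℕ} (hk : ¬ 3 ∣ k) : ∃ m : ℕ,
    Tendsto (fun t : ℝ => t * ∑' π, wt t π * cosK k π) (𝓝[>] 0) (𝓝 (-(m : ℝ))) := by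
  obtain ⟨m, hm⟩ := exists_order hk
  refine ⟨m, ?_⟩
  have h := (Complex.continuous_re.tendsto _).comp (tendsto_primeSum_of_primePowSum hm)
  simp only [Complex.neg_re, Complex.natCast_re] at h
  refine h.congr' ?_
  filter_upwards [self_mem_nhdsWithin] with t ht
  simp only [Function.comp, Complex.re_ofReal_mul]
  rw [re_primeSum k ht]

/-- Equidistribution in its Dirichlet series form: the twisted sums have no pole. -/
lemma tendsto_cosK {k : ℕ} (hk : ¬ 3 ∣ k) :
    Tendsto (fun t : ℝ => t * ∑' π, wt t π * cosK k π) (𝓝[>] 0) (𝓝 0) := by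
  obtain ⟨m, hm⟩ := exists_order_cosK hk
  obtain ⟨m', hm'⟩ := exists_order_cosK (k := 2 * k) (by omega)
  have hlim := ((tendsto_wt.const_mul 3).add (hm.const_mul 4)).add hm'
  have hnn : 0 ≤ 3 * 1 + 4 * -(m : ℝ) + -(m' : ℝ) := by
    refine ge_of_tendsto hlim ?_
    filter_upwards [self_mem_nhdsWithin] with t ht
    have ht : 0 < t := ht
    have s0 := summable_wt ht
    have s1 := summable_wt_mul ht (abs_cosK k)
    have s2 := summable_wt_mul ht (abs_cosK (2 * k))
    have : 3 * (t * ∑' π, wt t π) + 4 * (t * ∑' π, wt t π * cosK k π) +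
        t * ∑' π, wt t π * cosK (2 * k) π =
        t * ∑' π, wt t π * (2 * (1 + cosK k π) ^ 2) := by
      have e : ∀ π, wt t π * (2 * (1 + cosK k π) ^ 2) =
          3 * wt t π + 4 * (wt t π * cosK k π) + wt t π * cosK (2 * k) π := by
        intro π
        rw [cosK_two_mul]
        ring
      simp only [e]
      rw [((s0.mul_left 3).add (s1.mul_left 4)).tsum_add s2,
        (s0.mul_left 3).tsum_add (s1.mul_left 4), tsum_mul_left, tsum_mul_left]
      ring
    rw [this]
    exact mul_nonneg ht.le (tsum_nonneg fun π => mul_nonneg (wt_nonneg t π) (by positivity))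
  have hm0 : m = 0 := by
    by_contra hne
    have h1 : (1 : ℝ) ≤ m := by exact_mod_cast Nat.one_le_iff_ne_zero.2 hne
    have h2 : (0 : ℝ) ≤ m' := Nat.cast_nonneg _
    linarith
  rw [hm0] at hm
  simpa using hm

end Hecke

end

section

open Eis

namespace Hecke

open Filter Topology Polynomial

lemma wt_mul_pow (t : ℝ) (j : ℕ) (π : PrimE) :
    wt t π * (((π : Eis).norm : ℝ) ^ (-t)) ^ j = wt ((j + 1) * t) π := by
  have h4 := four_le_norm π
  unfold wt
  rw [← Real.rpow_natCast, ← Real.rpow_mul (by linarith), mul_assoc,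
    ← Real.rpow_add (by linarith)]
  congr 2
  ring

lemma norm_rpow_mem {t : ℝ} (ht : 0 < t) (π : PrimE) :
    ((π : Eis).norm : ℝ) ^ (-t) ∈ Set.Icc (0 : ℝ) 1 := by
  have h4 := four_le_norm π
  exact ⟨Real.rpow_nonneg (by linarith) _,
    Real.rpow_le_one_of_one_le_of_nonpos (by linarith) (by linarith)⟩

lemma poly_bounded (P : ℝ[X]) : ∃ K : ℝ, ∀ u ∈ Set.Icc (0 : ℝ) 1, |P.eval u| ≤ K := by
  obtain ⟨K, hK⟩ := isCompact_Icc.exists_bound_of_continuousOn (P.continuous.continuousOn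
    (s := Set.Icc (0 : ℝ) 1))
  exact ⟨K, fun u hu => by simpa using hK u hu⟩

/-- Karamata's device: an Abelian asymptotic transfers to polynomial test functions. -/
lemma tendsto_poly {f : PrimE → ℝ} {K c : ℝ} (hf : ∀ π, |f π| ≤ K)
    (h : Tendsto (fun t : ℝ => t * ∑' π, wt t π * f π) (𝓝[>] 0) (𝓝 c)) (P : ℝ[X]) :
    Tendsto (fun t : ℝ => t * ∑' π : PrimE, wt t π *
      (f π * P.eval (((π : Eis).norm : ℝ) ^ (-t)))) (𝓝[>] 0)
      (𝓝 (c * ∫ u in (0 : ℝ)..1, P.eval u)) := by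
  have hsum : ∀ (P : ℝ[X]) {t : ℝ}, 0 < t → Summable (fun π : PrimE => wt t π *
      (f π * P.eval (((π : Eis).norm : ℝ) ^ (-t)))) := by
    intro P t ht
    obtain ⟨B, hB⟩ := poly_bounded P
    refine summable_wt_mul ht (K := K * B) fun π => ?_
    rw [abs_mul]
    exact mul_le_mul (hf π) (hB _ (norm_rpow_mem ht π)) (abs_nonneg _)
      ((abs_nonneg _).trans (hf π))
  induction P using Polynomial.induction_on' with
  | add P Q hP hQ =>
    have hi : ∫ u in (0 : ℝ)..1, (P + Q).eval u =
        (∫ u in (0 : ℝ)..1, P.eval u) + ∫ u in (0 : ℝ)..1, Q.eval u := by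
      simp only [eval_add]
      exact intervalIntegral.integral_add (P.continuous.intervalIntegrable _ _)
        (Q.continuous.intervalIntegrable _ _)
    rw [hi, mul_add]
    refine (hP.add hQ).congr' ?_
    filter_upwards [self_mem_nhdsWithin] with t ht
    rw [← mul_add, ← (hsum P ht).tsum_add (hsum Q ht)]
    congr 2
    funext π
    rw [eval_add]
    ring
  | monomial j a =>
    have hi : ∫ u in (0 : ℝ)..1, (monomial j a).eval u = a / (j + 1) := by
      simp only [eval_monomial]
      rw [intervalIntegral.integral_const_mul, integral_pow]
      simp
      ring
    rw [hi]
    have hj : (0 : ℝ) < j + 1 := by positivity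
    have hsc : Tendsto (fun t : ℝ => ((j : ℝ) + 1) * t) (𝓝[>] 0) (𝓝[>] 0) := by
      refine tendsto_nhdsWithin_iff.2 ⟨?_, ?_⟩
      · have : Tendsto (fun t : ℝ => ((j : ℝ) + 1) * t) (𝓝 0) (𝓝 (((j : ℝ) + 1) * 0)) :=
          tendsto_id.const_mul _
        rw [mul_zero] at this
        exact this.mono_left nhdsWithin_le_nhds
      · filter_upwards [self_mem_nhdsWithin] with t ht
        exact mul_pos hj ht
    have h2 := (h.comp hsc).const_mul (a / (j + 1))
    rw [mul_comm] at h2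
    refine h2.congr' (Eventually.of_forall fun t => ?_)
    simp only [Function.comp]
    have e : ∀ π : PrimE, wt t π * (f π * (monomial j a).eval (((π : Eis).norm : ℝ) ^ (-t))) =
        a * (wt ((j + 1) * t) π * f π) := by
      intro π
      rw [eval_monomial, ← wt_mul_pow]
      ring
    simp only [e]
    rw [tsum_mul_left]
    field_simp

/-- The lower minorant used to detect primes with large real part. -/
noncomputable def minorant (π : PrimE) : ℝ := (cosK 1 π + cosK 1 π ^ 2) / 2 - 9 / 128

lemma abs_minorant (π : PrimE) : |minorant π| ≤ 1 := by
  have h := abs_le.1 (abs_cosK 1 π)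
  unfold minorant
  rw [abs_le]
  constructor <;> nlinarith [sq_nonneg (cosK 1 π + 1 / 2)]

lemma minorant_nonpos {π : PrimE} (h : cosK 1 π < 1 / 8) : minorant π ≤ 0 := by
  have h' := abs_le.1 (abs_cosK 1 π)
  unfold minorant
  nlinarith

lemma tendsto_minorant :
    Tendsto (fun t : ℝ => t * ∑' π, wt t π * minorant π) (𝓝[>] 0) (𝓝 (23 / 128)) := by
  have h := ((tendsto_cosK (k := 1) (by norm_num)).mul_const (1 / 2)).add
    (((tendsto_cosK (k := 2) (by norm_num)).mul_const (1 / 4)).add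
      (tendsto_wt.mul_const (23 / 128)))
  norm_num at h
  refine h.congr' ?_
  filter_upwards [self_mem_nhdsWithin] with t ht
  have s0 := summable_wt ht
  have s1 := summable_wt_mul ht (abs_cosK 1)
  have s2 := summable_wt_mul ht (abs_cosK 2)
  have e : ∀ π, wt t π * minorant π = wt t π * cosK 1 π * (1 / 2) +
      (wt t π * cosK 2 π * (1 / 4) + wt t π * (23 / 128)) := by
    intro π
    have := cosK_two_mul 1 π
    unfold minorant
    rw [mul_one] at this
    rw [this]
    ring
  simp only [e]
  rw [(s1.mul_right _).tsum_add ((s2.mul_right _).add (s0.mul_right _)),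
    (s2.mul_right _).tsum_add (s0.mul_right _), tsum_mul_right, tsum_mul_right, tsum_mul_right]
  ring

/-- A tent function supported on a short window. -/
noncomputable def tent (u : ℝ) : ℝ := max 0 (min (u - Real.exp (-1)) (Real.exp (-0.91) - u))

lemma continuous_tent : Continuous tent := by unfold tent; fun_prop

lemma tent_nonneg (u : ℝ) : 0 ≤ tent u := le_max_left _ _

lemma tent_le_one {u : ℝ} (hu : u ≤ 1) : tent u ≤ 1 := by
  unfold tent
  refine max_le zero_le_one ((min_le_left _ _).trans ?_)
  linarith [Real.exp_pos (-1)]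

lemma tent_eq_zero {u : ℝ} (hu : ¬ (Real.exp (-1) < u ∧ u < Real.exp (-0.91))) : tent u = 0 := by
  unfold tent
  apply max_eq_left
  by_contra! h
  rw [lt_min_iff] at h
  exact hu ⟨by linarith [h.1], by linarith [h.2]⟩

lemma integral_tent_pos : 0 < ∫ u in (0 : ℝ)..1, tent u := by
  have h01 : Real.exp (-1) < Real.exp (-0.91) := Real.exp_lt_exp.2 (by norm_num)
  have h1 : Real.exp (-0.91) < 1 := by rw [Real.exp_lt_one_iff]; norm_num
  set c := (Real.exp (-1) + Real.exp (-0.91)) / 2 with hc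
  refine intervalIntegral.integral_pos zero_lt_one continuous_tent.continuousOn
    (fun u _ => tent_nonneg u) ⟨c, ⟨?_, ?_⟩, ?_⟩
  · linarith [Real.exp_pos (-1), Real.exp_pos (-0.91)]
  · linarith
  · unfold tent
    rw [lt_max_iff, lt_min_iff]
    right
    constructor <;> linarith

/-- Primary primes with large real part in the window attached to `t`. -/
def window (t : ℝ) : Set PrimE := {π | 1 / 8 ≤ cosK 1 π ∧
  Real.exp (-1) < ((π : Eis).norm : ℝ) ^ (-t) ∧ ((π : Eis).norm : ℝ) ^ (-t) < Real.exp (-0.91)}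

lemma eventually_window_sum : ∃ η : ℝ, 0 < η ∧ ∀ᶠ t in 𝓝[>] (0 : ℝ),
    η ≤ t * ∑' π, wt t π * (window t).indicator 1 π := by
  set I := ∫ u in (0 : ℝ)..1, tent u with hI
  have hIpos : 0 < I := integral_tent_pos
  obtain ⟨P, hP⟩ := exists_polynomial_near_of_continuousOn 0 1 tent continuous_tent.continuousOn
    (I * 23 / 512) (by positivity)
  have h_int : I - I * 23 / 512 ≤ ∫ u in (0 : ℝ)..1, P.eval u := by
    have : ∫ u in (0 : ℝ)..1, (tent u - I * 23 / 512) ≤ ∫ u in (0 : ℝ)..1, P.eval u := by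
      refine intervalIntegral.integral_mono_on zero_le_one
        ((continuous_tent.sub continuous_const).intervalIntegrable _ _)
        (P.continuous.intervalIntegrable _ _) fun u hu => ?_
      have := abs_lt.1 (hP u hu)
      linarith [this.1]
    rw [intervalIntegral.integral_sub (continuous_tent.intervalIntegrable _ _)
      (by simp)] at this
    simpa using this
  have h1 := tendsto_poly abs_minorant tendsto_minorant P
  have h2 := h1.sub (tendsto_wt.mul_const (I * 23 / 512))
  have hlt : I * 23 / 512 < 23 / 128 * (∫ u in (0 : ℝ)..1, P.eval u) - 1 * (I * 23 / 512) := by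
    linarith
  refine ⟨I * 23 / 512, by positivity, ?_⟩
  filter_upwards [h2.eventually_const_lt hlt, self_mem_nhdsWithin] with t h ht
  refine h.le.trans ?_
  have ht : 0 < t := ht
  obtain ⟨B, hB⟩ := poly_bounded P
  have s1 : Summable (fun π : PrimE => wt t π *
      (minorant π * P.eval (((π : Eis).norm : ℝ) ^ (-t)))) := by
    refine summable_wt_mul ht (K := 1 * B) fun π => ?_
    rw [abs_mul]
    exact mul_le_mul (abs_minorant π) (hB _ (norm_rpow_mem ht π)) (abs_nonneg _) zero_le_one
  have s2 := (summable_wt ht).mul_right (I * 23 / 512)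
  have s3 : Summable (fun π : PrimE => wt t π * (window t).indicator 1 π) := by
    refine summable_wt_mul ht (K := 1) fun π => ?_
    by_cases hw : π ∈ window t <;> simp [hw]
  rw [mul_assoc, ← mul_sub, ← tsum_mul_right, ← s1.tsum_sub s2]
  refine mul_le_mul_of_nonneg_left ((s1.sub s2).tsum_le_tsum (fun π => ?_) s3) ht.le
  rw [← mul_sub]
  refine mul_le_mul_of_nonneg_left ?_ (wt_nonneg t π)
  set u := ((π : Eis).norm : ℝ) ^ (-t) with hu
  have hum := norm_rpow_mem ht π
  have hpu := abs_lt.1 (hP u hum)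
  have hm := abs_le.1 (abs_minorant π)
  have ht0 := tent_nonneg u
  have ht1 := tent_le_one hum.2
  have key : minorant π * P.eval u - I * 23 / 512 ≤ minorant π * tent u := by
    have : minorant π * (P.eval u - tent u) ≤ I * 23 / 512 := by
      calc minorant π * (P.eval u - tent u) ≤ |minorant π * (P.eval u - tent u)| := le_abs_self _
        _ = |minorant π| * |P.eval u - tent u| := abs_mul _ _
        _ ≤ 1 * (I * 23 / 512) :=
          mul_le_mul (abs_minorant π) (hP u hum).le (abs_nonneg _) zero_le_one
        _ = _ := one_mul _
    linarith
  refine key.trans ?_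
  by_cases hw : π ∈ window t
  · rw [Set.indicator_of_mem hw, Pi.one_apply]
    nlinarith
  · rw [Set.indicator_of_notMem hw]
    by_cases hc : 1 / 8 ≤ cosK 1 π
    · rw [tent_eq_zero (fun h => hw ⟨hc, h⟩), mul_zero]
    · exact mul_nonpos_of_nonpos_of_nonneg (minorant_nonpos (not_le.1 hc)) ht0

lemma window_bounds {t : ℝ} (ht : 0 < t) {π : PrimE} (h : π ∈ window t) :
    Real.exp (0.91 * t⁻¹) < ((π : Eis).norm : ℝ) ∧ ((π : Eis).norm : ℝ) < Real.exp t⁻¹ := by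
  have h4 := four_le_norm π
  obtain ⟨-, h1, h2⟩ := h
  have hpos : (0 : ℝ) < (π : Eis).norm := by linarith
  rw [Real.rpow_def_of_pos hpos, Real.exp_lt_exp] at h1 h2
  constructor
  · rw [← Real.lt_log_iff_exp_lt hpos, ← div_eq_mul_inv, div_lt_iff₀ ht]
    linarith
  · rw [← Real.log_lt_iff_lt_exp hpos, inv_eq_one_div, lt_div_iff₀ ht]
    linarith

lemma finite_norm_lt (B : ℝ) : {π : PrimE | ((π : Eis).norm : ℝ) < B}.Finite := by
  rcases le_or_gt B 4 with hB | hB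
  · convert Set.finite_empty
    ext π
    have := four_le_norm π
    simp only [Set.mem_ofPred_eq, Set.mem_empty_iff_false, iff_false]
    linarith
  have h := (summable_wt one_pos).tendsto_cofinite_zero
  have hpos : 0 < Real.log 4 * B ^ (-(2 : ℝ)) :=
    mul_pos (Real.log_pos (by norm_num)) (Real.rpow_pos_of_pos (by linarith) _)
  have h2 := h.eventually_lt_const hpos
  rw [Filter.eventually_cofinite] at h2
  refine h2.subset fun π hπ => ?_
  have h4 := four_le_norm π
  simp only [Set.mem_ofPred_eq, not_lt] at hπ ⊢
  unfold wt logN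
  rw [show (-(1 + 1) : ℝ) = -2 by norm_num]
  refine mul_le_mul (Real.log_le_log (by norm_num) h4)
    (Real.rpow_le_rpow_of_nonpos (by linarith) hπ.le (by norm_num))
    (Real.rpow_nonneg (by linarith) _) (Real.log_nonneg (by linarith))

lemma window_finite {t : ℝ} (ht : 0 < t) : (window t).Finite :=
  (finite_norm_lt (Real.exp t⁻¹)).subset fun _ h => (window_bounds ht h).2

lemma eventually_window_card : ∃ η : ℝ, 0 < η ∧ ∀ᶠ t in 𝓝[>] (0 : ℝ),
    η * Real.exp (0.91 * t⁻¹) ≤ (window t).ncard := by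
  obtain ⟨η, hη, h⟩ := eventually_window_sum
  refine ⟨η, hη, ?_⟩
  filter_upwards [h, self_mem_nhdsWithin] with t h1 ht
  have ht : 0 < t := ht
  have hfin := window_finite ht
  have e : ∑' π, wt t π * (window t).indicator 1 π = ∑ π ∈ hfin.toFinset, wt t π := by
    rw [tsum_eq_sum (s := hfin.toFinset)]
    · refine Finset.sum_congr rfl fun π hπ => ?_
      rw [Set.indicator_of_mem (hfin.mem_toFinset.1 hπ), Pi.one_apply, mul_one]
    · intro π hπ
      rw [Set.indicator_of_notMem (fun h => hπ (hfin.mem_toFinset.2 h)), mul_zero]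
  have hle : ∀ π ∈ hfin.toFinset, wt t π ≤ t⁻¹ * Real.exp (-(0.91 * t⁻¹)) := by
    intro π hπ
    obtain ⟨hl, hr⟩ := window_bounds ht (hfin.mem_toFinset.1 hπ)
    have h4 := four_le_norm π
    have hpos : (0 : ℝ) < (π : Eis).norm := by linarith
    unfold wt logN
    refine mul_le_mul ?_ ?_ (Real.rpow_nonneg hpos.le _) (by positivity)
    · exact ((Real.log_lt_iff_lt_exp hpos).2 hr).le
    · calc ((π : Eis).norm : ℝ) ^ (-(1 + t)) ≤ ((π : Eis).norm : ℝ) ^ (-1 : ℝ) :=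
            Real.rpow_le_rpow_of_exponent_le (by linarith) (by linarith)
        _ ≤ Real.exp (-(0.91 * t⁻¹)) := by
          rw [Real.rpow_neg_one, Real.exp_neg]
          exact inv_anti₀ (Real.exp_pos _) hl.le
  have h3 := Finset.sum_le_card_nsmul _ _ _ hle
  rw [e] at h1
  rw [nsmul_eq_mul, ← Set.ncard_eq_toFinset_card _ hfin] at h3
  have h5 : η ≤ (window t).ncard * Real.exp (-(0.91 * t⁻¹)) := by
    calc η ≤ _ := h1
      _ ≤ t * ((window t).ncard * (t⁻¹ * Real.exp (-(0.91 * t⁻¹)))) :=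
        mul_le_mul_of_nonneg_left h3 ht.le
      _ = _ := by field_simp
  calc η * Real.exp (0.91 * t⁻¹) ≤
        (window t).ncard * Real.exp (-(0.91 * t⁻¹)) * Real.exp (0.91 * t⁻¹) := by gcongr
    _ = _ := by rw [mul_assoc, ← Real.exp_add]; simp

end Hecke

end

/-- Number of solutions of `x³ + y³ + z³ ≡ b` modulo `m`, in terms of residues below `m`. -/
def cubeSols (m b : ℕ) : ℕ :=
  ((Finset.range m ×ˢ Finset.range m ×ˢ Finset.range m).filter fun t =>
    t.1 ^ 3 + t.2.1 ^ 3 + t.2.2 ^ 3 ≡ b [MOD m]).card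

lemma cast_inj_of_lt {m x y : ℕ} (hx : x < m) (hy : y < m) (h : (x : ZMod m) = y) : x = y := by
  rw [ZMod.natCast_eq_natCast_iff] at h
  exact Nat.ModEq.eq_of_lt_of_lt h hx hy

lemma cubeSols_le_cubeCount (m b : ℕ) [NeZero m] : cubeSols m b ≤ cubeCount m b := by
  unfold cubeSols cubeCount
  refine Finset.card_le_card_of_injOn (fun t => (t.1, t.2.1, t.2.2)) ?_ ?_
  · rintro ⟨x, y, z⟩ h
    have h := (Finset.mem_filter.1 h).2
    simp only [Finset.coe_filter, Finset.mem_univ, true_and, Set.mem_ofPred_eq]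
    rw [← ZMod.natCast_eq_natCast_iff] at h
    exact_mod_cast h
  · rintro ⟨x, y, z⟩ h ⟨x', y', z'⟩ hz he
    have h := (Finset.mem_filter.1 h).1
    have hz := (Finset.mem_filter.1 hz).1
    simp only [Finset.mem_product, Finset.mem_range] at h hz
    simp only [Prod.mk.injEq] at he ⊢
    exact ⟨cast_inj_of_lt h.1 hz.1 he.1, cast_inj_of_lt h.2.1 hz.2.1 he.2.1,
      cast_inj_of_lt h.2.2 hz.2.2 he.2.2⟩

/-- Primes modulo which `0` is noticeably less often than average a sum of three cubes, while no
residue is much more often than average a sum of three cubes. -/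
def GoodPrime (p : ℕ) : Prop :=
  p.Prime ∧ (cubeSols p 0 : ℝ) ≤ p ^ 2 - (p - 1) * √p / 4 ∧
    ∀ b, (cubeSols p b : ℝ) ≤ p ^ 2 + 8 * p

namespace Hecke

open Eis Filter Topology

lemma goodPrime_of_mem {π : PrimE} (h : 1 / 8 ≤ cosK 1 π) {p : ℕ} (hp : p.Prime)
    (hn : (π : Eis).norm = p) : GoodPrime p := by
  have := Fact.mk hp
  have h3 : p % 3 = 1 := by
    have := π.2.2.norm_mod
    rw [hn] at this
    omega
  obtain ⟨z, hz, hzp, h0, hb⟩ := exists_primary_cubeCount h3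
  have hre : (toC z).re = (toC (π : Eis)).re := by
    rcases eq_or_eq_star hp π.2.2 hzp hn hz with h | h
    · rw [h]
    · rw [h, toC_star]
      simp
  have hnorm : ‖toC (π : Eis)‖ = √p := by
    rw [← Real.sqrt_sq (_root_.norm_nonneg _), norm_toC_sq, hn]
    simp
  have hp1 : (1 : ℝ) < p := by exact_mod_cast hp.one_lt
  have hs : 0 < √(p : ℝ) := Real.sqrt_pos.2 (by linarith)
  have hre2 : √p / 8 ≤ (toC (π : Eis)).re := by
    unfold cosK at h
    rw [pow_one, hnorm, Complex.div_ofReal_re, le_div_iff₀ hs] at h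
    linarith
  have key : (cubeCount p 0 : ℝ) ≤ p ^ 2 - (p - 1) * √p / 4 := by
    rw [h0, hre]
    nlinarith
  have hle : ∀ b : ℕ, (cubeSols p b : ℝ) ≤ cubeCount p b := fun b => by
    exact_mod_cast cubeSols_le_cubeCount p b
  refine ⟨hp, ?_, fun b => (hle b).trans ?_⟩
  · have := hle 0
    push_cast at this
    linarith
  · by_cases hb0 : (b : ZMod p) = 0
    · rw [hb0]
      have : 0 ≤ (p - 1) * √p / 4 := by
        have := mul_nonneg (sub_nonneg.2 hp1.le) hs.le
        linarith
      linarith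
    · exact hb _ hb0

open Classical in
lemma card_inert_le {F : Finset PrimE} {B : ℝ} (hB : 0 ≤ B) (hF : ∀ π ∈ F, π ∉ splitSet)
    (hlt : ∀ π ∈ F, ((π : Eis).norm : ℝ) < B ^ 2) : (F.card : ℝ) ≤ B + 1 := by
  have h : F.card ≤ (Finset.range ⌈B⌉₊).card := by
    refine Finset.card_le_card_of_injOn
      (fun π => if h : π ∈ splitSet then 0 else inertPrime ⟨π, h⟩) ?_ ?_
    · intro π hπ
      have hπ' : π ∈ F := hπ
      have hlt := hlt π hπ'
      obtain ⟨-, -, hn⟩ := (inert_norm (hF π hπ')).choose_spec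
      rw [hn] at hlt
      beta_reduce
      rw [dif_neg (hF π hπ'), Finset.coe_range, Set.mem_Iio]
      rw [Nat.lt_ceil]
      push_cast at hlt
      exact lt_of_pow_lt_pow_left₀ 2 hB hlt
    · intro π hπ π' hπ' he
      have he : (if h : π ∈ splitSet then 0 else inertPrime ⟨π, h⟩) =
        if h : π' ∈ splitSet then 0 else inertPrime ⟨π', h⟩ := he
      rw [dif_neg (hF π hπ), dif_neg (hF π' hπ')] at he
      exact congrArg Subtype.val (inertPrime_injective he)
  rw [Finset.card_range] at h
  have h1 : (F.card : ℝ) ≤ (⌈B⌉₊ : ℝ) := by exact_mod_cast h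
  exact h1.trans (Nat.ceil_lt_add_one hB).le

open Classical in
lemma card_split_le {F : Finset PrimE} (hF : ∀ π ∈ F, π ∈ splitSet) :
    F.card ≤ 2 * (F.image fun π : PrimE => (π : Eis).norm.toNat).card := by
  refine Finset.card_le_mul_card_image _ _ fun m hm => ?_
  obtain ⟨π, hπ, rfl⟩ := Finset.mem_image.1 hm
  obtain ⟨p, hp, hn⟩ := hF π hπ
  have hsub : (F.filter fun x : PrimE => (x : Eis).norm.toNat = (π : Eis).norm.toNat).image
      (fun x : PrimE => (x : Eis)) ⊆ {(π : Eis), star (π : Eis)} := by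
    intro y hy
    obtain ⟨x, hx, rfl⟩ := Finset.mem_image.1 hy
    obtain ⟨hx, he⟩ := Finset.mem_filter.1 hx
    obtain ⟨p', hp', hn'⟩ := hF x hx
    rw [hn, hn'] at he
    have : p' = p := by simpa using he
    rw [Finset.mem_insert, Finset.mem_singleton]
    exact eq_or_eq_star hp π.2.2 x.2.2 hn (this ▸ hn')
  calc _ = _ := (Finset.card_image_of_injective _ Subtype.val_injective).symm
    _ ≤ _ := Finset.card_le_card hsub
    _ ≤ 2 := Finset.card_le_two

lemma tendsto_rpow_nat {a : ℝ} (ha : 0 < a) : Tendsto (fun n : ℕ => (n : ℝ) ^ a) atTop atTop :=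
  (tendsto_rpow_atTop ha).comp tendsto_natCast_atTop_atTop

theorem eventually_exists_goodPrimes : ∀ᶠ n : ℕ in atTop, ∃ S : Finset ℕ,
    (n : ℝ) ^ (2.7 : ℝ) ≤ S.card ∧
      ∀ p ∈ S, GoodPrime p ∧ (n : ℝ) ^ (2.73 : ℝ) < p ∧ p < n ^ 3 := by
  classical
  obtain ⟨η, hη, h⟩ := eventually_window_card
  have ht : Tendsto (fun n : ℕ => (3 * Real.log n)⁻¹) atTop (𝓝[>] 0) :=
    tendsto_inv_atTop_nhdsGT_zero.comp (Tendsto.const_mul_atTop (by norm_num)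
      (Real.tendsto_log_atTop.comp tendsto_natCast_atTop_atTop))
  filter_upwards [ht.eventually h, eventually_gt_atTop 1,
    (tendsto_rpow_nat (show (0 : ℝ) < 0.03 by norm_num)).eventually_ge_atTop (4 / η)]
    with n h hn hlarge
  have hn1 : (1 : ℝ) < n := by exact_mod_cast hn
  have hn0 : (0 : ℝ) < n := by linarith
  have hlog : 0 < Real.log n := Real.log_pos hn1
  have htpos : 0 < (3 * Real.log n)⁻¹ := by positivity
  rw [inv_inv, show 0.91 * (3 * Real.log n) = Real.log n * 2.73 by ring,
    ← Real.rpow_def_of_pos hn0] at h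
  have hfin := window_finite htpos
  rw [Set.ncard_eq_toFinset_card _ hfin] at h
  set F := hfin.toFinset with hF
  have hmem : ∀ π ∈ F, 1 / 8 ≤ cosK 1 π ∧ (n : ℝ) ^ (2.73 : ℝ) < (π : Eis).norm ∧
      ((π : Eis).norm : ℝ) < (n : ℝ) ^ 3 := by
    intro π hπ
    have hw := hfin.mem_toFinset.1 hπ
    obtain ⟨h1, h2⟩ := window_bounds htpos hw
    refine ⟨hw.1, ?_, ?_⟩
    · rw [inv_inv, show 0.91 * (3 * Real.log n) = Real.log n * 2.73 by ring,
        ← Real.rpow_def_of_pos hn0] at h1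
      exact h1
    · rw [inv_inv, mul_comm, ← Real.rpow_def_of_pos hn0] at h2
      exact_mod_cast h2
  have hsplit := card_split_le (F := F.filter (· ∈ splitSet)) fun π hπ => (Finset.mem_filter.1 hπ).2
  set S := (F.filter (· ∈ splitSet)).image fun π : PrimE => (π : Eis).norm.toNat with hS
  have hinert := card_inert_le (F := F.filter (· ∉ splitSet)) (B := (n : ℝ) ^ (1.5 : ℝ))
    (by positivity) (fun π hπ => (Finset.mem_filter.1 hπ).2) (fun π hπ => by
      have := (hmem π (Finset.mem_filter.1 hπ).1).2.2
      rw [← Real.rpow_natCast, ← Real.rpow_mul hn0.le]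
      norm_num
      exact this)
  refine ⟨S, ?_, ?_⟩
  · have e := Finset.card_filter_add_card_filter_not (s := F) (· ∈ splitSet)
    have e' : (F.card : ℝ) ≤ 2 * S.card + (n : ℝ) ^ (1.5 : ℝ) + 1 := by
      rw [← e]
      push_cast
      have : (((F.filter (· ∈ splitSet)).card : ℕ) : ℝ) ≤ 2 * S.card := by exact_mod_cast hsplit
      linarith
    have h1 : (n : ℝ) ^ (1.5 : ℝ) ≤ (n : ℝ) ^ (2.7 : ℝ) :=
      Real.rpow_le_rpow_of_exponent_le hn1.le (by norm_num)
    have h2 : 1 ≤ (n : ℝ) ^ (2.7 : ℝ) := Real.one_le_rpow hn1.le (by norm_num)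
    have h3 : (n : ℝ) ^ (2.73 : ℝ) = (n : ℝ) ^ (0.03 : ℝ) * (n : ℝ) ^ (2.7 : ℝ) := by
      rw [← Real.rpow_add hn0]
      norm_num
    have h4 : 4 ≤ η * (n : ℝ) ^ (0.03 : ℝ) := by
      rwa [div_le_iff₀' hη] at hlarge
    have h5 : 4 * (n : ℝ) ^ (2.7 : ℝ) ≤ η * (n : ℝ) ^ (2.73 : ℝ) := by
      rw [h3, ← mul_assoc]
      exact mul_le_mul_of_nonneg_right h4 (by linarith)
    linarith
  · intro p hp
    obtain ⟨π, hπ, rfl⟩ := Finset.mem_image.1 hp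
    obtain ⟨hπF, p, hpp, hn⟩ := Finset.mem_filter.1 hπ
    obtain ⟨h1, h2, h3⟩ := hmem π hπF
    have e : (π : Eis).norm.toNat = p := by rw [hn]; simp
    rw [e]
    rw [hn] at h2 h3
    exact ⟨goodPrime_of_mem h1 hpp hn, by exact_mod_cast h2, by exact_mod_cast h3⟩

end Hecke

section Suppression

lemma cubeSols_congr {m b b' : ℕ} (h : b ≡ b' [MOD m]) : cubeSols m b = cubeSols m b' := by
  unfold cubeSols
  congr 1
  refine Finset.filter_congr fun t _ => ⟨fun h1 => h1.trans h, fun h1 => h1.trans h.symm⟩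

lemma cubeSols_one (b : ℕ) : cubeSols 1 b = 1 := by
  simp [cubeSols, Nat.modEq_one]

lemma cubeSols_mul_le {m k : ℕ} (h : m.Coprime k) (b : ℕ) :
    cubeSols (m * k) b ≤ cubeSols m b * cubeSols k b := by
  unfold cubeSols
  rw [← Finset.card_product]
  refine Finset.card_le_card_of_injOn
    (fun t => ((t.1 % m, t.2.1 % m, t.2.2 % m), (t.1 % k, t.2.1 % k, t.2.2 % k))) ?_ ?_
  · rintro ⟨x, y, z⟩ ht
    obtain ⟨h1, h2⟩ := Finset.mem_filter.1 ht
    simp only [Finset.mem_product, Finset.mem_range] at h1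
    have hm : 0 < m := Nat.pos_of_mul_pos_right (by omega : 0 < m * k)
    have hk : 0 < k := Nat.pos_of_mul_pos_left (by omega : 0 < m * k)
    have key : ∀ l, x ^ 3 + y ^ 3 + z ^ 3 ≡ b [MOD l] →
        (x % l) ^ 3 + (y % l) ^ 3 + (z % l) ^ 3 ≡ b [MOD l] := fun l hl =>
      (Nat.ModEq.add (Nat.ModEq.add ((Nat.mod_modEq x l).pow 3) ((Nat.mod_modEq y l).pow 3))
        ((Nat.mod_modEq z l).pow 3)).trans hl
    simp only [Finset.coe_product, Set.mem_prod, Finset.mem_coe, Finset.mem_filter,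
      Finset.mem_product, Finset.mem_range]
    exact ⟨⟨⟨Nat.mod_lt _ hm, Nat.mod_lt _ hm, Nat.mod_lt _ hm⟩, key m (h2.of_mul_right k)⟩,
      ⟨Nat.mod_lt _ hk, Nat.mod_lt _ hk, Nat.mod_lt _ hk⟩, key k (h2.of_mul_left m)⟩
  · rintro ⟨x, y, z⟩ ht ⟨x', y', z'⟩ ht' he
    have h1 := (Finset.mem_filter.1 ht).1
    have h1' := (Finset.mem_filter.1 ht').1
    simp only [Finset.mem_product, Finset.mem_range, Prod.mk.injEq] at h1 h1' he ⊢
    have key : ∀ u v, u < m * k → v < m * k → u % m = v % m → u % k = v % k → u = v :=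
      fun u v hu hv e1 e2 => Nat.ModEq.eq_of_lt_of_lt
        ((Nat.modEq_and_modEq_iff_modEq_mul h).1 ⟨e1, e2⟩) hu hv
    exact ⟨key _ _ h1.1 h1'.1 he.1.1 he.2.1, key _ _ h1.2.1 h1'.2.1 he.1.2.1 he.2.2.1,
      key _ _ h1.2.2 h1'.2.2 he.1.2.2 he.2.2.2⟩

lemma cubeSols_prod_le {ι : Type*} (s : Finset ι) (P : ι → ℕ)
    (hP : (s : Set ι).Pairwise (Function.onFun Nat.Coprime P)) (b : ℕ) :
    cubeSols (∏ x ∈ s, P x) b ≤ ∏ x ∈ s, cubeSols (P x) b := by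
  classical
  induction s using Finset.induction_on with
  | empty => simp [cubeSols_one]
  | insert a s ha ih =>
    rw [Finset.prod_insert ha, Finset.prod_insert ha]
    refine (cubeSols_mul_le (Nat.Coprime.prod_right fun x hx => ?_) b).trans
      (Nat.mul_le_mul_left _ (ih (hP.mono (by simp))))
    exact hP (by simp) (by simp [hx]) (fun h => ha (h ▸ hx))

lemma GoodPrime.cubeSols_le {p : ℕ} (hp : GoodPrime p) (b : ℕ) :
    (cubeSols p b : ℝ) ≤ p ^ 2 * Real.exp (8 / p) := by
  have h0 : (0 : ℝ) < p := by exact_mod_cast hp.1.pos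
  refine (hp.2.2 b).trans ?_
  have := Real.add_one_le_exp (8 / (p : ℝ))
  calc (p : ℝ) ^ 2 + 8 * p = p ^ 2 * (8 / p + 1) := by field_simp; ring
    _ ≤ _ := by gcongr

lemma GoodPrime.cubeSols_zero_le {p b : ℕ} (hp : GoodPrime p) (hb : p ∣ b) :
    (cubeSols p b : ℝ) ≤ p ^ 2 * Real.exp (-(1 / (8 * √p))) := by
  have h0 : (2 : ℝ) ≤ p := by exact_mod_cast hp.1.two_le
  have hs : 0 < √(p : ℝ) := Real.sqrt_pos.2 (by linarith)
  have hss : √(p : ℝ) ^ 2 = p := Real.sq_sqrt (by linarith)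
  rw [cubeSols_congr (Nat.modEq_zero_iff_dvd.2 hb)]
  refine hp.2.1.trans ?_
  have := Real.add_one_le_exp (-(1 / (8 * √(p : ℝ))))
  calc (p : ℝ) ^ 2 - (p - 1) * √p / 4 ≤ p ^ 2 - p * √p / 8 := by nlinarith
    _ = p ^ 2 * (-(1 / (8 * √(p : ℝ))) + 1) := by
      generalize √(p : ℝ) = r at *
      rw [← hss]
      field_simp
      ring
    _ ≤ _ := by gcongr

lemma exists_coprime_of_lt {ι : Type*} [Fintype ι] {M : ι → ℕ}
    (hM : Pairwise (Function.onFun Nat.Coprime M)) {e : ℕ} (he : 0 < e)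
    (hlt : e < 2 ^ Fintype.card ι) : ∃ i, (M i).Coprime e := by
  by_contra! h
  have h2 : ∀ i, ∃ p, p.Prime ∧ p ∣ M i ∧ p ∣ e := fun i => Nat.Prime.not_coprime_iff_dvd.1 (h i)
  choose p hp hpM hpe using h2
  have hinj : Pairwise (Function.onFun Nat.Coprime p) := fun i j hij =>
    Nat.Coprime.of_dvd (hpM i) (hpM j) (hM hij)
  have hd : ∏ i, p i ∣ e := Finset.prod_dvd_of_isRelPrime
    (fun i _ j _ hij => Nat.coprime_iff_isRelPrime.1 (hinj hij)) (fun i _ => hpe i)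
  have h3 : 2 ^ Fintype.card ι ≤ ∏ i, p i := by
    rw [← Finset.card_univ, ← Finset.prod_const]
    exact Finset.prod_le_prod' fun i _ => (hp i).two_le
  have := Nat.le_of_dvd he hd
  omega

lemma sum_half_pow_le (h : ℕ) : ∑ j ∈ Finset.range h, (1 / 2 : ℝ) ^ j ≤ 2 := by
  rw [geom_sum_eq (by norm_num)]
  have : (0 : ℝ) < (1 / 2) ^ h := by positivity
  rw [div_le_iff_of_neg (by norm_num)]
  linarith

lemma sum_half_pow_tail_le (g h : ℕ) :
    ∑ j ∈ Finset.range h, (if j < g then 0 else (1 / 2 : ℝ) ^ j) ≤ 2 * (1 / 2) ^ g := by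
  have key : ∑ j ∈ Finset.range h, (if j < g then 0 else (1 / 2 : ℝ) ^ j) =
      if h < g then 0 else 2 * (1 / 2) ^ g - 2 * (1 / 2) ^ h := by
    induction h with
    | zero => rcases Nat.eq_zero_or_pos g with h | h <;> simp [h]
    | succ h ih =>
      rw [Finset.sum_range_succ, ih]
      rcases lt_trichotomy (h + 1) g with h1 | h1 | h1
      · simp [h1, show h < g by omega]
      · subst h1
        simp
      · simp only [show ¬ h < g by omega, show ¬ h + 1 < g by omega, if_false]
        ring
  rw [key]
  split_ifs
  · positivity
  · have : (0 : ℝ) < (1 / 2) ^ h := by positivity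
    linarith

/-- Simultaneous suppression: given enough good primes of size about `B`, there are moduli and
residue classes just above which sums of three cubes are scarce. -/
lemma exists_suppressed {R g m : ℕ} {S : Finset ℕ} (hcard : R * (g * m) ≤ S.card)
    {B D : ℝ} (hD : 0 < D) (hS : ∀ p ∈ S, GoodPrime p ∧ D ≤ p ∧ √(p : ℝ) ≤ B)
    {U : ℕ} (hU : ∀ p ∈ S, p ≤ U) :
    ∃ M b : Fin R → ℕ, Pairwise (Function.onFun Nat.Coprime M) ∧ ∀ i, 0 < M i ∧
      M i ≤ U ^ (g * m) ∧
      (∀ c, (cubeSols (M i) c : ℝ) ≤ M i ^ 2 * Real.exp (g * m * (8 / D))) ∧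
      ∀ j < g, (cubeSols (M i) (b i + (j + 1)) : ℝ) ≤
        M i ^ 2 * (Real.exp (g * m * (8 / D)) * Real.exp (-(m / (8 * B)))) := by
  classical
  obtain ⟨P⟩ : Nonempty (Fin R × Fin g × Fin m ↪ S) :=
    Function.Embedding.nonempty_of_card_le (by simpa using hcard)
  have hP : ∀ x, GoodPrime (P x) ∧ D ≤ (P x : ℕ) ∧ √((P x : ℕ) : ℝ) ≤ B := fun x => hS _ (P x).2
  have hcop : ∀ x y, x ≠ y → Nat.Coprime (P x) (P y) := fun x y hxy =>
    (Nat.coprime_primes (hP x).1.1 (hP y).1.1).2 fun h => hxy (P.injective (Subtype.ext h))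
  have hcopi : ∀ i, ((Finset.univ : Finset (Fin g × Fin m)) : Set _).Pairwise
      (Function.onFun Nat.Coprime fun x => (P (i, x) : ℕ)) := fun i x _ y _ hxy =>
    hcop _ _ fun h => hxy (Prod.ext_iff.1 h).2
  let M : Fin R → ℕ := fun i => ∏ x : Fin g × Fin m, (P (i, x) : ℕ)
  let b : Fin R → ℕ := fun i => (Nat.chineseRemainderOfFinset
    (fun x : Fin g × Fin m => (P (i, x) : ℕ) * (x.1 + 1) - (x.1 + 1))
    (fun x => (P (i, x) : ℕ)) Finset.univ (fun x _ => (hP _).1.1.ne_zero) (hcopi i)).1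
  have hb : ∀ i x, (P (i, x) : ℕ) ∣ b i + (x.1 + 1) := by
    intro i x
    have h := (Nat.chineseRemainderOfFinset
      (fun x : Fin g × Fin m => (P (i, x) : ℕ) * (x.1 + 1) - (x.1 + 1))
      (fun x => (P (i, x) : ℕ)) Finset.univ (fun x _ => (hP _).1.1.ne_zero) (hcopi i)).2 x
      (Finset.mem_univ x)
    change b i ≡ _ [MOD _] at h
    have h2 := h.add_right (x.1 + 1 : ℕ)
    rw [Nat.sub_add_cancel (Nat.le_mul_of_pos_left _ (hP _).1.1.pos)] at h2
    exact Nat.modEq_zero_iff_dvd.1 (h2.trans (Nat.modEq_zero_iff_dvd.2 (dvd_mul_right _ _)))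
  have hcast : ∀ i, ((M i : ℕ) : ℝ) = ∏ x : Fin g × Fin m, ((P (i, x) : ℕ) : ℝ) := fun i => by
    simp [M]
  refine ⟨M, b, ?_, fun i => ⟨?_, ?_, fun c => ?_, fun j hj => ?_⟩⟩
  · intro i i' hi
    exact Nat.Coprime.prod_left fun x _ => Nat.Coprime.prod_right fun y _ =>
      hcop _ _ fun h => hi (Prod.ext_iff.1 h).1
  · exact Finset.prod_pos fun x _ => (hP _).1.1.pos
  · calc M i ≤ ∏ x : Fin g × Fin m, U := Finset.prod_le_prod' fun x _ => hU _ (P _).2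
      _ = _ := by simp
  · calc (cubeSols (M i) c : ℝ) ≤ ∏ x : Fin g × Fin m, (cubeSols (P (i, x)) c : ℝ) := by
          exact_mod_cast cubeSols_prod_le _ _ (hcopi i) c
      _ ≤ ∏ x : Fin g × Fin m, (((P (i, x) : ℕ) : ℝ) ^ 2 * Real.exp (8 / D)) := by
        refine Finset.prod_le_prod (fun _ _ => by positivity) fun x _ => ?_
        exact ((hP _).1.cubeSols_le c).trans (by gcongr; exact (hP _).2.1)
      _ = _ := by
        rw [Finset.prod_mul_distrib, Finset.prod_pow, ← hcast, Finset.prod_const,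
          ← Real.exp_nat_mul]
        simp
  · calc (cubeSols (M i) (b i + (j + 1)) : ℝ)
        ≤ ∏ x : Fin g × Fin m, (cubeSols (P (i, x)) (b i + (j + 1)) : ℝ) := by
          exact_mod_cast cubeSols_prod_le _ _ (hcopi i) _
      _ ≤ ∏ x : Fin g × Fin m, (((P (i, x) : ℕ) : ℝ) ^ 2 * (Real.exp (8 / D) *
          Real.exp (if x.1 = ⟨j, hj⟩ then -(1 / (8 * B)) else 0))) := by
        refine Finset.prod_le_prod (fun _ _ => by positivity) fun x _ => ?_
        split_ifs with hx
        · have hd := hb i x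
          rw [hx] at hd
          refine ((hP _).1.cubeSols_zero_le hd).trans ?_
          refine mul_le_mul_of_nonneg_left ?_ (by positivity)
          have hs : 0 < √((P (i, x) : ℕ) : ℝ) :=
            Real.sqrt_pos.2 (by exact_mod_cast (hP _).1.1.pos)
          have h1 : Real.exp (-(1 / (8 * √((P (i, x) : ℕ) : ℝ)))) ≤
              Real.exp (-(1 / (8 * B))) := by
            refine Real.exp_le_exp.2 (neg_le_neg ?_)
            have := (hP (i, x)).2.2
            gcongr
          have h2 : 1 ≤ Real.exp (8 / D) := Real.one_le_exp (by positivity)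
          exact h1.trans (le_mul_of_one_le_left (Real.exp_pos _).le h2)
        · rw [Real.exp_zero, mul_one]
          exact ((hP _).1.cubeSols_le _).trans (by gcongr; exact (hP _).2.1)
      _ = _ := by
        rw [Finset.prod_mul_distrib, Finset.prod_pow, ← hcast, Finset.prod_mul_distrib,
          Finset.prod_const, ← Real.exp_nat_mul, ← Real.exp_sum, Fintype.sum_prod_type]
        simp
        left
        ring_nf

open Filter in
lemma eventually_log_le {c a : ℝ} (hc : 0 < c) (ha : 0 < a) :
    ∀ᶠ n : ℕ in atTop, Real.log n ≤ c * (n : ℝ) ^ a := by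
  have h := (isLittleO_log_rpow_atTop ha).def hc
  filter_upwards [tendsto_natCast_atTop_atTop.eventually h, eventually_ge_atTop 1] with n hn h1
  have h1' : (1 : ℝ) ≤ n := by exact_mod_cast h1
  rwa [Real.norm_of_nonneg (Real.log_nonneg h1'), Real.norm_of_nonneg (by positivity)] at hn

open Filter in
theorem eventually_exists_suppressed (C : ℕ) : ∀ᶠ n : ℕ in atTop,
    ∃ M b : Fin (C * n + 1) → ℕ,
      (∀ e, 0 < e → e ≤ 2 ^ (C * n) → ∃ i, (M i).Coprime e) ∧
      ∀ i, 0 < M i ∧ M i ≤ 2 ^ n ^ 2 ∧ ∀ h : ℕ, ∑ j ∈ Finset.range h,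
        (1 / 2 : ℝ) ^ j * cubeSols (M i) (b i + (j + 1)) ≤ M i ^ 2 / n ^ 4 := by
  filter_upwards [Hecke.eventually_exists_goodPrimes, eventually_ge_atTop 8,
    (Hecke.tendsto_rpow_nat (show (0 : ℝ) < 0.06 by norm_num)).eventually_ge_atTop (C + 1 : ℝ),
    (Hecke.tendsto_rpow_nat (show (0 : ℝ) < 1.09 by norm_num)).eventually_ge_atTop 16,
    (Hecke.tendsto_rpow_nat (show (0 : ℝ) < 0.04 by norm_num)).eventually_ge_atTop 2,
    eventually_log_le (show (0 : ℝ) < 1 / 80 by norm_num) (show (0 : ℝ) < 0.1 by norm_num),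
    eventually_log_le (show (0 : ℝ) < 1 / 20 by norm_num) (show (0 : ℝ) < 0.04 by norm_num),
    eventually_log_le (show (0 : ℝ) < 1 / 6 by norm_num) (show (0 : ℝ) < 0.36 by norm_num)]
    with n ⟨S, hcard, hS⟩ hn8 hC h16 h2 hl1 hl2 hl3
  have hn : (8 : ℝ) ≤ n := by exact_mod_cast hn8
  have hn0 : (0 : ℝ) < n := by linarith
  have hn1 : (1 : ℝ) ≤ n := by linarith
  have hlog2 := Real.log_two_gt_d9
  have hlogn : 0 ≤ Real.log n := Real.log_nonneg hn1
  set g := ⌊(n : ℝ) ^ (0.04 : ℝ)⌋₊ with hg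
  set m := ⌊(n : ℝ) ^ (1.6 : ℝ)⌋₊ with hm
  have hgle : (g : ℝ) ≤ (n : ℝ) ^ (0.04 : ℝ) := Nat.floor_le (by positivity)
  have hmle : (m : ℝ) ≤ (n : ℝ) ^ (1.6 : ℝ) := Nat.floor_le (by positivity)
  have hgge : (n : ℝ) ^ (0.04 : ℝ) / 2 ≤ g := by
    have := Nat.lt_floor_add_one ((n : ℝ) ^ (0.04 : ℝ))
    rw [← hg] at this
    linarith
  have hmge : (n : ℝ) ^ (1.6 : ℝ) / 2 ≤ m := by
    have := Nat.lt_floor_add_one ((n : ℝ) ^ (1.6 : ℝ))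
    rw [← hm] at this
    have h3 : (n : ℝ) ^ (0.04 : ℝ) ≤ (n : ℝ) ^ (1.6 : ℝ) :=
      Real.rpow_le_rpow_of_exponent_le hn1 (by norm_num)
    linarith
  have hgm : (g * m : ℝ) ≤ (n : ℝ) ^ (1.64 : ℝ) := by
    calc (g * m : ℝ) ≤ (n : ℝ) ^ (0.04 : ℝ) * (n : ℝ) ^ (1.6 : ℝ) := by gcongr
      _ = _ := by rw [← Real.rpow_add hn0]; norm_num
  have hcard' : (C * n + 1) * (g * m) ≤ S.card := by
    have : (((C * n + 1) * (g * m) : ℕ) : ℝ) ≤ S.card := by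
      push_cast
      calc (C * n + 1 : ℝ) * (g * m) ≤ ((C + 1) * n) * (n : ℝ) ^ (1.64 : ℝ) := by
            gcongr
            linarith
        _ ≤ ((n : ℝ) ^ (0.06 : ℝ) * n) * (n : ℝ) ^ (1.64 : ℝ) := by gcongr
        _ = (n : ℝ) ^ (2.7 : ℝ) := by
          nth_rewrite 2 [← Real.rpow_one (n : ℝ)]
          rw [← Real.rpow_add hn0, ← Real.rpow_add hn0]
          norm_num
        _ ≤ _ := hcard
    exact_mod_cast this
  obtain ⟨M, b, hcop, h⟩ := exists_suppressed (U := n ^ 3) hcard'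
    (B := (n : ℝ) ^ (1.5 : ℝ)) (D := (n : ℝ) ^ (2.73 : ℝ)) (by positivity)
    (fun p hp => ⟨(hS p hp).1, (hS p hp).2.1.le, by
      rw [Real.sqrt_le_left (by positivity), ← Real.rpow_natCast, ← Real.rpow_mul hn0.le]
      norm_num
      exact_mod_cast (hS p hp).2.2.le⟩) (fun p hp => (hS p hp).2.2.le)
  have hexp1 : Real.exp (g * m * (8 / (n : ℝ) ^ (2.73 : ℝ))) ≤ 2 := by
    rw [← Real.le_log_iff_exp_le (by norm_num)]
    have e : (n : ℝ) ^ (2.73 : ℝ) = (n : ℝ) ^ (1.64 : ℝ) * (n : ℝ) ^ (1.09 : ℝ) := by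
      rw [← Real.rpow_add hn0]; norm_num
    calc g * m * (8 / (n : ℝ) ^ (2.73 : ℝ)) ≤
          (n : ℝ) ^ (1.64 : ℝ) * (8 / (n : ℝ) ^ (2.73 : ℝ)) := by gcongr
      _ = 8 / (n : ℝ) ^ (1.09 : ℝ) := by rw [e]; field_simp
      _ ≤ 8 / 16 := by gcongr
      _ ≤ _ := by linarith
  have hexp2 : Real.exp (-(m / (8 * (n : ℝ) ^ (1.5 : ℝ)))) ≤ ((n : ℝ) ^ 5)⁻¹ := by
    rw [← Real.le_log_iff_exp_le (by positivity), Real.log_inv, Real.log_pow, neg_le_neg_iff]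
    have e : (n : ℝ) ^ (1.6 : ℝ) = (n : ℝ) ^ (1.5 : ℝ) * (n : ℝ) ^ (0.1 : ℝ) := by
      rw [← Real.rpow_add hn0]; norm_num
    rw [le_div_iff₀ (by positivity)]
    push_cast
    calc 5 * Real.log n * (8 * (n : ℝ) ^ (1.5 : ℝ))
        ≤ 5 * (1 / 80 * (n : ℝ) ^ (0.1 : ℝ)) * (8 * (n : ℝ) ^ (1.5 : ℝ)) := by gcongr
      _ = (n : ℝ) ^ (1.6 : ℝ) / 2 := by rw [e]; ring
      _ ≤ _ := hmge
  have hhalf : (1 / 2 : ℝ) ^ g ≤ ((n : ℝ) ^ 5)⁻¹ := by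
    rw [one_div, inv_pow]
    refine inv_anti₀ (by positivity) ?_
    rw [← Real.log_le_log_iff (by positivity) (by positivity), Real.log_pow, Real.log_pow]
    push_cast
    nlinarith
  refine ⟨M, b, fun e he hle => exists_coprime_of_lt hcop he (hle.trans_lt ?_), fun i => ?_⟩
  · rw [Fintype.card_fin]
    exact Nat.pow_lt_pow_right (by norm_num) (by omega)
  obtain ⟨h1, h2, h3, h4⟩ := h i
  refine ⟨h1, h2.trans ?_, fun H => ?_⟩
  · have : (((n ^ 3) ^ (g * m) : ℕ) : ℝ) ≤ ((2 ^ n ^ 2 : ℕ) : ℝ) := by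
      push_cast
      rw [← Real.log_le_log_iff (by positivity) (by positivity), Real.log_pow, Real.log_pow,
        Real.log_pow]
      push_cast
      have e : (n : ℝ) ^ 2 = (n : ℝ) ^ (1.64 : ℝ) * (n : ℝ) ^ (0.36 : ℝ) := by
        rw [← Real.rpow_add hn0]; norm_num
      calc (g * m : ℝ) * (3 * Real.log n)
          ≤ (n : ℝ) ^ (1.64 : ℝ) * (3 * (1 / 6 * (n : ℝ) ^ (0.36 : ℝ))) := by gcongr
        _ = (n : ℝ) ^ 2 * (1 / 2) := by rw [e]; ring
        _ ≤ _ := by gcongr; linarith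
    exact_mod_cast this
  · have hbound : ∀ j, (1 / 2 : ℝ) ^ j * cubeSols (M i) (b i + (j + 1)) ≤
        M i ^ 2 * 2 * (((n : ℝ) ^ 5)⁻¹ * (1 / 2) ^ j + if j < g then 0 else (1 / 2) ^ j) := by
      intro j
      have hpos : (0 : ℝ) ≤ (1 / 2) ^ j := by positivity
      split_ifs with hj
      · calc _ ≤ (1 / 2 : ℝ) ^ j * (M i ^ 2 * (2 * ((n : ℝ) ^ 5)⁻¹)) := by
              refine mul_le_mul_of_nonneg_left ((h4 j hj).trans ?_) hpos
              gcongr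
          _ = _ := by ring
      · calc _ ≤ (1 / 2 : ℝ) ^ j * (M i ^ 2 * 2) := by
              refine mul_le_mul_of_nonneg_left ((h3 _).trans ?_) hpos
              gcongr
          _ = M i ^ 2 * 2 * (0 + (1 / 2 : ℝ) ^ j) := by ring
          _ ≤ _ := by gcongr; positivity
    calc _ ≤ _ := Finset.sum_le_sum fun j _ => hbound j
      _ = M i ^ 2 * 2 * (((n : ℝ) ^ 5)⁻¹ * ∑ j ∈ Finset.range H, (1 / 2 : ℝ) ^ j +
          ∑ j ∈ Finset.range H, if j < g then 0 else (1 / 2 : ℝ) ^ j) := by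
        rw [← Finset.mul_sum, Finset.sum_add_distrib, Finset.mul_sum]
      _ ≤ M i ^ 2 * 2 * (((n : ℝ) ^ 5)⁻¹ * 2 + 2 * ((n : ℝ) ^ 5)⁻¹) := by
        gcongr
        · exact sum_half_pow_le H
        · exact (sum_half_pow_tail_le g H).trans (by gcongr)
      _ = M i ^ 2 * (8 / (n * (n : ℝ) ^ 4)) := by ring
      _ ≤ M i ^ 2 * (n / (n * (n : ℝ) ^ 4)) := by gcongr
      _ = _ := by field_simp

end Suppression

section Series

/-- The integer sequence `T N = -∑_{m ≤ N} c m * q ^ (N - m)`, defined recursively. -/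
def partialInt (q : ℕ) (c : ℕ → ℤ) : ℕ → ℤ
  | 0 => -c 0
  | N + 1 => q * partialInt q c N - c (N + 1)

lemma partialInt_succ (q : ℕ) (c : ℕ → ℤ) (N : ℕ) :
    partialInt q c (N + 1) = q * partialInt q c N - c (N + 1) := rfl

lemma partialInt_eq {q : ℕ} (hq : 0 < q) (c : ℕ → ℤ) (N : ℕ) :
    (partialInt q c N : ℝ) =
      -((q : ℝ) ^ N * ∑ m ∈ Finset.range (N + 1), (c m : ℝ) * (1 / (q : ℝ)) ^ m) := by
  have hq' : (q : ℝ) ≠ 0 := by positivity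
  induction N with
  | zero => simp [partialInt]
  | succ N ih =>
    rw [partialInt_succ, Finset.sum_range_succ]
    push_cast
    rw [ih, one_div, inv_pow]
    field_simp
    ring

lemma sq_le_five_mul_pow (j : ℕ) : ((j : ℝ) + 1) ^ 2 ≤ 5 * (3 / 2) ^ j := by
  rcases Nat.lt_or_ge j 5 with h | h
  · interval_cases j <;> norm_num
  · induction j, h using Nat.le_induction with
    | base => norm_num
    | succ j hj ih =>
      have : (5 : ℝ) ≤ j := by exact_mod_cast hj
      push_cast
      rw [pow_succ (3 / 2 : ℝ) j]
      nlinarith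

lemma abs_sub_partial_le {q n : ℕ} (hq : 2 ≤ q) {c : ℕ → ℤ} {L : ℝ}
    (hc : ∀ m, |(c m : ℝ)| ≤ 4 * (q : ℝ) ^ n * ((m : ℝ) + 1) ^ 2)
    (hL : HasSum (fun m => (c m : ℝ) * (1 / (q : ℝ)) ^ m) L) (N : ℕ) :
    |L - ∑ m ∈ Finset.range (N + 1), (c m : ℝ) * (1 / (q : ℝ)) ^ m| ≤
      (1 / (q : ℝ)) ^ N * (40 * (q : ℝ) ^ n * ((N : ℝ) + 2) ^ 2) := by
  have hq2 : (2 : ℝ) ≤ q := by exact_mod_cast hq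
  have hx : (1 / (q : ℝ)) ≤ 1 / 2 := one_div_le_one_div_of_le (by norm_num) hq2
  have hx0 : (0 : ℝ) ≤ 1 / (q : ℝ) := by positivity
  have h1 := (hasSum_nat_add_iff' (N + 1)).2 hL
  have hg : HasSum (fun j : ℕ => (1 / (q : ℝ)) ^ N * (10 * (q : ℝ) ^ n * ((N : ℝ) + 2) ^ 2) *
      (3 / 4 : ℝ) ^ j) ((1 / (q : ℝ)) ^ N * (10 * (q : ℝ) ^ n * ((N : ℝ) + 2) ^ 2) *
      (1 - 3 / 4)⁻¹) := (hasSum_geometric_of_lt_one (by norm_num) (by norm_num)).mul_left _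
  rw [← h1.tsum_eq, ← Real.norm_eq_abs]
  refine (tsum_of_norm_bounded hg fun j => ?_).trans (le_of_eq (by ring))
  rw [norm_mul, norm_pow, Real.norm_of_nonneg hx0, Real.norm_eq_abs]
  have hcj := hc (j + (N + 1))
  push_cast at hcj
  have h2 : ((j : ℝ) + (N + 1) + 1) ^ 2 ≤ ((N : ℝ) + 2) ^ 2 * ((j : ℝ) + 1) ^ 2 := by
    rw [← mul_pow]
    have : (0 : ℝ) ≤ (N : ℝ) * j := by positivity
    gcongr
    nlinarith [(Nat.cast_nonneg j : (0 : ℝ) ≤ j)]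
  calc |(c (j + (N + 1)) : ℝ)| * (1 / (q : ℝ)) ^ (j + (N + 1))
      ≤ (4 * (q : ℝ) ^ n * (((N : ℝ) + 2) ^ 2 * (5 * (3 / 2) ^ j))) *
        (1 / (q : ℝ)) ^ (j + (N + 1)) := by
        refine mul_le_mul_of_nonneg_right (hcj.trans ?_) (by positivity)
        refine mul_le_mul_of_nonneg_left (h2.trans ?_) (by positivity)
        gcongr
        exact sq_le_five_mul_pow j
    _ = (1 / (q : ℝ)) ^ N * (20 * (q : ℝ) ^ n * ((N : ℝ) + 2) ^ 2) * (3 / 2) ^ j *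
        ((1 / (q : ℝ)) ^ j * (1 / (q : ℝ))) := by ring
    _ ≤ (1 / (q : ℝ)) ^ N * (20 * (q : ℝ) ^ n * ((N : ℝ) + 2) ^ 2) * (3 / 2) ^ j *
        ((1 / 2) ^ j * (1 / 2)) := by gcongr
    _ = (1 / (q : ℝ)) ^ N * (10 * (q : ℝ) ^ n * ((N : ℝ) + 2) ^ 2) *
        ((3 / 2) ^ j * (1 / 2) ^ j) := by ring
    _ = _ := by rw [← mul_pow]; norm_num

lemma abs_partialInt_le {q n : ℕ} (hq : 2 ≤ q) {c : ℕ → ℤ} {L : ℝ}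
    (hc : ∀ m, |(c m : ℝ)| ≤ 4 * (q : ℝ) ^ n * ((m : ℝ) + 1) ^ 2)
    (hL : HasSum (fun m => (c m : ℝ) * (1 / (q : ℝ)) ^ m) L) {N : ℕ}
    (hN : (q : ℝ) ^ N * |L| ≤ 1) :
    |(partialInt q c N : ℝ)| ≤ 41 * (q : ℝ) ^ n * ((N : ℝ) + 2) ^ 2 := by
  have hq0 : (0 : ℝ) < q := by exact_mod_cast (by omega : 0 < q)
  have hq1 : (1 : ℝ) ≤ q := by exact_mod_cast (by omega : 1 ≤ q)
  have h1 := abs_sub_partial_le hq hc hL N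
  set p := ∑ m ∈ Finset.range (N + 1), (c m : ℝ) * (1 / (q : ℝ)) ^ m with hp
  have e : (partialInt q c N : ℝ) = (q : ℝ) ^ N * (L - p) - (q : ℝ) ^ N * L := by
    rw [partialInt_eq (by omega) c N]
    ring
  have hqN : 0 < (q : ℝ) ^ N := by positivity
  have h2 : |(q : ℝ) ^ N * (L - p)| ≤ 40 * (q : ℝ) ^ n * ((N : ℝ) + 2) ^ 2 := by
    rw [abs_mul, abs_of_pos hqN]
    calc (q : ℝ) ^ N * |L - p| ≤ (q : ℝ) ^ N * ((1 / (q : ℝ)) ^ N *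
          (40 * (q : ℝ) ^ n * ((N : ℝ) + 2) ^ 2)) := by gcongr
      _ = _ := by
        rw [← mul_assoc, ← mul_pow, mul_one_div_cancel hq0.ne', one_pow, one_mul]
  have h3 : |(q : ℝ) ^ N * L| ≤ 1 := by rwa [abs_mul, abs_of_pos hqN]
  have h4 : 1 ≤ (q : ℝ) ^ n * ((N : ℝ) + 2) ^ 2 := by
    have a1 : 1 ≤ (q : ℝ) ^ n := one_le_pow₀ hq1
    have a2 : 1 ≤ ((N : ℝ) + 2) ^ 2 := by
      have : (0 : ℝ) ≤ N := Nat.cast_nonneg N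
      nlinarith
    nlinarith
  rw [e]
  refine (abs_sub _ _).trans ?_
  linarith

end Series

section Representations

/-- Number of representations as a cube. -/
def reprOne (m : ℕ) : ℕ := ((Finset.range (m + 1)).filter fun a => a ^ 3 = m).card

/-- Number of ordered representations as a sum of two cubes. -/
def reprTwo (m : ℕ) : ℕ := ((Finset.range (m + 1) ×ˢ Finset.range (m + 1)).filter fun t =>
  t.1 ^ 3 + t.2 ^ 3 = m).card

/-- Number of ordered representations as a sum of three cubes. -/
def reprThree (m : ℕ) : ℕ := ((Finset.range (m + 1) ×ˢ Finset.range (m + 1) ×ˢ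
  Finset.range (m + 1)).filter fun t => t.1 ^ 3 + t.2.1 ^ 3 + t.2.2 ^ 3 = m).card

lemma reprOne_le (m : ℕ) : reprOne m ≤ m + 1 :=
  (Finset.card_filter_le _ _).trans (by simp)

lemma reprTwo_le (m : ℕ) : reprTwo m ≤ (m + 1) ^ 2 :=
  (Finset.card_filter_le _ _).trans (by simp [sq])

lemma pow_three_inj {a b : ℕ} (h : a ^ 3 = b ^ 3) : a = b :=
  Nat.pow_left_injective (by norm_num : 3 ≠ 0) h

lemma le_pow_three (a : ℕ) : a ≤ a ^ 3 := Nat.le_self_pow (by norm_num) a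

lemma reprThree_le (m : ℕ) : reprThree m ≤ (m + 1) ^ 2 := by
  have : reprThree m ≤ (Finset.range (m + 1) ×ˢ Finset.range (m + 1)).card := by
    refine Finset.card_le_card_of_injOn (fun t => (t.1, t.2.1)) ?_ ?_
    · rintro ⟨x, y, z⟩ h
      have h := (Finset.mem_filter.1 h).1
      simp only [Finset.mem_product] at h
      simp only [Finset.coe_product, Set.mem_prod, Finset.mem_coe]
      exact ⟨h.1, h.2.1⟩
    · rintro ⟨x, y, z⟩ h ⟨x', y', z'⟩ h' he
      have h := (Finset.mem_filter.1 h).2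
      have h' := (Finset.mem_filter.1 h').2
      simp only [Prod.mk.injEq] at he h h' ⊢
      obtain ⟨rfl, rfl⟩ := he
      exact ⟨rfl, rfl, pow_three_inj (by omega)⟩
  simpa [sq] using this

lemma reprOne_eq_zero {m : ℕ} (h : reprTwo m = 0) : reprOne m = 0 := by
  unfold reprOne reprTwo at *
  rw [Finset.card_eq_zero, Finset.filter_eq_empty_iff] at *
  intro a ha he
  exact h (x := (a, 0)) (by simpa using ha) (by simpa using he)

lemma pos_of_reprTwo_eq_zero {m : ℕ} (h : reprTwo m = 0) : m ≠ 0 := by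
  rintro rfl
  exact absurd h (by decide)

lemma hasSum_card_fiber {β : Type*} {F : β → ℕ} {s : ℕ → Finset β}
    (hs : ∀ m b, b ∈ s m ↔ F b = m) {x a : ℝ} (h : HasSum (fun b => x ^ F b) a) :
    HasSum (fun m => ((s m).card : ℝ) * x ^ m) a := by
  have h1 := h.tsum_fiberwise F
  have e : (fun m => ∑' b : ↥(F ⁻¹' {m}), x ^ F b) = fun m => ((s m).card : ℝ) * x ^ m := by
    funext m
    have hset : F ⁻¹' {m} = ↑(s m) := by
      ext b
      simp [hs]
    rw [hset, Finset.tsum_subtype' (s m) (fun b => x ^ F b),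
      Finset.sum_congr rfl fun b hb => by rw [(hs m b).1 hb], Finset.sum_const, nsmul_eq_mul]
  rwa [e] at h1

lemma hasSum_theta3 {q : ℕ} (hq : 2 ≤ q) :
    HasSum (fun n : ℕ => (1 / (q : ℝ)) ^ (n ^ 3)) (∑' n : ℕ, (1 : ℝ) / (q : ℝ) ^ (n ^ 3)) := by
  have hq2 : (2 : ℝ) ≤ q := by exact_mod_cast hq
  have hx : (1 / (q : ℝ)) < 1 := by
    rw [div_lt_one (by linarith)]
    linarith
  have hs : Summable (fun n : ℕ => (1 / (q : ℝ)) ^ (n ^ 3)) := by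
    refine .of_nonneg_of_le (fun n => by positivity) (fun n => ?_)
      (summable_geometric_of_lt_one (by positivity) hx)
    exact pow_le_pow_of_le_one (by positivity) hx.le (le_pow_three n)
  convert hs.hasSum using 4
  rw [one_div_pow]

lemma mem_reprOne_iff (m a : ℕ) :
    a ∈ (Finset.range (m + 1)).filter (fun a => a ^ 3 = m) ↔ a ^ 3 = m := by
  have := le_pow_three a
  simp only [Finset.mem_filter, Finset.mem_range, and_iff_right_iff_imp]
  intro h
  linarith

lemma mem_reprTwo_iff (m : ℕ) (t : ℕ × ℕ) :
    t ∈ (Finset.range (m + 1) ×ˢ Finset.range (m + 1)).filter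
      (fun t => t.1 ^ 3 + t.2 ^ 3 = m) ↔ t.1 ^ 3 + t.2 ^ 3 = m := by
  have := le_pow_three t.1
  have := le_pow_three t.2
  simp only [Finset.mem_filter, Finset.mem_product, Finset.mem_range, and_iff_right_iff_imp]
  intro h
  constructor <;> linarith

lemma mem_reprThree_iff (m : ℕ) (t : ℕ × ℕ × ℕ) :
    t ∈ (Finset.range (m + 1) ×ˢ Finset.range (m + 1) ×ˢ Finset.range (m + 1)).filter
      (fun t => t.1 ^ 3 + t.2.1 ^ 3 + t.2.2 ^ 3 = m) ↔ t.1 ^ 3 + t.2.1 ^ 3 + t.2.2 ^ 3 = m := by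
  have := le_pow_three t.1
  have := le_pow_three t.2.1
  have := le_pow_three t.2.2
  simp only [Finset.mem_filter, Finset.mem_product, Finset.mem_range, and_iff_right_iff_imp]
  intro h
  refine ⟨?_, ?_, ?_⟩ <;> linarith

lemma hasSum_reprOne {x θ : ℝ} (h : HasSum (fun n : ℕ => x ^ (n ^ 3)) θ) :
    HasSum (fun m => (reprOne m : ℝ) * x ^ m) θ :=
  hasSum_card_fiber (F := fun a => a ^ 3) mem_reprOne_iff h

lemma hasSum_sq_of_nonneg {f : ℕ → ℝ} {θ : ℝ} (hf : ∀ n, 0 ≤ f n) (h : HasSum f θ) :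
    HasSum (fun t : ℕ × ℕ => f t.1 * f t.2) (θ ^ 2) := by
  have hs := h.summable.mul_of_nonneg h.summable hf hf
  have := HasSum.mul h h hs
  rwa [← sq] at this

lemma hasSum_cube_of_nonneg {f : ℕ → ℝ} {θ : ℝ} (hf : ∀ n, 0 ≤ f n) (h : HasSum f θ) :
    HasSum (fun t : ℕ × ℕ × ℕ => f t.1 * (f t.2.1 * f t.2.2)) (θ ^ 3) := by
  have h2 := hasSum_sq_of_nonneg hf h
  have hs := h.summable.mul_of_nonneg h2.summable hf fun t => mul_nonneg (hf t.1) (hf t.2)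
  have := HasSum.mul h h2 hs
  rwa [show θ * θ ^ 2 = θ ^ 3 by ring] at this

lemma hasSum_reprTwo {x θ : ℝ} (hx : 0 ≤ x) (h : HasSum (fun n : ℕ => x ^ (n ^ 3)) θ) :
    HasSum (fun m => (reprTwo m : ℝ) * x ^ m) (θ ^ 2) := by
  refine hasSum_card_fiber mem_reprTwo_iff ?_
  obtain ⟨f, hf⟩ : ∃ f : ℕ → ℝ, f = fun n : ℕ => x ^ (n ^ 3) := ⟨_, rfl⟩
  rw [← hf] at h
  have hnn : ∀ n, 0 ≤ f n := fun n => by rw [hf]; positivity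
  have e : (fun t : ℕ × ℕ => x ^ (t.1 ^ 3 + t.2 ^ 3)) = fun t => f t.1 * f t.2 :=
    funext fun t => by rw [hf, pow_add]
  rw [e]
  exact hasSum_sq_of_nonneg hnn h

lemma hasSum_reprThree {x θ : ℝ} (hx : 0 ≤ x) (h : HasSum (fun n : ℕ => x ^ (n ^ 3)) θ) :
    HasSum (fun m => (reprThree m : ℝ) * x ^ m) (θ ^ 3) := by
  refine hasSum_card_fiber mem_reprThree_iff ?_
  obtain ⟨f, hf⟩ : ∃ f : ℕ → ℝ, f = fun n : ℕ => x ^ (n ^ 3) := ⟨_, rfl⟩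
  rw [← hf] at h
  have hnn : ∀ n, 0 ≤ f n := fun n => by rw [hf]; positivity
  have e : (fun t : ℕ × ℕ × ℕ => x ^ (t.1 ^ 3 + t.2.1 ^ 3 + t.2.2 ^ 3)) =
      fun t => f t.1 * (f t.2.1 * f t.2.2) :=
    funext fun t => by rw [hf, pow_add, pow_add, mul_assoc]
  rw [e]
  exact hasSum_cube_of_nonneg hnn h

/-- Coefficients of the linear form in the powers of the cubic theta series. -/
def formCoeff (α₀ α₁ α₂ α₃ : ℤ) (m : ℕ) : ℤ :=
  (if m = 0 then α₀ else 0) + α₁ * reprOne m + α₂ * reprTwo m + α₃ * reprThree m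

lemma hasSum_formCoeff {q : ℕ} {θ : ℝ} (h : HasSum (fun n : ℕ => (1 / (q : ℝ)) ^ (n ^ 3)) θ)
    (α₀ α₁ α₂ α₃ : ℤ) :
    HasSum (fun m => (formCoeff α₀ α₁ α₂ α₃ m : ℝ) * (1 / (q : ℝ)) ^ m)
      (α₀ + α₁ * θ + α₂ * θ ^ 2 + α₃ * θ ^ 3) := by
  have hx : (0 : ℝ) ≤ 1 / q := by positivity
  have h1 := hasSum_reprOne h
  have h2 := hasSum_reprTwo hx h
  have h3 := hasSum_reprThree hx h
  have h0 : HasSum (fun m : ℕ => if m = 0 then (α₀ : ℝ) else 0) α₀ := hasSum_ite_eq 0 _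
  convert (((h0.add (h1.mul_left (α₁ : ℝ))).add (h2.mul_left (α₂ : ℝ))).add
    (h3.mul_left (α₃ : ℝ))) using 2 with m
  unfold formCoeff
  rcases eq_or_ne m 0 with rfl | hm
  · simp
  · simp only [hm, if_false]
    push_cast
    ring

lemma abs_formCoeff_le {B : ℝ} {α₀ α₁ α₂ α₃ : ℤ} (h0 : |(α₀ : ℝ)| ≤ B) (h1 : |(α₁ : ℝ)| ≤ B)
    (h2 : |(α₂ : ℝ)| ≤ B) (h3 : |(α₃ : ℝ)| ≤ B) (m : ℕ) :
    |(formCoeff α₀ α₁ α₂ α₃ m : ℝ)| ≤ 4 * B * ((m : ℝ) + 1) ^ 2 := by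
  have hm : (1 : ℝ) ≤ (m : ℝ) + 1 := by
    have : (0 : ℝ) ≤ m := Nat.cast_nonneg m
    linarith
  have hB : 0 ≤ B := (abs_nonneg _).trans h0
  have r1 : (reprOne m : ℝ) ≤ ((m : ℝ) + 1) ^ 2 := by
    have : (reprOne m : ℝ) ≤ (m : ℝ) + 1 := by exact_mod_cast reprOne_le m
    nlinarith
  have r2 : (reprTwo m : ℝ) ≤ ((m : ℝ) + 1) ^ 2 := by exact_mod_cast reprTwo_le m
  have r3 : (reprThree m : ℝ) ≤ ((m : ℝ) + 1) ^ 2 := by exact_mod_cast reprThree_le m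
  have key : ∀ (a : ℤ) (r : ℕ), |(a : ℝ)| ≤ B → (r : ℝ) ≤ ((m : ℝ) + 1) ^ 2 →
      |(a : ℝ) * r| ≤ B * ((m : ℝ) + 1) ^ 2 := fun a r ha hr => by
    rw [abs_mul, Nat.abs_cast]
    gcongr
  have z0 : |(if m = 0 then (α₀ : ℝ) else 0)| ≤ B * ((m : ℝ) + 1) ^ 2 := by
    have : B ≤ B * ((m : ℝ) + 1) ^ 2 := le_mul_of_one_le_right hB (one_le_pow₀ hm)
    split_ifs
    · exact h0.trans this
    · simpa using hB.trans this
  unfold formCoeff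
  push_cast
  refine (abs_add_le _ _).trans ?_
  refine (add_le_add ((abs_add_le _ _).trans (add_le_add ((abs_add_le _ _).trans
    (add_le_add z0 (key α₁ _ h1 r1))) (key α₂ _ h2 r2)))
    (key α₃ _ h3 r3)).trans ?_
  linarith

lemma formCoeff_of_reprTwo_eq_zero {m : ℕ} (h : reprTwo m = 0) (α₀ α₁ α₂ α₃ : ℤ) :
    formCoeff α₀ α₁ α₂ α₃ m = α₃ * reprThree m := by
  simp [formCoeff, h, reprOne_eq_zero h, pos_of_reprTwo_eq_zero h]

end Representations

section CubeCounting

lemma exists_cube_floor (t : ℕ) : ∃ x : ℕ, x ^ 3 ≤ t ∧ t ≤ x ^ 3 + 3 * x ^ 2 + 3 * x := by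
  induction t with
  | zero => exact ⟨0, by simp⟩
  | succ t ih =>
    obtain ⟨x, h1, h2⟩ := ih
    rcases h2.lt_or_eq with h | h
    · exact ⟨x, by omega, by omega⟩
    · refine ⟨x + 1, ?_, ?_⟩ <;> ring_nf <;> omega

lemma reprThree_pos (x y z : ℕ) : 0 < reprThree (x ^ 3 + y ^ 3 + z ^ 3) :=
  Finset.card_pos.2 ⟨(x, y, z), (mem_reprThree_iff _ _).2 rfl⟩

lemma exists_reprThree_pos {s N : ℕ} (hs : 0 < s) (hN : N < 10 ^ 6 * s ^ 27) :
    ∃ j < 1000 * s ^ 8, 0 < reprThree (N + 1 + j) := by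
  have p1 : ∀ {i j : ℕ}, i ≤ j → s ^ i ≤ s ^ j := fun h => Nat.pow_le_pow_right hs h
  obtain ⟨x, hx1, hx2⟩ := exists_cube_floor (N + 1000 * s ^ 8)
  have hx : x ≤ 101 * s ^ 9 := by
    refine le_of_not_gt fun h => ?_
    have := Nat.pow_le_pow_left h.le 3
    have e : (101 * s ^ 9) ^ 3 = 1030301 * s ^ 27 := by ring
    have := p1 (show 8 ≤ 27 by norm_num)
    have : 1 ≤ s ^ 27 := Nat.one_le_pow _ _ hs
    omega
  obtain ⟨y, hy1, hy2⟩ := exists_cube_floor (N + 1000 * s ^ 8 - x ^ 3)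
  have hy : y ≤ 32 * s ^ 6 := by
    refine le_of_not_gt fun h => ?_
    have := Nat.pow_le_pow_left h.le 3
    have e : (32 * s ^ 6) ^ 3 = 32768 * s ^ 18 := by ring
    have := Nat.pow_le_pow_left hx 2
    have e' : (101 * s ^ 9) ^ 2 = 10201 * s ^ 18 := by ring
    have := p1 (show 9 ≤ 18 by norm_num)
    have : 1 ≤ s ^ 18 := Nat.one_le_pow _ _ hs
    omega
  obtain ⟨z, hz1, hz2⟩ := exists_cube_floor (N + 1000 * s ^ 8 - x ^ 3 - y ^ 3)
  have hz : z ≤ 15 * s ^ 4 := by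
    refine le_of_not_gt fun h => ?_
    have := Nat.pow_le_pow_left h.le 3
    have e : (15 * s ^ 4) ^ 3 = 3375 * s ^ 12 := by ring
    have := Nat.pow_le_pow_left hy 2
    have e' : (32 * s ^ 6) ^ 2 = 1024 * s ^ 12 := by ring
    have := p1 (show 6 ≤ 12 by norm_num)
    have : 1 ≤ s ^ 12 := Nat.one_le_pow _ _ hs
    omega
  have := Nat.pow_le_pow_left hz 2
  have e' : (15 * s ^ 4) ^ 2 = 225 * s ^ 8 := by ring
  have := p1 (show 4 ≤ 8 by norm_num)
  have h0 : 0 < s ^ 8 := by positivity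
  refine ⟨x ^ 3 + y ^ 3 + z ^ 3 - N - 1, by omega, ?_⟩
  rw [show N + 1 + (x ^ 3 + y ^ 3 + z ^ 3 - N - 1) = x ^ 3 + y ^ 3 + z ^ 3 by omega]
  exact reprThree_pos x y z

lemma lt_of_pow_three_lt {x S : ℕ} (h : x ^ 3 < S ^ 3) : x < S := lt_of_pow_lt_pow_left' 3 h

lemma sum_reprTwo_le {X S : ℕ} (h : X ≤ S ^ 3) : ∑ m ∈ Finset.range X, reprTwo m ≤ S ^ 2 := by
  have key : ((Finset.range S ×ˢ Finset.range S).filter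
      fun t => t.1 ^ 3 + t.2 ^ 3 ∈ Finset.range X).card = ∑ m ∈ Finset.range X, reprTwo m := by
    refine (Finset.card_eq_sum_card_fiberwise (f := fun t : ℕ × ℕ => t.1 ^ 3 + t.2 ^ 3)
      (t := Finset.range X) fun t ht => (Finset.mem_filter.1 ht).2).trans ?_
    refine Finset.sum_congr rfl fun m hm => ?_
    unfold reprTwo
    congr 1
    ext t
    rw [mem_reprTwo_iff]
    simp only [Finset.mem_filter, Finset.mem_product, Finset.mem_range] at hm ⊢
    constructor
    · exact fun h => h.2
    · intro e
      exact ⟨⟨⟨lt_of_pow_three_lt (by omega), lt_of_pow_three_lt (by omega)⟩,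
        by simpa [e] using hm⟩, e⟩
  rw [← key]
  exact (Finset.card_filter_le _ _).trans (by simp [sq])

lemma sum_reprThree_eq {D : Finset ℕ} {S : ℕ} (h : ∀ m ∈ D, m < S ^ 3) :
    ∑ m ∈ D, reprThree m = ((Finset.range S ×ˢ Finset.range S ×ˢ Finset.range S).filter
      fun t => t.1 ^ 3 + t.2.1 ^ 3 + t.2.2 ^ 3 ∈ D).card := by
  symm
  refine (Finset.card_eq_sum_card_fiberwise
    (f := fun t : ℕ × ℕ × ℕ => t.1 ^ 3 + t.2.1 ^ 3 + t.2.2 ^ 3)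
    (t := D) fun t ht => (Finset.mem_filter.1 ht).2).trans ?_
  refine Finset.sum_congr rfl fun m hm => ?_
  unfold reprThree
  congr 1
  ext t
  rw [mem_reprThree_iff]
  have := h m hm
  simp only [Finset.mem_filter, Finset.mem_product, Finset.mem_range]
  constructor
  · exact fun h => h.2
  · intro e
    exact ⟨⟨⟨lt_of_pow_three_lt (by omega), lt_of_pow_three_lt (by omega),
      lt_of_pow_three_lt (by omega)⟩, e ▸ hm⟩, e⟩

lemma sum_reprThree_le {D : Finset ℕ} {S : ℕ} (h : ∀ m ∈ D, m < S ^ 3) :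
    ∑ m ∈ D, reprThree m ≤ S ^ 3 := by
  rw [sum_reprThree_eq h]
  exact (Finset.card_filter_le _ _).trans (by simp [pow_succ, mul_assoc])

lemma card_cubes_modEq_le {M : ℕ} (hM : 0 < M) (S b : ℕ) :
    ((Finset.range S ×ˢ Finset.range S ×ˢ Finset.range S).filter
      fun t => t.1 ^ 3 + t.2.1 ^ 3 + t.2.2 ^ 3 ≡ b [MOD M]).card ≤
      cubeSols M b * (S / M + 1) ^ 3 := by
  have hcard : cubeSols M b * (S / M + 1) ^ 3 =
      (((Finset.range M ×ˢ Finset.range M ×ˢ Finset.range M).filter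
      fun t => t.1 ^ 3 + t.2.1 ^ 3 + t.2.2 ^ 3 ≡ b [MOD M]) ×ˢ
      (Finset.range (S / M + 1) ×ˢ Finset.range (S / M + 1) ×ˢ
        Finset.range (S / M + 1))).card := by
    rw [Finset.card_product]
    simp [cubeSols, pow_succ, mul_assoc]
  rw [hcard]
  refine Finset.card_le_card_of_injOn (fun t => ((t.1 % M, t.2.1 % M, t.2.2 % M),
    (t.1 / M, t.2.1 / M, t.2.2 / M))) ?_ ?_
  · rintro ⟨x, y, z⟩ ht
    simp only [Finset.coe_filter, Finset.mem_product, Finset.mem_range, Set.mem_ofPred_eq] at ht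
    obtain ⟨⟨hx, hy, hz⟩, h⟩ := ht
    have hd : ∀ {x}, x < S → x / M < S / M + 1 := fun h =>
      Nat.lt_succ_of_le (Nat.div_le_div_right h.le)
    simp only [Finset.coe_product, Set.mem_prod, Finset.mem_coe, Finset.mem_filter,
      Finset.mem_product, Finset.mem_range]
    refine ⟨⟨⟨Nat.mod_lt _ hM, Nat.mod_lt _ hM, Nat.mod_lt _ hM⟩, ?_⟩, hd hx, hd hy, hd hz⟩
    refine Nat.ModEq.trans ?_ h
    exact (((Nat.mod_modEq _ _).pow 3).add ((Nat.mod_modEq _ _).pow 3)).add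
      ((Nat.mod_modEq _ _).pow 3)
  · rintro ⟨x, y, z⟩ - ⟨x', y', z'⟩ - h
    simp only [Prod.mk.injEq] at h ⊢
    obtain ⟨⟨h1, h2, h3⟩, h4, h5, h6⟩ := h
    have key : ∀ {u v : ℕ}, u % M = v % M → u / M = v / M → u = v := fun {u v} e1 e2 => by
      rw [← Nat.mod_add_div u M, ← Nat.mod_add_div v M, e1, e2]
    exact ⟨key h1 h4, key h2 h5, key h3 h6⟩

lemma sum_reprThree_modEq_le {M : ℕ} (hM : 0 < M) {X S j : ℕ} (b : ℕ) (h : X + j < S ^ 3) :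
    ∑ N ∈ (Finset.range X).filter (fun N => N ≡ b [MOD M]), reprThree (N + 1 + j) ≤
      cubeSols M (b + (j + 1)) * (S / M + 1) ^ 3 := by
  have e : ∑ N ∈ (Finset.range X).filter (fun N => N ≡ b [MOD M]), reprThree (N + 1 + j) =
      ∑ m ∈ ((Finset.range X).filter (fun N => N ≡ b [MOD M])).map
        (addRightEmbedding (j + 1)), reprThree m := by
    rw [Finset.sum_map]
    refine Finset.sum_congr rfl fun N _ => ?_
    rw [addRightEmbedding_apply, show N + 1 + j = N + (j + 1) by ring]
  rw [e, sum_reprThree_eq (S := S)]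
  · refine le_trans (Finset.card_le_card ?_) (card_cubes_modEq_le hM S (b + (j + 1)))
    refine Finset.monotone_filter_right _ fun t _ ht => ?_
    obtain ⟨N, hN, e⟩ := Finset.mem_map.1 ht
    rw [← e]
    exact (Finset.mem_filter.1 hN).2.add_right _
  · intro m hm
    obtain ⟨N, hN, e⟩ := Finset.mem_map.1 hm
    have := Finset.mem_range.1 (Finset.mem_filter.1 hN).1
    simp only [addRightEmbedding_apply] at e
    omega

lemma sum_reprThree_shift_le {X S j : ℕ} (h : X + j < S ^ 3) :
    ∑ N ∈ Finset.range X, reprThree (N + 1 + j) ≤ S ^ 3 := by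
  have e : ∑ N ∈ Finset.range X, reprThree (N + 1 + j) =
      ∑ m ∈ (Finset.range X).map (addRightEmbedding (j + 1)), reprThree m := by
    rw [Finset.sum_map]
    refine Finset.sum_congr rfl fun N _ => ?_
    rw [addRightEmbedding_apply, show N + 1 + j = N + (j + 1) by ring]
  rw [e]
  refine sum_reprThree_le fun m hm => ?_
  obtain ⟨N, hN, e⟩ := Finset.mem_map.1 hm
  have := Finset.mem_range.1 hN
  simp only [addRightEmbedding_apply] at e
  omega

lemma sum_range_mul_eq (φ : ℕ → ℝ) (K W : ℕ) :
    ∑ N ∈ Finset.range (K * W), φ N =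
      ∑ k ∈ Finset.range K, ∑ i ∈ Finset.range W, φ (k * W + i) := by
  induction K with
  | zero => simp
  | succ K ih => rw [Nat.succ_mul, Finset.sum_range_add, ih, Finset.sum_range_succ]

lemma exists_block_sum_lt_one {φ : ℕ → ℝ} {K W : ℕ}
    (h : ∑ N ∈ Finset.range (K * W), φ N < K) :
    ∃ k < K, ∑ i ∈ Finset.range W, φ (k * W + i) < 1 := by
  rw [sum_range_mul_eq] at h
  have : ∑ k ∈ Finset.range K, ∑ i ∈ Finset.range W, φ (k * W + i) <
      ∑ k ∈ Finset.range K, (1 : ℝ) := by simpa using h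
  obtain ⟨k, hk, h⟩ := Finset.exists_lt_of_sum_lt this
  exact ⟨k, Finset.mem_range.1 hk, h⟩

end CubeCounting

section BlockSelection

/-- The weights `1, …, 1, 1/2, 1/4, …` whose first `2 n` terms are equal to one. -/
noncomputable def headWeight (n j : ℕ) : ℝ := if j < 2 * n then 1 else (1 / 2) ^ (j + 1 - 2 * n)

/-- Geometrically weighted number of representations as sums of three cubes after `N`. -/
noncomputable def tailSum (h N : ℕ) : ℝ :=
  ∑ j ∈ Finset.range h, (1 / 2 : ℝ) ^ j * reprThree (N + 1 + j)

/-- Number of representations as sums of three cubes after `N`, weighted by `headWeight`. -/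
noncomputable def headSum (n h N : ℕ) : ℝ :=
  ∑ j ∈ Finset.range h, headWeight n j * reprThree (N + 1 + j)

lemma headWeight_nonneg (n j : ℕ) : 0 ≤ headWeight n j := by
  unfold headWeight
  split_ifs <;> positivity

lemma tailSum_nonneg (h N : ℕ) : 0 ≤ tailSum h N :=
  Finset.sum_nonneg fun _ _ => by positivity

lemma headSum_nonneg (n h N : ℕ) : 0 ≤ headSum n h N :=
  Finset.sum_nonneg fun j _ => mul_nonneg (headWeight_nonneg n j) (Nat.cast_nonneg _)

lemma sum_headWeight_eq (n m : ℕ) :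
    ∑ j ∈ Finset.range (2 * n + m), headWeight n j = 2 * n + 1 - (1 / 2) ^ m := by
  induction m with
  | zero =>
    rw [add_zero, Finset.sum_congr rfl fun j hj => show headWeight n j = 1 from
      if_pos (Finset.mem_range.1 hj)]
    simp
  | succ m ih =>
    rw [← add_assoc, Finset.sum_range_succ, ih, headWeight, if_neg (by omega),
      show 2 * n + m + 1 - 2 * n = m + 1 by omega]
    ring

lemma sum_headWeight_le (n h : ℕ) :
    ∑ j ∈ Finset.range h, headWeight n j ≤ 2 * n + 1 := by
  calc ∑ j ∈ Finset.range h, headWeight n j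
      ≤ ∑ j ∈ Finset.range (2 * n + h), headWeight n j :=
        Finset.sum_le_sum_of_subset_of_nonneg (Finset.range_mono (by omega))
          fun j _ _ => headWeight_nonneg n j
    _ ≤ 2 * n + 1 := by
      rw [sum_headWeight_eq]
      have : (0 : ℝ) ≤ (1 / 2) ^ h := by positivity
      linarith

lemma sum_headSum_le {X S h : ℕ} (n : ℕ) (hX : X + h ≤ S ^ 3) :
    ∑ N ∈ Finset.range X, headSum n h N ≤ (2 * n + 1) * (S : ℝ) ^ 3 := by
  unfold headSum
  rw [Finset.sum_comm]
  calc ∑ j ∈ Finset.range h, ∑ N ∈ Finset.range X, headWeight n j * (reprThree (N + 1 + j) : ℝ)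
      ≤ ∑ j ∈ Finset.range h, headWeight n j * (S : ℝ) ^ 3 := by
        refine Finset.sum_le_sum fun j hj => ?_
        rw [← Finset.mul_sum]
        refine mul_le_mul_of_nonneg_left ?_ (headWeight_nonneg n j)
        have := Finset.mem_range.1 hj
        exact_mod_cast sum_reprThree_shift_le (X := X) (S := S) (j := j) (by omega)
    _ ≤ (2 * n + 1) * (S : ℝ) ^ 3 := by
        rw [← Finset.sum_mul]
        exact mul_le_mul_of_nonneg_right (sum_headWeight_le n h) (by positivity)

lemma sum_tailSum_modEq_le {X S h M : ℕ} (hM : 0 < M) (b : ℕ) (hX : X + h ≤ S ^ 3) :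
    ∑ N ∈ (Finset.range X).filter (fun N => N ≡ b [MOD M]), tailSum h N ≤
      (∑ j ∈ Finset.range h, (1 / 2 : ℝ) ^ j * cubeSols M (b + (j + 1))) *
        ((S : ℝ) / M + 1) ^ 3 := by
  unfold tailSum
  rw [Finset.sum_comm, Finset.sum_mul]
  refine Finset.sum_le_sum fun j hj => ?_
  rw [← Finset.mul_sum, mul_assoc]
  refine mul_le_mul_of_nonneg_left ?_ (by positivity)
  have := Finset.mem_range.1 hj
  have h1 := sum_reprThree_modEq_le (X := X) (S := S) (j := j) hM b (by omega)
  have h2 : (∑ N ∈ (Finset.range X).filter (fun N => N ≡ b [MOD M]),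
      (reprThree (N + 1 + j) : ℝ)) ≤ cubeSols M (b + (j + 1)) * (((S / M : ℕ) : ℝ) + 1) ^ 3 := by
    exact_mod_cast h1
  refine h2.trans ?_
  have : ((S / M : ℕ) : ℝ) ≤ (S : ℝ) / M := Nat.cast_div_le
  gcongr

theorem exists_block {n C s h W : ℕ} (hn : 4 ≤ n) (hs : s = 2 ^ n ^ 2)
    (hh : h = 250000 * s ^ 8) (hW : W = 10 ^ 6 * s ^ 8) {M b : Fin (C * n + 1) → ℕ}
    (hM : ∀ i, 0 < M i ∧ M i ≤ s ∧ ∑ j ∈ Finset.range h,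
      (1 / 2 : ℝ) ^ j * cubeSols (M i) (b i + (j + 1)) ≤ (M i : ℝ) ^ 2 / (n : ℝ) ^ 4) :
    ∃ a, a + W ≤ 10 ^ 6 * s ^ 27 ∧ (∀ i < W, reprTwo (a + i) = 0) ∧
      ∑ i ∈ Finset.range W, headSum n h (a + i) ≤ 96 * n * W ∧
      ∀ l, M l * ∑ i ∈ (Finset.range W).filter (fun i => a + i ≡ b l [MOD M l]),
        tailSum h (a + i) ≤ 256 * (C + 1) * W / (n : ℝ) ^ 3 := by
  have hs4 : 65536 ≤ s := by
    rw [hs]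
    calc 65536 = 2 ^ 4 ^ 2 := by norm_num
      _ ≤ 2 ^ n ^ 2 := Nat.pow_le_pow_right (by norm_num) (Nat.pow_le_pow_left hn 2)
  have hs0 : 0 < s := by omega
  have hsr : (65536 : ℝ) ≤ s := by exact_mod_cast hs4
  have hnr : (4 : ℝ) ≤ n := by exact_mod_cast hn
  have hWr : (W : ℝ) = 10 ^ 6 * (s : ℝ) ^ 8 := by rw [hW]; push_cast; ring
  have hW0 : (0 : ℝ) < W := by rw [hWr]; positivity
  have hX : s ^ 19 * W = 10 ^ 6 * s ^ 27 := by rw [hW]; ring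
  have hXS : s ^ 19 * W + h ≤ (200 * s ^ 9) ^ 3 := by
    rw [hX, hh]
    have : s ^ 8 ≤ s ^ 27 := Nat.pow_le_pow_right hs0 (by norm_num)
    have : (200 * s ^ 9) ^ 3 = 8000000 * s ^ 27 := by ring
    omega
  have hSr : (((200 * s ^ 9 : ℕ) : ℝ)) ^ 3 = 8 * ((s : ℝ) ^ 19 * W) := by
    rw [hWr]; push_cast; ring
  set A₁ : ℝ := 96 * n * W with hA₁
  set A₂ : ℝ := 256 * (C + 1) * W / (n : ℝ) ^ 3 with hA₂
  have hA₁0 : 0 < A₁ := by positivity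
  have hA₂0 : 0 < A₂ := by positivity
  let φ₁ : ℕ → ℝ := fun N => (reprTwo N : ℝ)
  let φ₂ : ℕ → ℝ := fun N => headSum n h N / A₁
  let ψ : Fin (C * n + 1) → ℕ → ℝ := fun l N =>
    if N ≡ b l [MOD M l] then M l * tailSum h N / A₂ else 0
  have φ₁0 : ∀ N, 0 ≤ φ₁ N := fun N => Nat.cast_nonneg _
  have φ₂0 : ∀ N, 0 ≤ φ₂ N := fun N => div_nonneg (headSum_nonneg n h N) hA₁0.le
  have ψ0 : ∀ l N, 0 ≤ ψ l N := fun l N => by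
    have := tailSum_nonneg h N
    simp only [ψ]
    split_ifs <;> positivity
  have b1 : ∑ N ∈ Finset.range (s ^ 19 * W), φ₁ N ≤ (s : ℝ) ^ 19 / 4 := by
    have h1 : ∑ N ∈ Finset.range (s ^ 19 * W), reprTwo N ≤ (100 * s ^ 9) ^ 2 :=
      sum_reprTwo_le (by rw [hX]; ring_nf; exact le_rfl)
    have h2 : ∑ N ∈ Finset.range (s ^ 19 * W), φ₁ N ≤ (100 * (s : ℝ) ^ 9) ^ 2 := by
      simp only [φ₁]; exact_mod_cast h1
    have h3 : (s : ℝ) ^ 19 = s ^ 18 * s := by ring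
    have h4 : (0 : ℝ) < s ^ 18 := by positivity
    rw [h3]
    nlinarith
  have b2 : ∑ N ∈ Finset.range (s ^ 19 * W), φ₂ N ≤ (s : ℝ) ^ 19 / 4 := by
    rw [← Finset.sum_div, div_le_iff₀ hA₁0]
    refine (sum_headSum_le n hXS).trans ?_
    rw [hSr, hA₁]
    have : (0 : ℝ) < (s : ℝ) ^ 19 * W := by positivity
    nlinarith
  have b3 : ∀ l, ∑ N ∈ Finset.range (s ^ 19 * W), ψ l N ≤ (s : ℝ) ^ 19 / (4 * ((C + 1) * n)) := by
    intro l
    obtain ⟨m0, m1, m2⟩ := hM l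
    have m0r : (0 : ℝ) < M l := by exact_mod_cast m0
    have m1r : (M l : ℝ) ≤ s := by exact_mod_cast m1
    simp only [ψ]
    rw [← Finset.sum_filter, ← Finset.sum_div, ← Finset.mul_sum, div_le_iff₀ hA₂0]
    have e1 := sum_tailSum_modEq_le m0 (b l) hXS
    have e2 : ((200 * s ^ 9 : ℕ) : ℝ) / M l + 1 ≤ 2 * (((200 * s ^ 9 : ℕ) : ℝ) / M l) := by
      have : 1 ≤ ((200 * s ^ 9 : ℕ) : ℝ) / M l := by
        rw [le_div_iff₀ m0r, one_mul]
        have : s ≤ 200 * s ^ 9 := by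
          have := Nat.le_self_pow (by norm_num : 9 ≠ 0) s
          omega
        exact_mod_cast m1.trans this
      linarith
    have e3 : ((((200 * s ^ 9 : ℕ) : ℝ)) / M l + 1) ^ 3 ≤
        8 * (8 * ((s : ℝ) ^ 19 * W)) / (M l : ℝ) ^ 3 := by
      calc _ ≤ (2 * (((200 * s ^ 9 : ℕ) : ℝ) / M l)) ^ 3 := by gcongr
        _ = 8 * (8 * ((s : ℝ) ^ 19 * W)) / (M l : ℝ) ^ 3 := by
          rw [mul_pow, div_pow, hSr]; ring
    calc (M l : ℝ) * _ ≤ M l * ((M l : ℝ) ^ 2 / (n : ℝ) ^ 4 *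
          (8 * (8 * ((s : ℝ) ^ 19 * W)) / (M l : ℝ) ^ 3)) := by
          refine mul_le_mul_of_nonneg_left (e1.trans ?_) m0r.le
          exact mul_le_mul m2 e3 (by positivity) (by positivity)
      _ = (s : ℝ) ^ 19 / (4 * ((C + 1) * n)) * A₂ := by
          rw [hA₂]
          field_simp
          ring
  have b4 : ∑ N ∈ Finset.range (s ^ 19 * W), ∑ l, ψ l N ≤ (s : ℝ) ^ 19 / 4 := by
    rw [Finset.sum_comm]
    calc _ ≤ ∑ l : Fin (C * n + 1), (s : ℝ) ^ 19 / (4 * ((C + 1) * n)) :=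
          Finset.sum_le_sum fun l _ => b3 l
      _ = ((C : ℝ) * n + 1) * ((s : ℝ) ^ 19 / (4 * ((C + 1) * n))) := by simp
      _ ≤ ((C : ℝ) + 1) * n * ((s : ℝ) ^ 19 / (4 * ((C + 1) * n))) := by
          gcongr
          linarith
      _ = (s : ℝ) ^ 19 / 4 := by field_simp
  have hs19 : (0 : ℝ) < (s : ℝ) ^ 19 := by positivity
  obtain ⟨k, hk, hlt⟩ := exists_block_sum_lt_one (φ := fun N => φ₁ N + φ₂ N + ∑ l, ψ l N)
    (K := s ^ 19) (W := W) (by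
      rw [Finset.sum_add_distrib, Finset.sum_add_distrib]
      push_cast
      linarith)
  rw [Finset.sum_add_distrib, Finset.sum_add_distrib] at hlt
  have p1 := Finset.sum_nonneg fun i (_ : i ∈ Finset.range W) => φ₁0 (k * W + i)
  have p2 := Finset.sum_nonneg fun i (_ : i ∈ Finset.range W) => φ₂0 (k * W + i)
  have p3 := Finset.sum_nonneg fun i (_ : i ∈ Finset.range W) =>
    Finset.sum_nonneg fun l (_ : l ∈ Finset.univ) => ψ0 l (k * W + i)
  refine ⟨k * W, ?_, ?_, ?_, ?_⟩
  · rw [← hX, ← Nat.succ_mul]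
    exact Nat.mul_le_mul_right _ hk
  · intro i hi
    have : φ₁ (k * W + i) < 1 :=
      (Finset.single_le_sum (fun i _ => φ₁0 (k * W + i)) (Finset.mem_range.2 hi)).trans_lt
        (by linarith)
    have : reprTwo (k * W + i) < 1 := by simp only [φ₁] at this; exact_mod_cast this
    omega
  · have : ∑ i ∈ Finset.range W, φ₂ (k * W + i) ≤ 1 := by linarith
    simp only [φ₂] at this
    rwa [← Finset.sum_div, div_le_one hA₁0] at this
  · intro l
    have : ∑ i ∈ Finset.range W, ψ l (k * W + i) ≤ 1 := by
      refine le_trans (Finset.sum_le_sum fun i _ => ?_) (by linarith :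
        ∑ i ∈ Finset.range W, ∑ l, ψ l (k * W + i) ≤ 1)
      exact Finset.single_le_sum (fun l _ => ψ0 l (k * W + i)) (Finset.mem_univ l)
    simp only [ψ] at this
    rwa [← Finset.sum_filter, ← Finset.sum_div, ← Finset.mul_sum, div_le_one hA₂0] at this

end BlockSelection

section BlockDynamics

lemma orbit_expand {q : ℕ} (hq : 0 < q) {t : ℕ → ℤ} {r : ℕ → ℕ} {α : ℤ} {W : ℕ}
    (hrec : ∀ i, i + 1 < W → t (i + 1) = q * t i - α * r i) (i m : ℕ) (hm : i + m < W) :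
    (t i : ℝ) = (1 / (q : ℝ)) ^ m * t (i + m) +
      α * ∑ j ∈ Finset.range m, (r (i + j) : ℝ) * (1 / (q : ℝ)) ^ (j + 1) := by
  have hq0 : (q : ℝ) ≠ 0 := by positivity
  induction m with
  | zero => simp
  | succ m ih =>
    rw [ih (by omega), Finset.sum_range_succ]
    have h1 : (t (i + (m + 1)) : ℝ) = q * t (i + m) - α * r (i + m) := by
      rw [← add_assoc, hrec (i + m) (by omega)]
      push_cast
      ring
    rw [h1, pow_succ]
    field_simp
    ring

lemma abs_orbit_sub_le {q : ℕ} (hq : 0 < q) {t : ℕ → ℤ} {r : ℕ → ℕ} {α : ℤ} {W h i : ℕ} {R : ℝ}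
    (hrec : ∀ i, i + 1 < W → t (i + 1) = q * t i - α * r i) (hR : ∀ i < W, |(t i : ℝ)| ≤ R)
    (hi : i + h < W) :
    |(t i : ℝ) - α * ∑ j ∈ Finset.range h, (r (i + j) : ℝ) * (1 / (q : ℝ)) ^ (j + 1)| ≤
      (1 / (q : ℝ)) ^ h * R := by
  have hx : (0 : ℝ) ≤ (1 / (q : ℝ)) ^ h := by positivity
  rw [orbit_expand hq hrec i h hi, add_sub_cancel_right, abs_mul, abs_of_nonneg hx]
  exact mul_le_mul_of_nonneg_left (hR _ hi) hx

variable {q h i i' : ℕ} {t : ℕ → ℤ} {r : ℕ → ℕ} {α : ℤ} {ε : ℝ}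

lemma orbit_pos (hq : 2 ≤ q) (hα : 0 < α)
    (hi : |(t i : ℝ) - α * ∑ j ∈ Finset.range h, (r (i + j) : ℝ) * (1 / (q : ℝ)) ^ (j + 1)| ≤ ε)
    {G : ℕ} (hG : G ≤ h) (hgap : ∃ j < G, 0 < r (i + j)) (hε : ε < (1 / (q : ℝ)) ^ G) :
    0 < t i := by
  have hq2 : (2 : ℝ) ≤ q := by exact_mod_cast hq
  have hx1 : (1 / (q : ℝ)) ≤ 1 := by
    rw [div_le_one (by linarith)]
    linarith
  have hα1 : (1 : ℝ) ≤ α := by exact_mod_cast hα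
  obtain ⟨j, hj, hr⟩ := hgap
  have hr1 : (1 : ℝ) ≤ r (i + j) := by exact_mod_cast hr
  have h1 : (1 / (q : ℝ)) ^ G ≤
      ∑ j ∈ Finset.range h, (r (i + j) : ℝ) * (1 / (q : ℝ)) ^ (j + 1) := by
    calc (1 / (q : ℝ)) ^ G ≤ (1 / (q : ℝ)) ^ (j + 1) :=
          pow_le_pow_of_le_one (by positivity) hx1 hj
      _ ≤ (r (i + j) : ℝ) * (1 / (q : ℝ)) ^ (j + 1) := le_mul_of_one_le_left (by positivity) hr1
      _ ≤ _ := Finset.single_le_sum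
          (f := fun j => (r (i + j) : ℝ) * (1 / (q : ℝ)) ^ (j + 1)) (fun j _ => by positivity)
          (Finset.mem_range.2 (by omega))
  have h2 := (abs_le.1 hi).1
  have h3 : (0 : ℝ) ≤ (1 / (q : ℝ)) ^ G := by positivity
  have : (0 : ℝ) < t i := by nlinarith
  exact_mod_cast this

lemma mul_orbit_le (hq : 2 ≤ q) (hα : 0 < α) (hε : 0 ≤ ε)
    (hi : |(t i : ℝ) - α * ∑ j ∈ Finset.range h, (r (i + j) : ℝ) * (1 / (q : ℝ)) ^ (j + 1)| ≤ ε) :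
    (q : ℝ) * t i ≤ α * ((∑ j ∈ Finset.range h, (1 / 2 : ℝ) ^ j * r (i + j)) + q * ε) := by
  have hq2 : (2 : ℝ) ≤ q := by exact_mod_cast hq
  have hα1 : (1 : ℝ) ≤ α := by exact_mod_cast hα
  have h1 : (q : ℝ) * ∑ j ∈ Finset.range h, (r (i + j) : ℝ) * (1 / (q : ℝ)) ^ (j + 1) ≤
      ∑ j ∈ Finset.range h, (1 / 2 : ℝ) ^ j * r (i + j) := by
    rw [Finset.mul_sum]
    refine Finset.sum_le_sum fun j _ => ?_
    have e : (q : ℝ) * ((r (i + j) : ℝ) * (1 / (q : ℝ)) ^ (j + 1)) =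
        (1 / (q : ℝ)) ^ j * r (i + j) := by
      rw [pow_succ]
      field_simp
    rw [e]
    gcongr
  have h2 := (abs_le.1 hi).2
  have h3 : (0 : ℝ) ≤ q * ε := by positivity
  nlinarith

lemma orbit_eq_of_pattern {n : ℕ} {B : ℝ} (hq : 2 ≤ q) (hα : 0 < α)
    (hαq : (α : ℝ) ≤ (q : ℝ) ^ n)
    (hi : |(t i : ℝ) - α * ∑ j ∈ Finset.range h, (r (i + j) : ℝ) * (1 / (q : ℝ)) ^ (j + 1)| ≤ ε)
    (hi' : |(t i' : ℝ) - α * ∑ j ∈ Finset.range h,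
      (r (i' + j) : ℝ) * (1 / (q : ℝ)) ^ (j + 1)| ≤ ε)
    (hB : ∑ j ∈ Finset.range h, headWeight n j * r (i + j) ≤ B)
    (hB' : ∑ j ∈ Finset.range h, headWeight n j * r (i' + j) ≤ B)
    (hp : ∀ j < 2 * n, r (i + j) = r (i' + j)) (hlt : 2 * ε + (1 / 2) ^ n * (2 * B) < 1) :
    t i = t i' := by
  have hq2 : (2 : ℝ) ≤ q := by exact_mod_cast hq
  have hα1 : (0 : ℝ) < α := by exact_mod_cast hα
  have key : |α * ∑ j ∈ Finset.range h, (r (i + j) : ℝ) * (1 / (q : ℝ)) ^ (j + 1) -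
      α * ∑ j ∈ Finset.range h, (r (i' + j) : ℝ) * (1 / (q : ℝ)) ^ (j + 1)| ≤
      (1 / 2) ^ n * (2 * B) := by
    rw [← mul_sub, ← Finset.sum_sub_distrib, abs_mul, abs_of_pos hα1]
    calc (α : ℝ) * |∑ j ∈ Finset.range h, ((r (i + j) : ℝ) * (1 / (q : ℝ)) ^ (j + 1) -
          (r (i' + j) : ℝ) * (1 / (q : ℝ)) ^ (j + 1))|
        ≤ α * ∑ j ∈ Finset.range h, |(r (i + j) : ℝ) * (1 / (q : ℝ)) ^ (j + 1) -
          (r (i' + j) : ℝ) * (1 / (q : ℝ)) ^ (j + 1)| :=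
          mul_le_mul_of_nonneg_left (Finset.abs_sum_le_sum_abs _ _) hα1.le
      _ ≤ ∑ j ∈ Finset.range h, (1 / 2) ^ n *
          (headWeight n j * r (i + j) + headWeight n j * r (i' + j)) := by
          rw [Finset.mul_sum]
          refine Finset.sum_le_sum fun j _ => ?_
          rw [← sub_mul, abs_mul, abs_of_nonneg (by positivity : (0 : ℝ) ≤ (1 / (q : ℝ)) ^ (j + 1))]
          have hw := headWeight_nonneg n j
          by_cases hj : j < 2 * n
          · rw [hp j hj]
            simp only [sub_self, abs_zero, zero_mul, mul_zero]
            positivity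
          · have e1 : |(r (i + j) : ℝ) - r (i' + j)| ≤ r (i + j) + r (i' + j) := by
              rw [abs_le]
              have := Nat.cast_nonneg (α := ℝ) (r (i + j))
              have := Nat.cast_nonneg (α := ℝ) (r (i' + j))
              constructor <;> linarith
            have e2 : (α : ℝ) * (1 / (q : ℝ)) ^ (j + 1) ≤ (1 / 2) ^ n * headWeight n j := by
              rw [headWeight, if_neg hj]
              calc (α : ℝ) * (1 / (q : ℝ)) ^ (j + 1) ≤ (q : ℝ) ^ n * (1 / (q : ℝ)) ^ (j + 1) := by
                    gcongr
                _ = (1 / (q : ℝ)) ^ (n + (j + 1 - 2 * n)) := by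
                    rw [show j + 1 = n + (n + (j + 1 - 2 * n)) by omega, pow_add _ n (n + _),
                      ← mul_assoc, ← mul_pow, mul_one_div_cancel (by linarith), one_pow, one_mul]
                    congr 1
                    omega
                _ ≤ (1 / 2) ^ (n + (j + 1 - 2 * n)) := by gcongr
                _ = _ := pow_add _ _ _
            calc (α : ℝ) * (|(r (i + j) : ℝ) - r (i' + j)| * (1 / (q : ℝ)) ^ (j + 1))
                = |(r (i + j) : ℝ) - r (i' + j)| * (α * (1 / (q : ℝ)) ^ (j + 1)) := by ring
              _ ≤ ((r (i + j) : ℝ) + r (i' + j)) * ((1 / 2) ^ n * headWeight n j) := by gcongr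
              _ = _ := by ring
      _ ≤ (1 / 2) ^ n * (2 * B) := by
          rw [← Finset.mul_sum, Finset.sum_add_distrib]
          gcongr
          linarith
  have : |(t i : ℝ) - t i'| < 1 := by
    rw [abs_le] at hi hi' key
    rw [abs_lt]
    constructor <;> linarith [hi.1, hi.2, hi'.1, hi'.2, key.1, key.2]
  have h4 : |t i - t i'| < 1 := by exact_mod_cast this
  have := Int.abs_lt_one_iff.1 h4
  omega

/-- Tuples of natural numbers whose sum is at most `m`. -/
def boundedTuples (k m : ℕ) : Finset (Fin k → ℕ) :=
  (Fintype.piFinset fun _ => Finset.range (m + 1)).filter fun p => ∑ j, p j ≤ m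

lemma mem_boundedTuples {k m : ℕ} {p : Fin k → ℕ} : p ∈ boundedTuples k m ↔ ∑ j, p j ≤ m := by
  simp only [boundedTuples, Finset.mem_filter, Fintype.mem_piFinset, Finset.mem_range,
    and_iff_right_iff_imp]
  intro h j
  have := Finset.single_le_sum (fun j _ => Nat.zero_le (p j)) (Finset.mem_univ j)
  omega

lemma card_boundedTuples_le (k m : ℕ) : (boundedTuples k m).card ≤ 2 ^ (k + m) := by
  have h1 : ((boundedTuples k m).card : ℝ) * (1 / 2) ^ m ≤ 2 ^ k := by
    calc ((boundedTuples k m).card : ℝ) * (1 / 2) ^ m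
        = ∑ p ∈ boundedTuples k m, (1 / 2 : ℝ) ^ m := by simp
      _ ≤ ∑ p ∈ boundedTuples k m, ∏ j, (1 / 2 : ℝ) ^ p j := by
          refine Finset.sum_le_sum fun p hp => ?_
          rw [Finset.prod_pow_eq_pow_sum]
          exact pow_le_pow_of_le_one (by norm_num) (by norm_num) (mem_boundedTuples.1 hp)
      _ ≤ ∑ p ∈ Fintype.piFinset fun _ : Fin k => Finset.range (m + 1),
            ∏ j, (1 / 2 : ℝ) ^ p j :=
          Finset.sum_le_sum_of_subset_of_nonneg (Finset.filter_subset _ _)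
            fun p _ _ => by positivity
      _ = ∏ _j : Fin k, ∑ v ∈ Finset.range (m + 1), (1 / 2 : ℝ) ^ v :=
          (Finset.prod_univ_sum _ _).symm
      _ ≤ ∏ _j : Fin k, (2 : ℝ) :=
          Finset.prod_le_prod (fun _ _ => by positivity) fun _ _ => sum_half_pow_le _
      _ = 2 ^ k := by simp
  have h2 : ((boundedTuples k m).card : ℝ) ≤ 2 ^ (k + m) := by
    rw [pow_add]
    have : (1 / 2 : ℝ) ^ m * 2 ^ m = 1 := by rw [← mul_pow]; norm_num
    have h0 : (0 : ℝ) < 2 ^ m := by positivity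
    calc ((boundedTuples k m).card : ℝ) = ((boundedTuples k m).card : ℝ) * (1 / 2) ^ m * 2 ^ m := by
          rw [mul_assoc, this, mul_one]
      _ ≤ _ := by gcongr
  exact_mod_cast h2

end BlockDynamics

section BlockContradiction

lemma exists_equal_patterns {n h : ℕ} {r : ℕ → ℕ} (hn : 0 < n) (hnh : 2 * n ≤ h)
    (hP : 2 ^ (1002 * n + 2) < h)
    (hH : ∑ i ∈ Finset.range h, ∑ j ∈ Finset.range h, headWeight n j * r (i + j) ≤ 384 * n * h) :
    ∃ i e, 0 < e ∧ e ≤ 2 ^ (1002 * n + 2) ∧ i + e < h ∧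
      ∑ j ∈ Finset.range h, headWeight n j * r (i + j) ≤ 1000 * n ∧
      ∑ j ∈ Finset.range h, headWeight n j * r (i + e + j) ≤ 1000 * n ∧
      ∀ j < 2 * n, r (i + j) = r (i + e + j) := by
  classical
  have hnr : (0 : ℝ) < n := by exact_mod_cast hn
  set H : ℕ → ℝ := fun i => ∑ j ∈ Finset.range h, headWeight n j * r (i + j) with hHdef
  have H0 : ∀ i, 0 ≤ H i := fun i =>
    Finset.sum_nonneg fun j _ => mul_nonneg (headWeight_nonneg n j) (Nat.cast_nonneg _)
  set good := (Finset.range h).filter fun i => H i ≤ 1000 * n with hgood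
  set bad := (Finset.range h).filter fun i => ¬ H i ≤ 1000 * n with hbad
  have hsplit : good.card + bad.card = h := by
    rw [Finset.card_filter_add_card_filter_not, Finset.card_range]
  have hb : (bad.card : ℝ) * (1000 * n) ≤ 384 * n * h := by
    calc (bad.card : ℝ) * (1000 * n) = ∑ _i ∈ bad, (1000 * n : ℝ) := by simp
      _ ≤ ∑ i ∈ bad, H i := Finset.sum_le_sum fun i hi => (not_le.1 (Finset.mem_filter.1 hi).2).le
      _ ≤ ∑ i ∈ Finset.range h, H i :=
        Finset.sum_le_sum_of_subset_of_nonneg (Finset.filter_subset _ _) fun i _ _ => H0 i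
      _ ≤ _ := hH
  have hb2 : 2 * bad.card ≤ h := by
    have : 2 * (bad.card : ℝ) ≤ h := by
      have : (n : ℝ) * (1000 * bad.card) ≤ n * (384 * h) := by linarith
      have := le_of_mul_le_mul_left this hnr
      have : (0 : ℝ) ≤ h := Nat.cast_nonneg _
      linarith
    exact_mod_cast this
  set P := 2 ^ (1002 * n) with hPdef
  have hE : 2 ^ (1002 * n + 2) = 4 * P := by rw [pow_add]; ring
  rw [hE] at hP ⊢
  have hP0 : 0 < P := by positivity
  have hcard : (boundedTuples (2 * n) (1000 * n)).card ≤ P := by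
    refine (card_boundedTuples_le _ _).trans_eq ?_
    rw [hPdef, ← add_mul]
  have hlt : (boundedTuples (2 * n) (1000 * n) ×ˢ Finset.range (h / (4 * P) + 1)).card <
      good.card := by
    rw [Finset.card_product, Finset.card_range]
    have h1 : (boundedTuples (2 * n) (1000 * n)).card * (h / (4 * P) + 1) ≤
        P * (h / (4 * P) + 1) := Nat.mul_le_mul_right _ hcard
    have h2 : 4 * P * (h / (4 * P)) ≤ h := Nat.mul_div_le _ _
    have h3 : 4 * (P * (h / (4 * P) + 1)) = 4 * P * (h / (4 * P)) + 4 * P := by ring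
    omega
  obtain ⟨i, hi, i', hi', hne, heq⟩ := Finset.exists_ne_map_eq_of_card_lt_of_maps_to hlt
    (f := fun i => ((fun j : Fin (2 * n) => r (i + j)), i / (4 * P))) (by
      intro i hi
      obtain ⟨hi1, hi2⟩ := Finset.mem_filter.1 hi
      rw [Finset.mem_coe, Finset.mem_product, mem_boundedTuples, Finset.mem_range]
      constructor
      · have : ((∑ j : Fin (2 * n), r (i + j) : ℕ) : ℝ) ≤ 1000 * n := by
          refine le_trans ?_ hi2
          rw [Fin.sum_univ_eq_sum_range (fun j => r (i + j)) (2 * n)]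
          push_cast
          calc ∑ j ∈ Finset.range (2 * n), (r (i + j) : ℝ)
              = ∑ j ∈ Finset.range (2 * n), headWeight n j * r (i + j) :=
                Finset.sum_congr rfl fun j hj => by
                  rw [headWeight, if_pos (Finset.mem_range.1 hj), one_mul]
            _ ≤ _ := Finset.sum_le_sum_of_subset_of_nonneg (Finset.range_mono hnh)
                fun j _ _ => mul_nonneg (headWeight_nonneg n j) (Nat.cast_nonneg _)
        exact_mod_cast this
      · exact Nat.lt_succ_of_le (Nat.div_le_div_right (Finset.mem_range.1 hi1).le))
  wlog hii : i < i' generalizing i i'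
  · exact this i' hi' i hi hne.symm heq.symm (by omega)
  obtain ⟨hi1, hi2⟩ := Finset.mem_filter.1 hi
  obtain ⟨hi1', hi2'⟩ := Finset.mem_filter.1 hi'
  rw [Finset.mem_range] at hi1 hi1'
  simp only [Prod.mk.injEq] at heq
  obtain ⟨hpat, hdiv⟩ := heq
  obtain ⟨e, rfl⟩ := Nat.exists_eq_add_of_lt hii
  rw [add_assoc] at *
  refine ⟨i, e + 1, by omega, ?_, hi1', hi2, by simpa only [hHdef, add_assoc] using hi2', ?_⟩
  · have h1 := Nat.div_add_mod i (4 * P)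
    have h2 := Nat.div_add_mod (i + (e + 1)) (4 * P)
    have h3 := Nat.mod_lt (i + (e + 1)) (by omega : 0 < 4 * P)
    rw [← hdiv] at h2
    omega
  · intro j hj
    have := congrFun hpat ⟨j, hj⟩
    simpa [add_assoc] using this

lemma orbit_modEq {q : ℕ} {t : ℕ → ℤ} {r : ℕ → ℕ} {α : ℤ} {W : ℕ}
    (hrec : ∀ i, i + 1 < W → t (i + 1) = q * t i - α * r i) (i k : ℕ) (hk : i + k < W) :
    t (i + k) ≡ q ^ k * t i [ZMOD α] := by
  induction k with
  | zero => simp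
  | succ k ih =>
    rw [← add_assoc, hrec (i + k) (by omega)]
    have h1 := (ih (by omega)).mul_left (q : ℤ)
    have h2 : (q : ℤ) * t (i + k) - α * r (i + k) ≡ q * t (i + k) [ZMOD α] := by
      rw [Int.modEq_iff_dvd]
      exact ⟨r (i + k), by ring⟩
    rw [show (q : ℤ) * (q ^ k * t i) = q ^ (k + 1) * t i by ring] at h1
    exact h2.trans h1

lemma exists_shift_large {q n e h W i₁ : ℕ} {t : ℕ → ℤ} {r : ℕ → ℕ} {α : ℤ} (hq : 2 ≤ q)
    (hα : 0 < α) (hαq : α ≤ (q : ℤ) ^ n)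
    (hrec : ∀ i, i + 1 < W → t (i + 1) = q * t i - α * r i) (hW : 2 * h ≤ W)
    (hpos : ∀ i < 2 * h, 0 < t i) (he : i₁ + e < W) (heq : t i₁ = t (i₁ + e)) (k : ℕ) :
    ∃ i ≤ n, ∀ k', k' ≡ k + i [MOD e] → i₁ + k' < 2 * h → α ≤ q * t (i₁ + k') := by
  have hq2 : (2 : ℤ) ≤ q := by exact_mod_cast hq
  set ψ : ℕ → ℤ := fun k => (q ^ k * t i₁) % α with hψ
  have hper : ∀ k, ψ (k + e) = ψ k := by
    intro k
    have h1 := orbit_modEq hrec i₁ e he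
    rw [← heq] at h1
    have h2 := (h1.mul_left ((q : ℤ) ^ k)).symm
    rw [← mul_assoc, ← pow_add] at h2
    exact h2
  have hcongr : ∀ {k k' : ℕ}, k' ≡ k [MOD e] → ψ k' = ψ k := by
    intro k k' hk
    have hp : Function.Periodic ψ e := hper
    rw [← hp.map_mod_nat k, ← hp.map_mod_nat k', hk]
  have hle : ∀ k', i₁ + k' < 2 * h → ψ k' ≤ t (i₁ + k') := by
    intro k' hk'
    have h1 : t (i₁ + k') % α = ψ k' := orbit_modEq hrec i₁ k' (by omega)
    have h2 := Int.mul_ediv_add_emod (t (i₁ + k')) α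
    have h3 := Int.ediv_nonneg (hpos _ hk').le hα.le
    rw [← h1]
    nlinarith
  have hψ0 : ∀ k, 0 ≤ ψ k := fun k => Int.emod_nonneg _ hα.ne'
  rcases (hψ0 k).eq_or_lt with h0 | h0
  · refine ⟨0, Nat.zero_le n, fun k' hk' hlt => ?_⟩
    have h1 : t (i₁ + k') % α = ψ k' := orbit_modEq hrec i₁ k' (by omega)
    rw [hcongr hk', add_zero, ← h0] at h1
    have h2 := Int.le_of_dvd (hpos _ hlt) (Int.dvd_of_emod_eq_zero h1)
    have h3 := hpos _ hlt
    nlinarith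
  · by_contra! hcon
    have hsmall : ∀ i ≤ n, (q : ℤ) * ψ (k + i) < α := by
      intro i hi
      obtain ⟨k', hk', hlt, hk⟩ := hcon i hi
      have h1 := hle k' hlt
      rw [hcongr hk'] at h1
      nlinarith
    have hpow : ∀ i ≤ n, ψ (k + i) = q ^ i * ψ k := by
      intro i
      induction i with
      | zero => intro _; simp
      | succ i ih =>
        intro hi
        have h1 := ih (by omega)
        have h2 := hsmall i (by omega)
        have h3 : ψ (k + (i + 1)) = (q * ψ (k + i)) % α := by
          simp only [hψ]
          have := (Int.mod_modEq ((q : ℤ) ^ (k + i) * t i₁) α).mul_left (q : ℤ)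
          rw [show (q : ℤ) * (q ^ (k + i) * t i₁) = q ^ (k + (i + 1)) * t i₁ by ring] at this
          exact this.symm
        rw [h3, Int.emod_eq_of_lt (by have := hψ0 (k + i); positivity) h2, h1]
        ring
    have h1 := hsmall n le_rfl
    rw [hpow n le_rfl] at h1
    have h2 : (0 : ℤ) < (q : ℤ) ^ n := by positivity
    have h3 : (q : ℤ) ^ n ≤ q ^ n * ψ k := le_mul_of_one_le_right h2.le h0
    nlinarith

lemma le_card_filter_modEq {M : ℕ} (hM : 0 < M) (a b L : ℕ) :
    L ≤ ((Finset.range (L * M)).filter fun k => a + k ≡ b [MOD M]).card := by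
  obtain ⟨v, hv, hvb⟩ : ∃ v < M, a + v ≡ b [MOD M] := by
    refine ⟨(b + (M - 1) * a) % M, Nat.mod_lt _ hM, ?_⟩
    refine ((Nat.mod_modEq (b + (M - 1) * a) M).add_left a).trans ?_
    have e : a + (b + (M - 1) * a) = b + M * a := by
      obtain ⟨M, rfl⟩ : ∃ M', M = M' + 1 := ⟨M - 1, by omega⟩
      simp only [Nat.add_sub_cancel]
      ring
    rw [e]
    simp [Nat.ModEq]
  calc L = (Finset.range L).card := (Finset.card_range L).symm
    _ ≤ _ := Finset.card_le_card_of_injOn (fun u => v + M * u) ?_ ?_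
  · intro u hu
    have hu := Finset.mem_range.1 hu
    simp only [Finset.coe_filter, Set.mem_ofPred_eq, Finset.mem_range]
    constructor
    · have : M * (u + 1) ≤ M * L := Nat.mul_le_mul_left _ hu
      rw [mul_comm L M]
      linarith
    · rw [← add_assoc]
      refine Nat.ModEq.trans ?_ hvb
      simp [Nat.ModEq]
  · intro u _ u' _ h
    simpa [hM.ne'] using h

end BlockContradiction

section BlockContradiction

lemma exists_nat_congruence {M e : ℕ} (hM : 0 < M) (he : 0 < e) (h : M.Coprime e) :
    ∃ w, w ≤ e * M ∧ w ≡ 1 [MOD e] ∧ w ≡ 0 [MOD M] := by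
  obtain ⟨v, hv1, hv2⟩ := Nat.chineseRemainder h 0 1
  refine ⟨v % (e * M), (Nat.mod_lt _ (by positivity)).le, ?_, ?_⟩
  · exact (Nat.ModEq.of_mul_right M (Nat.mod_modEq v (e * M))).trans hv2
  · exact (Nat.ModEq.of_mul_left e (Nat.mod_modEq v (e * M))).trans hv1

lemma card_mul_le_sum {n h e i₁ a b M L w : ℕ} {F : ℕ → ℝ} {α : ℝ}
    (hF : ∀ N < 2 * h, 0 ≤ F N) (hwe : w ≡ 1 [MOD e]) (hwM : w ≡ 0 [MOD M])
    (hL : i₁ + L * M + n * w ≤ 2 * h)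
    (hshift : ∀ k, ∃ i ≤ n, ∀ k', k' ≡ k + i [MOD e] → i₁ + k' < 2 * h → α ≤ F (i₁ + k'))
    (hα : 0 ≤ α) (hM : 0 < M) :
    L * α ≤ (n + 1) *
      ∑ N ∈ (Finset.range (2 * h)).filter (fun N => a + N ≡ b [MOD M]), F N := by
  choose ι hι1 hι2 using hshift
  set I := (Finset.range (L * M)).filter fun k => (a + i₁) + k ≡ b [MOD M] with hI
  set D := (Finset.range (2 * h)).filter fun N => a + N ≡ b [MOD M] with hD
  have hbound : ∀ k ∈ I, ∀ i ≤ n, i₁ + (k + i * w) < 2 * h := by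
    intro k hk i hi
    have h1 := Finset.mem_range.1 (Finset.mem_filter.1 hk).1
    have h2 : i * w ≤ n * w := Nat.mul_le_mul_right w hi
    omega
  have hmem : ∀ k ∈ I, ∀ i ≤ n, i₁ + (k + i * w) ∈ D := by
    intro k hk i hi
    refine Finset.mem_filter.2 ⟨Finset.mem_range.2 (hbound k hk i hi), ?_⟩
    have h1 := (Finset.mem_filter.1 hk).2
    have h2 := (hwM.mul_left i).add_left (a + i₁ + k)
    rw [mul_zero, add_zero] at h2
    have h3 := h2.trans h1
    rwa [show a + i₁ + k + i * w = a + (i₁ + (k + i * w)) by ring] at h3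
  have hlarge : ∀ k ∈ I, α ≤ F (i₁ + (k + ι k * w)) := by
    intro k hk
    refine hι2 k _ ?_ (hbound k hk _ (hι1 k))
    simpa using (hwe.mul_left (ι k)).add_left k
  calc (L : ℝ) * α ≤ I.card * α :=
        mul_le_mul_of_nonneg_right (by exact_mod_cast le_card_filter_modEq hM (a + i₁) b L) hα
    _ = ∑ _k ∈ I, α := by simp
    _ ≤ ∑ k ∈ I, ∑ i ∈ Finset.range (n + 1), F (i₁ + (k + i * w)) := by
        refine Finset.sum_le_sum fun k hk => (hlarge k hk).trans ?_
        exact Finset.single_le_sum (f := fun i => F (i₁ + (k + i * w)))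
          (fun i hi => hF _ (hbound k hk i (Nat.lt_succ_iff.1 (Finset.mem_range.1 hi))))
          (Finset.mem_range.2 (Nat.lt_succ_of_le (hι1 k)))
    _ = ∑ i ∈ Finset.range (n + 1), ∑ k ∈ I, F (i₁ + (k + i * w)) := Finset.sum_comm
    _ ≤ ∑ _i ∈ Finset.range (n + 1), ∑ N ∈ D, F N := by
        refine Finset.sum_le_sum fun i hi => ?_
        have hi : i ≤ n := Nat.lt_succ_iff.1 (Finset.mem_range.1 hi)
        rw [← Finset.sum_image (f := F) (g := fun k => i₁ + (k + i * w))
          (fun k _ k' _ h => by simpa using h)]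
        refine Finset.sum_le_sum_of_subset_of_nonneg ?_ fun N hN _ =>
          hF N (Finset.mem_range.1 (Finset.mem_filter.1 hN).1)
        intro N hN
        obtain ⟨k, hk, rfl⟩ := Finset.mem_image.1 hN
        exact hmem k hk i hi
    _ = _ := by simp

theorem block_contradiction {q n h s G : ℕ} {t : ℕ → ℤ} {r : ℕ → ℕ} {α : ℤ} {ε A : ℝ}
    (hq : 2 ≤ q) (hn : 0 < n) (hα : 0 < α) (hαq : α ≤ (q : ℤ) ^ n)
    (hrec : ∀ i, i + 1 < 4 * h → t (i + 1) = q * t i - α * r i) (hε0 : 0 ≤ ε)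
    (hexp : ∀ i < 2 * h, |(t i : ℝ) - α * ∑ j ∈ Finset.range h,
      (r (i + j) : ℝ) * (1 / (q : ℝ)) ^ (j + 1)| ≤ ε)
    (hG : G ≤ h) (hgap : ∀ i < 2 * h, ∃ j < G, 0 < r (i + j)) (hε : ε < (1 / (q : ℝ)) ^ G)
    (hH : ∑ i ∈ Finset.range h, ∑ j ∈ Finset.range h, headWeight n j * r (i + j) ≤ 384 * n * h)
    (hsmall : 2 * ε + (1 / 2) ^ n * (2 * (1000 * n)) < 1)
    (hs : 0 < s) (hh : 2 * (n * (2 ^ (1004 * n) * s)) ≤ h)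
    (hcls : ∀ e, 0 < e → e ≤ 2 ^ (1004 * n) → ∃ M a b, 0 < M ∧ M ≤ s ∧ M.Coprime e ∧
      M * ∑ N ∈ (Finset.range (2 * h)).filter (fun N => a + N ≡ b [MOD M]),
        ∑ j ∈ Finset.range h, (1 / 2 : ℝ) ^ j * r (N + j) ≤ A)
    (hA : (n + 1) * (A + 2 * h * s * (q * ε)) < h / 4) : False := by
  have hpow : 2 ^ (1002 * n + 2) ≤ 2 ^ (1004 * n) := Nat.pow_le_pow_right (by norm_num) (by omega)
  have hbig : 2 * 2 ^ (1004 * n) ≤ h := by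
    refine le_trans ?_ hh
    have : 2 ^ (1004 * n) ≤ n * (2 ^ (1004 * n) * s) := by
      have := Nat.mul_le_mul hn (Nat.mul_le_mul_left (2 ^ (1004 * n)) hs)
      linarith
    omega
  have hp0 : 0 < 2 ^ (1004 * n) := by positivity
  have hnp : n ≤ 2 ^ (1004 * n) := by
    have h1 : 1004 * n < 2 ^ (1004 * n) := Nat.lt_two_pow_self
    omega
  have h4s : 4 * s ≤ h := by
    refine le_trans ?_ hh
    have h1 : 2 ≤ 2 ^ (1004 * n) := by
      calc 2 = 2 ^ 1 := rfl
        _ ≤ 2 ^ (1004 * n) := Nat.pow_le_pow_right (by norm_num) (by omega)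
    have := Nat.mul_le_mul hn (Nat.mul_le_mul_right s h1)
    omega
  obtain ⟨i₁, e, he0, he, hie, hg1, hg2, hpat⟩ :=
    exists_equal_patterns hn (by omega) (by omega) hH
  have heq : t i₁ = t (i₁ + e) :=
    orbit_eq_of_pattern hq hα (by exact_mod_cast hαq) (hexp i₁ (by omega))
      (hexp (i₁ + e) (by omega)) hg1 hg2 hpat hsmall
  have hpos : ∀ i < 2 * h, 0 < t i := fun i hi =>
    orbit_pos hq hα (hexp i hi) hG (hgap i hi) hε
  obtain ⟨M, a, b, hM0, hMs, hMe, hsum⟩ := hcls e he0 (he.trans hpow)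
  obtain ⟨w, hw, hwe, hwM⟩ := exists_nat_congruence hM0 he0 hMe
  have hLM : h / (2 * M) * M ≤ h / 2 := by
    have := Nat.div_mul_le_self h (2 * M)
    rw [show h / (2 * M) * (2 * M) = 2 * (h / (2 * M) * M) by ring] at this
    omega
  have hnw : 2 * (n * w) ≤ h := by
    refine le_trans ?_ hh
    gcongr
    exact hw.trans (Nat.mul_le_mul (he.trans hpow) hMs)
  have hαr : (0 : ℝ) < α := by exact_mod_cast hα
  have hM0r : (0 : ℝ) < M := by exact_mod_cast hM0
  have hmain := card_mul_le_sum (F := fun N => (q : ℝ) * t N) (α := (α : ℝ)) (a := a) (b := b)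
    (L := h / (2 * M)) (i₁ := i₁) (h := h) (n := n)
    (fun N hN => by
      have : (0 : ℝ) < t N := by exact_mod_cast hpos N hN
      positivity) hwe hwM (by omega)
    (fun k => by
      obtain ⟨i, hi, hk⟩ := exists_shift_large hq hα hαq hrec (by omega) hpos (by omega) heq k
      exact ⟨i, hi, fun k' h1 h2 => by exact_mod_cast hk k' h1 h2⟩) hαr.le hM0
  have hsum2 : ∑ N ∈ (Finset.range (2 * h)).filter (fun N => a + N ≡ b [MOD M]), (q : ℝ) * t N ≤
      α * (A / M + 2 * h * (q * ε)) := by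
    calc _ ≤ ∑ N ∈ (Finset.range (2 * h)).filter (fun N => a + N ≡ b [MOD M]),
          α * ((∑ j ∈ Finset.range h, (1 / 2 : ℝ) ^ j * r (N + j)) + q * ε) :=
          Finset.sum_le_sum fun N hN => mul_orbit_le hq hα hε0
            (hexp N (Finset.mem_range.1 (Finset.mem_filter.1 hN).1))
      _ ≤ _ := by
          rw [← Finset.mul_sum, Finset.sum_add_distrib, Finset.sum_const, nsmul_eq_mul]
          refine mul_le_mul_of_nonneg_left (add_le_add ?_ ?_) hαr.le
          · rw [le_div_iff₀ hM0r, mul_comm]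
            exact hsum
          · refine mul_le_mul_of_nonneg_right ?_ (by positivity)
            have := Finset.card_filter_le (Finset.range (2 * h)) fun N => a + N ≡ b [MOD M]
            rw [Finset.card_range] at this
            exact_mod_cast this
  have hL : (h : ℝ) / (4 * M) ≤ (h / (2 * M) : ℕ) := by
    have h1 : h < (h / (2 * M) + 1) * (2 * M) := by
      rw [mul_comm]
      exact Nat.lt_mul_div_succ h (by omega)
    have h2 : (h : ℝ) ≤ ((h / (2 * M) : ℕ) + 1) * (2 * M) := by exact_mod_cast h1.le
    have h3 : (4 * M : ℝ) ≤ h := by exact_mod_cast (by omega : 4 * M ≤ h)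
    rw [div_le_iff₀ (by positivity)]
    linarith
  have h5 : (h : ℝ) / (4 * M) * α ≤ (n + 1) * (α * (A / M + 2 * h * (q * ε))) := by
    refine (mul_le_mul_of_nonneg_right hL hαr.le).trans (hmain.trans ?_)
    gcongr
  have h6 : (h : ℝ) / (4 * M) ≤ (n + 1) * (A / M + 2 * h * (q * ε)) := by
    refine le_of_mul_le_mul_right (h5.trans_eq ?_) hαr
    ring
  have h7 : (h : ℝ) / 4 ≤ (n + 1) * (A + 2 * h * M * (q * ε)) := by
    have e1 : (h : ℝ) / 4 = h / (4 * M) * M := by field_simp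
    have e2 : ((n : ℝ) + 1) * (A + 2 * h * M * (q * ε)) =
        (n + 1) * (A / M + 2 * h * (q * ε)) * M := by field_simp
    rw [e1, e2]
    gcongr
  have hMsr : (M : ℝ) ≤ s := by exact_mod_cast hMs
  have h8 : ((n : ℝ) + 1) * (A + 2 * h * M * (q * ε)) ≤ (n + 1) * (A + 2 * h * s * (q * ε)) := by
    gcongr
  linarith

end BlockContradiction

open Filter Topology in
lemma eventually_parameter_bounds : ∀ᶠ n : ℕ in atTop,
    (1 / 2 : ℝ) ^ n * (2 * (1000 * n)) < 1 / 2 ∧ 10000 ≤ n := by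
  have h := tendsto_self_mul_const_pow_of_lt_one (r := (1 / 2 : ℝ)) (by norm_num) (by norm_num)
  have h1 := h.eventually (gt_mem_nhds (by norm_num : (0 : ℝ) < 1 / 4000))
  filter_upwards [h1, eventually_ge_atTop 10000] with n hn hn2
  exact ⟨by linarith, hn2⟩

lemma mul_error_lt {q n s : ℕ} (hq : 2 ≤ q) (hs : s = 2 ^ n ^ 2) :
    (1 / (q : ℝ)) ^ (250000 * s ^ 8) * (41 * (q : ℝ) ^ n * (2 * 10 ^ 6 * (s : ℝ) ^ 27) ^ 2) *
      (q * (s : ℝ) ^ 2) < (1 / (q : ℝ)) ^ (1000 * s ^ 8) := by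
  have hq2 : (2 : ℝ) ≤ q := by exact_mod_cast hq
  have hq0 : (0 : ℝ) < q := by linarith
  have hns : n ^ 2 < s := by
    rw [hs]
    exact Nat.lt_two_pow_self
  have hexp : 56 * n ^ 2 + 48 + (n + 1) + 1000 * s ^ 8 < 250000 * s ^ 8 := by
    have h1 : s ≤ s ^ 8 := Nat.le_self_pow (by norm_num) s
    have h2 : n ≤ n ^ 2 := Nat.le_self_pow (by norm_num) n
    omega
  have h1 : (41 * (q : ℝ) ^ n * (2 * 10 ^ 6 * (s : ℝ) ^ 27) ^ 2) * (q * (s : ℝ) ^ 2) ≤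
      (q : ℝ) ^ (56 * n ^ 2 + 48 + (n + 1)) := by
    have e1 : (41 * (q : ℝ) ^ n * (2 * 10 ^ 6 * (s : ℝ) ^ 27) ^ 2) * (q * (s : ℝ) ^ 2) =
        (s : ℝ) ^ 56 * 164000000000000 * (q : ℝ) ^ (n + 1) := by ring
    rw [e1, pow_add (q : ℝ) _ (n + 1), pow_add (q : ℝ) _ 48]
    gcongr
    · calc (s : ℝ) ^ 56 = 2 ^ (56 * n ^ 2) := by
            rw [hs]
            push_cast
            rw [← pow_mul, mul_comm]
        _ ≤ (q : ℝ) ^ (56 * n ^ 2) := by gcongr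
    · calc (164000000000000 : ℝ) ≤ 2 ^ 48 := by norm_num
        _ ≤ (q : ℝ) ^ 48 := by gcongr
  rw [one_div_pow, one_div_pow, mul_assoc, one_div_mul_eq_div, lt_div_iff₀ (by positivity),
    div_mul_eq_mul_div, div_lt_one (by positivity)]
  calc _ ≤ (q : ℝ) ^ (56 * n ^ 2 + 48 + (n + 1)) * (q : ℝ) ^ (1000 * s ^ 8) := by gcongr
    _ = (q : ℝ) ^ (56 * n ^ 2 + 48 + (n + 1) + 1000 * s ^ 8) := (pow_add _ _ _).symm
    _ < _ := pow_lt_pow_right₀ (by linarith) hexp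

open Filter in
theorem eventually_lt_abs_cubic_form_of_pos : ∀ᶠ n : ℕ in atTop, ∀ q : ℕ, 2 ≤ q →
    ∀ α₀ α₁ α₂ α₃ : ℤ, |(α₀ : ℝ)| ≤ (q : ℝ) ^ n → |(α₁ : ℝ)| ≤ (q : ℝ) ^ n →
    |(α₂ : ℝ)| ≤ (q : ℝ) ^ n → |(α₃ : ℝ)| ≤ (q : ℝ) ^ n → 0 < α₃ → ∀ θ : ℝ,
    HasSum (fun m : ℕ => (1 / (q : ℝ)) ^ (m ^ 3)) θ →
    (1 / (q : ℝ)) ^ (10 ^ 6 * (2 ^ n ^ 2) ^ 27) <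
      |(α₀ : ℝ) + α₁ * θ + α₂ * θ ^ 2 + α₃ * θ ^ 3| := by
  filter_upwards [eventually_exists_suppressed 1004, eventually_parameter_bounds]
    with n hsup ⟨hpar, hn⟩ q hq α₀ α₁ α₂ α₃ h0 h1 h2 h3 hα θ hθ
  by_contra! hL
  obtain ⟨M, b, hcop, hM⟩ := hsup
  obtain ⟨s, hs⟩ : ∃ s, s = 2 ^ n ^ 2 := ⟨_, rfl⟩
  rw [← hs] at hL
  obtain ⟨h, hh⟩ : ∃ h, h = 250000 * s ^ 8 := ⟨_, rfl⟩
  obtain ⟨a, haW, hr2, hhead, htail⟩ := exists_block (W := 4 * h) (by omega : 4 ≤ n) hs hh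
    (by rw [hh]; ring) (M := M) (b := b)
    (fun i => ⟨(hM i).1, by rw [hs]; exact (hM i).2.1, (hM i).2.2 h⟩)
  have hq2 : (2 : ℝ) ≤ q := by exact_mod_cast hq
  have hq0 : (0 : ℝ) < q := by linarith
  have hns : n ^ 2 < s := by
    rw [hs]
    exact Nat.lt_two_pow_self
  have hn2 : 10000 * n ≤ n ^ 2 := by
    rw [sq]
    exact Nat.mul_le_mul_right n hn
  have hs0 : 0 < s := by omega
  have hs8 : s ≤ s ^ 8 := Nat.le_self_pow (by norm_num) s
  have hsr : (100000000 : ℝ) ≤ s := by exact_mod_cast (by omega : 100000000 ≤ s)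
  have hnr : (10000 : ℝ) ≤ n := by exact_mod_cast hn
  have hh0 : (0 : ℝ) < h := by exact_mod_cast (by omega : 0 < h)
  have hsum := hasSum_formCoeff hθ α₀ α₁ α₂ α₃
  have hc := abs_formCoeff_le h0 h1 h2 h3
  set c := formCoeff α₀ α₁ α₂ α₃ with hcdef
  set R : ℝ := 41 * (q : ℝ) ^ n * (2 * 10 ^ 6 * (s : ℝ) ^ 27) ^ 2 with hR
  set ε : ℝ := (1 / (q : ℝ)) ^ h * R with hε
  have hεq : ε * (q * (s : ℝ) ^ 2) < (1 / (q : ℝ)) ^ (1000 * s ^ 8) := by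
    have := mul_error_lt (n := n) hq hs
    rwa [← hh] at this
  have hR0 : 0 ≤ R := by positivity
  have hε0 : 0 ≤ ε := by positivity
  have hεq1 : ε * (q * (s : ℝ) ^ 2) < 1 := by
    refine hεq.trans_le (pow_le_one₀ (by positivity) ?_)
    rw [div_le_one hq0]
    linarith
  have hqs : 4 ≤ (q : ℝ) * (s : ℝ) ^ 2 := by nlinarith
  have hT : ∀ i < 4 * h, |(partialInt q c (a + i) : ℝ)| ≤ R := by
    intro i hi
    have hlt : a + i < 10 ^ 6 * s ^ 27 := by omega
    have h1 := abs_partialInt_le (N := a + i) hq hc hsum (by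
      calc (q : ℝ) ^ (a + i) * _ ≤ (q : ℝ) ^ (10 ^ 6 * s ^ 27) *
            (1 / (q : ℝ)) ^ (10 ^ 6 * s ^ 27) := by
            refine mul_le_mul (pow_le_pow_right₀ (by linarith) hlt.le) hL (abs_nonneg _)
              (by positivity)
        _ = 1 := by rw [← mul_pow, mul_one_div_cancel hq0.ne', one_pow])
    refine h1.trans ?_
    rw [hR]
    gcongr
    have h3 : a + i + 2 ≤ 2 * 10 ^ 6 * s ^ 27 := by
      have := Nat.one_le_pow 27 s hs0
      omega
    exact_mod_cast h3
  obtain ⟨t, ht⟩ : ∃ t : ℕ → ℤ, ∀ i, t i = partialInt q c (a + i) := ⟨_, fun _ => rfl⟩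
  obtain ⟨r, hr⟩ : ∃ r : ℕ → ℕ, ∀ i, r i = reprThree (a + i + 1) := ⟨_, fun _ => rfl⟩
  have hrj : ∀ i j, r (i + j) = reprThree (a + i + 1 + j) := fun i j => by
    rw [hr, show a + (i + j) + 1 = a + i + 1 + j by ring]
  have hrec : ∀ i, i + 1 < 4 * h → t (i + 1) = q * t i - α₃ * r i := by
    intro i hi
    rw [ht, ht, hr, ← add_assoc, partialInt_succ, hcdef,
      formCoeff_of_reprTwo_eq_zero (by rw [add_assoc]; exact hr2 (i + 1) hi)]
  have htR : ∀ i < 4 * h, |(t i : ℝ)| ≤ R := fun i hi => by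
    rw [ht]
    exact hT i hi
  refine block_contradiction (q := q) (n := n) (h := h) (s := s) (G := 1000 * s ^ 8)
    (t := t) (r := r) (α := α₃) (ε := ε)
    (A := 256 * ((1004 : ℕ) + 1) * ((4 * h : ℕ) : ℝ) / (n : ℝ) ^ 3)
    hq (by omega) hα ?_ hrec hε0 (fun i hi => abs_orbit_sub_le (by omega) hrec htR (by omega))
    (by omega) ?_ ?_ ?_ ?_ hs0 ?_ ?_ ?_
  · have : (α₃ : ℝ) ≤ (q : ℝ) ^ n := (le_abs_self _).trans h3
    exact_mod_cast this
  · intro i hi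
    obtain ⟨j, hj, hpos⟩ := exists_reprThree_pos (N := a + i) hs0 (by omega)
    exact ⟨j, hj, by rwa [hrj]⟩
  · exact (le_mul_of_one_le_right hε0 (by linarith)).trans_lt hεq
  · calc _ ≤ ∑ i ∈ Finset.range (4 * h), headSum n h (a + i) := by
          refine le_trans (le_of_eq ?_) (Finset.sum_le_sum_of_subset_of_nonneg
            (Finset.range_mono (by omega : h ≤ 4 * h)) fun i _ _ => headSum_nonneg n h (a + i))
          refine Finset.sum_congr rfl fun i _ => Finset.sum_congr rfl fun j _ => ?_
          rw [hrj]
      _ ≤ _ := hhead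
      _ = _ := by push_cast; ring
  · nlinarith
  · have hp : 2 ^ (1004 * n) ≤ s := by
      rw [hs]
      exact Nat.pow_le_pow_right (by norm_num) (by omega)
    calc 2 * (n * (2 ^ (1004 * n) * s)) ≤ 2 * (s * (s * s)) := by
          gcongr
          omega
      _ = 2 * s ^ 3 := by ring
      _ ≤ 250000 * s ^ 8 := by
          have := Nat.pow_le_pow_right hs0 (by norm_num : 3 ≤ 8)
          omega
      _ = h := hh.symm
  · intro e he0 he
    obtain ⟨l, hl⟩ := hcop e he0 he
    refine ⟨M l, a, b l, (hM l).1, by rw [hs]; exact (hM l).2.1, hl, ?_⟩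
    refine le_trans (mul_le_mul_of_nonneg_left ?_ (Nat.cast_nonneg _)) (htail l)
    refine le_trans (le_of_eq ?_) (Finset.sum_le_sum_of_subset_of_nonneg
      (Finset.filter_subset_filter _ (Finset.range_mono (by omega : 2 * h ≤ 4 * h)))
      fun i _ _ => tailSum_nonneg h (a + i))
    refine Finset.sum_congr rfl fun i _ => Finset.sum_congr rfl fun j _ => ?_
    rw [hrj]
  · have hA : ((n : ℝ) + 1) * (256 * ((1004 : ℕ) + 1) * ((4 * h : ℕ) : ℝ) / (n : ℝ) ^ 3) <
        h / 8 := by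
      push_cast
      rw [mul_div_assoc', div_lt_iff₀ (by positivity)]
      have e : ((n : ℝ) + 1) * 8232960 < n ^ 3 := by
        have e0 : (100000000 : ℝ) * n ≤ n ^ 3 := by
          have : (10000 : ℝ) * 10000 ≤ n * n := by gcongr
          nlinarith
        linarith
      nlinarith
    have hB : ((n : ℝ) + 1) * (2 * h * s * (q * ε)) ≤ h / 8 := by
      have e1 : 16 * ((n : ℝ) + 1) ≤ s := by exact_mod_cast (by omega : 16 * (n + 1) ≤ s)
      have e2 : 16 * ((n : ℝ) + 1) * (s * (q * ε)) ≤ 1 := by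
        calc 16 * ((n : ℝ) + 1) * (s * (q * ε)) ≤ s * (s * (q * ε)) := by gcongr
          _ = ε * (q * (s : ℝ) ^ 2) := by ring
          _ ≤ 1 := hεq1.le
      nlinarith
    rw [mul_add]
    linarith

open Filter in
theorem exists_forall_lt_abs_cubic_form : ∃ n₀ : ℕ, ∀ n ≥ n₀, ∀ q : ℕ, 2 ≤ q →
    ∀ α₀ α₁ α₂ α₃ : ℤ, |(α₀ : ℝ)| ≤ (q : ℝ) ^ n → |(α₁ : ℝ)| ≤ (q : ℝ) ^ n →
    |(α₂ : ℝ)| ≤ (q : ℝ) ^ n → |(α₃ : ℝ)| ≤ (q : ℝ) ^ n → α₃ ≠ 0 → ∀ θ : ℝ,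
    HasSum (fun m : ℕ => (1 / (q : ℝ)) ^ (m ^ 3)) θ →
    (1 / (q : ℝ)) ^ (10 ^ 6 * (2 ^ n ^ 2) ^ 27) <
      |(α₀ : ℝ) + α₁ * θ + α₂ * θ ^ 2 + α₃ * θ ^ 3| := by
  obtain ⟨n₀, h⟩ := eventually_atTop.1 eventually_lt_abs_cubic_form_of_pos
  refine ⟨n₀, fun n hn q hq α₀ α₁ α₂ α₃ h0 h1 h2 h3 hα θ hθ => ?_⟩
  rcases hα.lt_or_gt with hneg | hpos
  · have := h n hn q hq (-α₀) (-α₁) (-α₂) (-α₃) (by simpa using h0) (by simpa using h1)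
      (by simpa using h2) (by simpa using h3) (by omega) θ hθ
    rw [← abs_neg]
    convert this using 2
    push_cast
    ring
  · exact h n hn q hq α₀ α₁ α₂ α₃ h0 h1 h2 h3 hpos θ hθ

lemma natCast_le_exp_of_le {n₀ n : ℕ} {A : ℝ} (hA : 1.1 < A) (hn : (n : ℝ) ≤ (n₀ + 2) * A) :
    ((10 ^ 6 * (2 ^ n ^ 2) ^ 27 : ℕ) : ℝ) ≤
      Real.exp ((20 + 27 * ((n₀ : ℝ) + 2) ^ 2) / Real.log 1.1 ^ 2 * A ^ 2 * Real.log A ^ 2) := by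
  have he : (2 : ℝ) ≤ Real.exp 1 := by linarith [Real.add_one_le_exp 1]
  have hl0 : 0 < Real.log 1.1 := Real.log_pos (by norm_num)
  have hl : Real.log 1.1 ≤ Real.log A := Real.log_le_log (by norm_num) hA.le
  have h1 : ((10 ^ 6 * (2 ^ n ^ 2) ^ 27 : ℕ) : ℝ) ≤ Real.exp (20 + 27 * (n : ℝ) ^ 2) := by
    calc ((10 ^ 6 * (2 ^ n ^ 2) ^ 27 : ℕ) : ℝ) ≤ 2 ^ (20 + 27 * n ^ 2) := by
          push_cast
          rw [pow_add, ← pow_mul, mul_comm (n ^ 2) 27]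
          gcongr
          norm_num
      _ ≤ Real.exp 1 ^ (20 + 27 * n ^ 2) := by gcongr
      _ = Real.exp (20 + 27 * (n : ℝ) ^ 2) := by
          rw [← Real.exp_nat_mul]
          push_cast
          rw [mul_one]
  refine h1.trans (Real.exp_le_exp.2 ?_)
  have h2 : (1 : ℝ) ≤ Real.log A ^ 2 / Real.log 1.1 ^ 2 := by
    rw [one_le_div (by positivity)]
    gcongr
  have h3 : (n : ℝ) ^ 2 ≤ (((n₀ : ℝ) + 2) * A) ^ 2 := by gcongr
  have h4 : (1 : ℝ) ≤ A ^ 2 := one_le_pow₀ (by linarith)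
  calc 20 + 27 * (n : ℝ) ^ 2 ≤ (20 + 27 * ((n₀ : ℝ) + 2) ^ 2) * A ^ 2 := by nlinarith
    _ ≤ (20 + 27 * ((n₀ : ℝ) + 2) ^ 2) * A ^ 2 * (Real.log A ^ 2 / Real.log 1.1 ^ 2) :=
        le_mul_of_one_le_right (by positivity) h2
    _ = _ := by ring

/-- Measure of linear independence for `1, θ₃(q), θ₃(q)², θ₃(q)³`. -/
theorem theta3_linear_independence_measure :
    ∃ c₃ : ℝ, 0 < c₃ ∧
      ∀ q : ℕ, 2 ≤ q → ∀ A : ℝ, 1.1 < A →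
        ∀ α₀ α₁ α₂ α₃ : ℤ,
          (|(α₀ : ℝ)| ≤ (q : ℝ) ^ A) → (|(α₁ : ℝ)| ≤ (q : ℝ) ^ A) →
          (|(α₂ : ℝ)| ≤ (q : ℝ) ^ A) → (|(α₃ : ℝ)| ≤ (q : ℝ) ^ A) →
          α₃ ≠ 0 →
          Real.exp (-(Real.log q * Real.exp (c₃ * A ^ 2 * (Real.log A) ^ 2))) <
            |(α₀ : ℝ) + (α₁ : ℝ) * theta3 q + (α₂ : ℝ) * theta3 q ^ 2 +
              (α₃ : ℝ) * theta3 q ^ 3| := by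
  obtain ⟨n₀, hn₀⟩ := exists_forall_lt_abs_cubic_form
  have hl0 : 0 < Real.log 1.1 := Real.log_pos (by norm_num)
  refine ⟨(20 + 27 * ((n₀ : ℝ) + 2) ^ 2) / Real.log 1.1 ^ 2, by positivity, ?_⟩
  intro q hq A hA α₀ α₁ α₂ α₃ h0 h1 h2 h3 hα
  have hq1 : (1 : ℝ) ≤ q := by exact_mod_cast (by omega : 1 ≤ q)
  have hq0 : (0 : ℝ) < q := by linarith
  set n := max n₀ ⌈A⌉₊ with hn
  have hAn : (q : ℝ) ^ A ≤ (q : ℝ) ^ n := by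
    rw [← Real.rpow_natCast]
    refine Real.rpow_le_rpow_of_exponent_le hq1 ((Nat.le_ceil A).trans ?_)
    exact_mod_cast le_max_right _ _
  have hnA : (n : ℝ) ≤ (n₀ + 2) * A := by
    have hc := Nat.ceil_lt_add_one (by linarith : 0 ≤ A)
    have hn0 : (0 : ℝ) ≤ n₀ := Nat.cast_nonneg _
    rw [hn, Nat.cast_max]
    refine max_le ?_ ?_ <;> nlinarith
  refine lt_of_le_of_lt ?_ (hn₀ n (le_max_left _ _) q hq α₀ α₁ α₂ α₃ (h0.trans hAn)
    (h1.trans hAn) (h2.trans hAn) (h3.trans hAn) hα (theta3 q) (hasSum_theta3 hq))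
  have hpow : (1 / (q : ℝ)) ^ (10 ^ 6 * (2 ^ n ^ 2) ^ 27) =
      Real.exp (-(Real.log q * ((10 ^ 6 * (2 ^ n ^ 2) ^ 27 : ℕ) : ℝ))) := by
    rw [one_div_pow, Real.exp_neg, mul_comm (Real.log _) _, Real.exp_nat_mul,
      Real.exp_log hq0, one_div]
  rw [hpow, Real.exp_le_exp, neg_le_neg_iff]
  exact mul_le_mul_of_nonneg_left (natCast_le_exp_of_le hA hnA) (Real.log_nonneg hq1)
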